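/- For integers k ≥ 3, 1 ≤ ℓ ≤ k−1 and α > 0, there exist ε > 0 and an integer C > 0 such that the following holds for all sufficiently large n divisible by k−ℓ. Suppose H is a k-uniform hypergraph on n vertices with δ₁(H) ≥ α·n^{k−1}, and p = p(n) satisfies p ≥ n^{−(k−ℓ)−ε} if ℓ ≥ 2 and p ≥ C·n^{−(k−1)} if ℓ = 1. Then the union H ∪ 𝔾^{(k)}(n,p) (on the same vertex set) asymptotically almost surely contains a Hamiltonian ℓ-cycle. -/

import Mathlib

open Finset
open scoped Classical

/-- All `k`-subsets of `Fin n` (the possible edges of a `k`-graph on `n` vertices). -/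
def kSets (n k : ℕ) : Finset (Finset (Fin n)) := Finset.univ.powersetCard k

/-- The probability that the binomial random `k`-graph `G^{(k)}(n,p)` (each `k`-set is an
edge independently with probability `p`) has an edge set satisfying the property `A`. -/
noncomputable def gProb (n k : ℕ) (p : ℝ) (A : Finset (Finset (Fin n)) → Prop) : ℝ :=
  ∑ E ∈ (kSets n k).powerset.filter (fun E => A E),
    p ^ E.card * (1 - p) ^ ((kSets n k).card - E.card)

/-- Expectation of a random variable `f` of the random `k`-graph `G^{(k)}(n,p)`. -/
noncomputable def gExpect (n k : ℕ) (p : ℝ) (f : Finset (Finset (Fin n)) → ℝ) : ℝ :=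
  ∑ E ∈ (kSets n k).powerset,
    p ^ E.card * (1 - p) ^ ((kSets n k).card - E.card) * f E

/-- The degree of a vertex set `S` in the `k`-graph with edge set `E`: the number of edges
containing `S` (equivalently, the number of `(k-|S|)`-sets `T` with `S ∪ T ∈ E`). -/
def degOf {n : ℕ} (E : Finset (Finset (Fin n))) (S : Finset (Fin n)) : ℕ :=
  (E.filter (fun e => S ⊆ e)).card

/-- The minimum vertex degree (minimum 1-degree) of a `k`-graph. -/
noncomputable def minVertexDeg {n : ℕ} (E : Finset (Finset (Fin n))) : ℕ :=
  sInf {d : ℕ | ∃ v : Fin n, degOf E {v} = d}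

/-- The index set of the `i`-th edge of the path `P_{a,x}`:
`{x + i*d, x + i*d + 1, …, x + i*d + k - 1}` (here `d = k - ℓ`). -/
def edgeIdx (k d x i : ℕ) : Finset ℕ := (Finset.range k).image (fun j => x + i * d + j)

/-- The ordered `b`-tuple `w` spans a labeled copy of `P_{a,x}` (the `k`-uniform `ℓ`-path
with `a` edges, preceded and followed by `x` isolated vertices) in the edge set `E`. -/
def SpansPax {n : ℕ} (k ℓ a x : ℕ) (E : Finset (Finset (Fin n))) {b : ℕ}
    (w : Fin b → Fin n) : Prop :=
  Function.Injective w ∧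
  ∀ i < a,
    ((Finset.univ.filter (fun m : Fin b => (m : ℕ) ∈ edgeIdx k (k - ℓ) x i)).image w) ∈ E

/-- The ordered tuple `w` spans a labeled copy of the `ℓ`-path `P_a` of length `a` in `E`. -/
def SpansPath {n : ℕ} (k ℓ a : ℕ) (E : Finset (Finset (Fin n))) {b : ℕ}
    (w : Fin b → Fin n) : Prop :=
  SpansPax k ℓ a 0 E w

/-- The first `ℓ`-end of the ordered tuple `w` (its first `ℓ` vertices, as a set). -/
def firstEnd {n b : ℕ} (ℓ : ℕ) (w : Fin b → Fin n) : Finset (Fin n) :=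
  (Finset.univ.filter (fun m : Fin b => (m : ℕ) < ℓ)).image w

/-- The last `ℓ`-end of the ordered tuple `w` (its last `ℓ` vertices, as a set). -/
def lastEnd {n b : ℕ} (ℓ : ℕ) (w : Fin b → Fin n) : Finset (Fin n) :=
  (Finset.univ.filter (fun m : Fin b => b - ℓ ≤ (m : ℕ))).image w

/-- The `k`-graph with edge set `E` on vertex set `Fin n` contains a Hamiltonian `ℓ`-cycle:
there is a cyclic ordering of all `n` vertices such that each of the `n/(k-ℓ)` edges
consists of `k` consecutive vertices, consecutive edges overlapping in `ℓ` vertices. -/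
def IsHamCycle (n k ℓ : ℕ) (E : Finset (Finset (Fin n))) : Prop :=
  ∃ f : ZMod n → Fin n, Function.Bijective f ∧
    ∀ i < n / (k - ℓ),
      ((Finset.range k).image (fun j => f (((i * (k - ℓ) + j : ℕ) : ZMod n)))) ∈ E

/-- The `ℓ`-shadow of a `k`-graph: all `ℓ`-sets contained in some edge. -/
def shadowL {n : ℕ} (ℓ : ℕ) (E : Finset (Finset (Fin n))) : Finset (Finset (Fin n)) :=
  (Finset.univ.powersetCard ℓ).filter (fun S => ∃ e ∈ E, S ⊆ e)

/-- The list `v` of vertices spans a copy of the `ℓ`-path `P_a` of length `a` in `E`. -/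
def ListSpans {n : ℕ} (k ℓ a : ℕ) (E : Finset (Finset (Fin n))) (v : List (Fin n)) : Prop :=
  v.Nodup ∧ v.length = a * (k - ℓ) + ℓ ∧
    ∀ i < a, ((v.drop (i * (k - ℓ))).take k).toFinset ∈ E

/-- `Φ_F(n,p) = min { n^{v_H} p^{e_H} : H ⊆ F, e_H > 0 }`, where the subgraph `H` is given
by a nonempty edge set `E' ⊆ F` together with a vertex set `W` containing all its edges. -/
noncomputable def Phi {V : Type*} (n : ℕ) (p : ℝ) (F : Finset (Finset V)) : ℝ :=
  sInf {r : ℝ | ∃ (W : Finset V) (E' : Finset (Finset V)),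
    E' ⊆ F ∧ E'.Nonempty ∧ (∀ e ∈ E', e ⊆ W) ∧ r = (n : ℝ) ^ W.card * p ^ E'.card}

/-- The ordered tuple `w` spans a labeled copy of the `k`-graph `F` (given by its edge set
`Fe` on vertex set `Fin s`) in the edge set `E`. -/
def SpansCopy {n s : ℕ} (Fe : Finset (Finset (Fin s))) (E : Finset (Finset (Fin n)))
    (w : Fin s → Fin n) : Prop :=
  ∀ e ∈ Fe, e.image w ∈ E

/-- Concatenation of three ordered tuples. -/
def concat3 {n p q r : ℕ} (A : Fin p → Fin n) (C : Fin q → Fin n) (B : Fin r → Fin n)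
    (m : Fin (p + q + r)) : Fin n :=
  if h : (m : ℕ) < p then A ⟨(m : ℕ), h⟩
  else if h2 : (m : ℕ) < p + q then C ⟨(m : ℕ) - p, by omega⟩
  else B ⟨(m : ℕ) - (p + q), by have := m.isLt; omega⟩

/-- `w`, spanning an `ℓ`-path of length `a`, is a `W`-absorber in `E`: it avoids `W`, and
its vertex set together with `W` spans an `ℓ`-path (of length `a+1` when `|W| = k - ℓ`)
with the same two `ℓ`-ends. -/
def IsAbsorber {n : ℕ} (k ℓ a : ℕ) (E : Finset (Finset (Fin n))) {b : ℕ}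
    (w : Fin b → Fin n) (W : Finset (Fin n)) : Prop :=
  (∀ m, w m ∉ W) ∧
  ∃ w' : Fin (b + W.card) → Fin n, SpansPath k ℓ (a + 1) E w' ∧
    Finset.image w' Finset.univ = Finset.image w Finset.univ ∪ W ∧
    firstEnd ℓ w' = firstEnd ℓ w ∧ lastEnd ℓ w' = lastEnd ℓ w

noncomputable def bw {β : Type*} (X : Finset β) (p : ℝ) (F : Finset β → ℝ) : ℝ :=
  ∑ E ∈ X.powerset, p ^ E.card * (1 - p) ^ (X.card - E.card) * F E

lemma bw_empty {β : Type*} (p : ℝ) (F : Finset β → ℝ) : bw ∅ p F = F ∅ := by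
  simp [bw]

lemma bw_insert {β : Type*} {X : Finset β} {x : β} (hx : x ∉ X) (p : ℝ) (F : Finset β → ℝ) :
    bw (insert x X) p F = (1 - p) * bw X p F + p * bw X p (fun E => F (insert x E)) := by
  unfold bw
  rw [Finset.sum_powerset_insert hx, Finset.mul_sum, Finset.mul_sum]
  congr 1
  · refine Finset.sum_congr rfl fun E hE => ?_
    have h1 := Finset.card_le_card (Finset.mem_powerset.1 hE)
    rw [Finset.card_insert_of_notMem hx, show X.card + 1 - E.card = (X.card - E.card) + 1 by omega,
      pow_succ]
    ring
  · refine Finset.sum_congr rfl fun E hE => ?_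
    have h1 : x ∉ E := fun h => hx (Finset.mem_powerset.1 hE h)
    rw [Finset.card_insert_of_notMem hx, Finset.card_insert_of_notMem h1,
      show X.card + 1 - (E.card + 1) = (X.card - E.card) by omega, pow_succ]
    ring

lemma bw_congr {β : Type*} {X : Finset β} {p : ℝ} {F F' : Finset β → ℝ}
    (h : ∀ E ⊆ X, F E = F' E) : bw X p F = bw X p F' := by
  unfold bw
  exact Finset.sum_congr rfl fun E hE => by rw [h E (Finset.mem_powerset.1 hE)]

lemma bw_mono {β : Type*} {X : Finset β} {p : ℝ} (hp0 : 0 ≤ p) (hp1 : p ≤ 1)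
    {F F' : Finset β → ℝ} (h : ∀ E ⊆ X, F E ≤ F' E) : bw X p F ≤ bw X p F' := by
  unfold bw
  refine Finset.sum_le_sum fun E hE => ?_
  have : 0 ≤ 1 - p := by linarith
  exact mul_le_mul_of_nonneg_left (h E (Finset.mem_powerset.1 hE)) (by positivity)

lemma bw_add {β : Type*} (X : Finset β) (p : ℝ) (F F' : Finset β → ℝ) :
    bw X p (fun E => F E + F' E) = bw X p F + bw X p F' := by
  unfold bw
  rw [← Finset.sum_add_distrib]
  exact Finset.sum_congr rfl fun E _ => by ring

lemma bw_mul {β : Type*} (X : Finset β) (p c : ℝ) (F : Finset β → ℝ) :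
    bw X p (fun E => c * F E) = c * bw X p F := by
  unfold bw
  rw [Finset.mul_sum]
  exact Finset.sum_congr rfl fun E _ => by ring

lemma bw_const {β : Type*} (X : Finset β) (p c : ℝ) : bw X p (fun _ => c) = c := by
  induction X using Finset.induction_on with
  | empty => simp [bw_empty]
  | insert x X hx ih => rw [bw_insert hx, ih]; ring

lemma bw_sum {β ι : Type*} (X : Finset β) (p : ℝ) (s : Finset ι) (F : ι → Finset β → ℝ) :
    bw X p (fun E => ∑ i ∈ s, F i E) = ∑ i ∈ s, bw X p (F i) := by
  unfold bw
  rw [Finset.sum_comm]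
  exact Finset.sum_congr rfl fun E _ => by rw [Finset.mul_sum]

lemma bw_union {β : Type*} (X : Finset β) (p p' : ℝ) (F : Finset β → ℝ) :
    bw X p (fun E₁ => bw X p' (fun E₂ => F (E₁ ∪ E₂))) = bw X (p + p' - p * p') F := by
  induction X using Finset.induction_on generalizing F with
  | empty => simp [bw_empty]
  | insert x X hx ih =>
    rw [bw_insert hx, bw_insert hx]
    have e1 : bw X p (fun E₁ => bw (insert x X) p' (fun E₂ => F (E₁ ∪ E₂)))
        = (1 - p') * bw X (p + p' - p * p') F
          + p' * bw X (p + p' - p * p') (fun E => F (insert x E)) := by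
      rw [← ih, ← ih (fun E => F (insert x E)), ← bw_mul, ← bw_mul, ← bw_add]
      refine bw_congr fun E _ => ?_
      rw [bw_insert hx]
      simp only [Finset.union_insert]
    have e2 : bw X p (fun E₁ => bw (insert x X) p' (fun E₂ => F (insert x E₁ ∪ E₂)))
        = bw X (p + p' - p * p') (fun E => F (insert x E)) := by
      rw [← ih (fun E => F (insert x E))]
      refine bw_congr fun E _ => ?_
      rw [bw_insert hx]
      simp only [Finset.union_insert, Finset.insert_union, Finset.insert_idem]
      ring
    rw [e1, e2]
    ring

lemma bw_mono_p {β : Type*} (X : Finset β) {p p' : ℝ} (hp0 : 0 ≤ p) (hpp : p ≤ p') (hp1 : p' ≤ 1)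
    {F : Finset β → ℝ} (hF : ∀ E E', E ⊆ E' → F E ≤ F E') : bw X p F ≤ bw X p' F := by
  rcases eq_or_lt_of_le (hpp.trans hp1) with h | h
  · have : p' = p := by linarith
    rw [this]
  · set q := (p' - p) / (1 - p) with hq
    have h1 : 0 < 1 - p := by linarith
    have hq0 : 0 ≤ q := div_nonneg (by linarith) h1.le
    have hq1 : q ≤ 1 := by rw [hq, div_le_one h1]; linarith
    have : p' = p + q - p * q := by
      rw [hq]; field_simp; ring
    rw [this, ← bw_union]
    refine bw_mono hp0 (by linarith) fun E _ => ?_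
    calc F E = bw X q (fun _ => F E) := (bw_const _ _ _).symm
      _ ≤ _ := bw_mono hq0 hq1 fun E' _ => hF _ _ Finset.subset_union_left

lemma bw_disjoint {β : Type*} {X T : Finset β} (hT : T ⊆ X) (p : ℝ) :
    bw X p (fun E => if Disjoint E T then 1 else 0) = (1 - p) ^ T.card := by
  induction X using Finset.induction_on generalizing T with
  | empty =>
    have : T = ∅ := by simpa using hT
    subst this; simp [bw_empty]
  | insert x X hx ih =>
    rw [bw_insert hx]
    by_cases hxT : x ∈ T
    · have h1 : T.erase x ⊆ X := by
        intro y hy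
        have := hT (Finset.mem_of_mem_erase hy)
        exact (Finset.mem_insert.1 this).resolve_left (Finset.ne_of_mem_erase hy)
      have e1 : bw X p (fun E => if Disjoint E T then (1:ℝ) else 0) = (1 - p) ^ (T.erase x).card := by
        rw [← ih h1]
        refine bw_congr fun E hE => ?_
        have : Disjoint E T ↔ Disjoint E (T.erase x) := by
          have hxE : x ∉ E := fun h => hx (hE h)
          rw [Finset.disjoint_left, Finset.disjoint_left]
          constructor
          · intro h a ha hb; exact h ha (Finset.mem_of_mem_erase hb)
          · intro h a ha hb
            exact h ha (Finset.mem_erase.2 ⟨fun e => hxE (e ▸ ha), hb⟩)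
        simp only [this]
      have e2 : bw X p (fun E => if Disjoint (insert x E) T then (1:ℝ) else 0) = 0 := by
        refine (bw_congr (F' := fun _ => 0) fun E hE => ?_).trans (bw_const X p 0)
        rw [if_neg]
        intro h
        exact Finset.disjoint_left.1 h (Finset.mem_insert_self _ _) hxT
      rw [e1, e2, ← Finset.card_erase_add_one hxT, pow_succ]; ring
    · have h1 : T ⊆ X := fun y hy => (Finset.mem_insert.1 (hT hy)).resolve_left (fun e => hxT (e ▸ hy))
      have e2 : bw X p (fun E => if Disjoint (insert x E) T then (1:ℝ) else 0)
          = bw X p (fun E => if Disjoint E T then (1:ℝ) else 0) := by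
        refine bw_congr fun E hE => ?_
        simp only [Finset.disjoint_insert_left, hxT, not_false_eq_true, true_and]
      rw [e2, ih h1]; ring

lemma gProb_eq_bw (n k : ℕ) (p : ℝ) (A : Finset (Finset (Fin n)) → Prop) :
    gProb n k p A = bw (kSets n k) p (fun E => if A E then 1 else 0) := by
  unfold gProb bw
  rw [Finset.sum_filter]
  exact Finset.sum_congr rfl fun E _ => by by_cases h : A E <;> simp [h]

lemma exists_frag {β ι : Type*} (Ω : Finset ι) (R : ι → Finset β) :
    ∃ Tf : ι → Finset β → Finset β, ∀ ω ∈ Ω, ∀ W, Tf ω W ⊆ R ω ∧ Disjoint W (Tf ω W) ∧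
      (∃ ω' ∈ Ω, R ω' ⊆ W ∪ Tf ω W) ∧
      ∀ ω' ∈ Ω, R ω' ⊆ W ∪ R ω → R ω' ⊆ W ∪ Tf ω W → Tf ω W ⊆ R ω' := by
  have : ∀ ω, ∀ W, ∃ T : Finset β, ω ∈ Ω → (T ⊆ R ω ∧ Disjoint W T ∧
      (∃ ω' ∈ Ω, R ω' ⊆ W ∪ T) ∧
      ∀ ω' ∈ Ω, R ω' ⊆ W ∪ R ω → R ω' ⊆ W ∪ T → T ⊆ R ω') := by
    intro ω W
    by_cases hω : ω ∈ Ω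
    swap
    · exact ⟨∅, fun h => absurd h hω⟩
    obtain ⟨ω₁, h1, h2⟩ := Finset.exists_min_image (Ω.filter fun ω' => R ω' ⊆ W ∪ R ω)
      (fun ω' => (R ω' \ W).card) ⟨ω, by simp [hω, Finset.subset_union_right]⟩
    rw [Finset.mem_filter] at h1
    refine ⟨R ω₁ \ W, fun _ => ⟨?_, Finset.disjoint_sdiff, ⟨ω₁, h1.1, ?_⟩, ?_⟩⟩
    · intro a ha
      rw [Finset.mem_sdiff] at ha
      exact (Finset.mem_union.1 (h1.2 ha.1)).resolve_left ha.2
    · intro a ha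
      by_cases h : a ∈ W <;> simp [h, ha]
    · intro ω' hω' h3 h4
      have h5 := h2 ω' (Finset.mem_filter.2 ⟨hω', h3⟩)
      have h6 : R ω' \ W ⊆ R ω₁ \ W := by
        intro a ha
        rw [Finset.mem_sdiff] at ha
        exact (Finset.mem_union.1 (h4 ha.1)).resolve_left ha.2
      rw [← Finset.eq_of_subset_of_card_le h6 h5]
      exact Finset.sdiff_subset
  choose Tf hTf using this
  exact ⟨Tf, fun ω hω W => hTf ω W hω⟩

lemma frag_count {β ι : Type*} (X : Finset β) (Ω : Finset ι) (R : ι → Finset β)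
    (hne : Ω.Nonempty) (hRX : ∀ ω ∈ Ω, R ω ⊆ X) (Tf : ι → Finset β → Finset β)
    (hTf : ∀ ω ∈ Ω, ∀ W, Tf ω W ⊆ R ω ∧ Disjoint W (Tf ω W) ∧
      (∃ ω' ∈ Ω, R ω' ⊆ W ∪ Tf ω W) ∧
      ∀ ω' ∈ Ω, R ω' ⊆ W ∪ R ω → R ω' ⊆ W ∪ Tf ω W → Tf ω W ⊆ R ω')
    (t : ℕ) (B q M p : ℝ) (hq : 0 ≤ q) (hM : 0 ≤ M) (hp : 0 < p) (hp1 : p ≤ 1)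
    (hB0 : 0 ≤ B)
    (hB : ∀ ω ∈ Ω, (((R ω).card.choose t : ℕ) : ℝ) ≤ B)
    (hS : ∀ S : Finset β, ((Ω.filter fun ω => S ⊆ R ω).card : ℝ) ≤ M * q ^ S.card) :
    bw X p (fun W => ((Ω.filter fun ω => (Tf ω W).card = t).card : ℝ)) ≤ M * B * (q / p) ^ t := by
  have hp1' : 0 ≤ 1 - p := by linarith
  have hhat : ∃ ωh : Finset β → ι, ∀ Z, (∃ ω ∈ Ω, R ω ⊆ Z) → ωh Z ∈ Ω ∧ R (ωh Z) ⊆ Z := by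
    obtain ⟨ω0, _⟩ := hne
    have : ∀ Z : Finset β, ∃ ω, (∃ ω ∈ Ω, R ω ⊆ Z) → ω ∈ Ω ∧ R ω ⊆ Z := by
      intro Z
      by_cases h : ∃ ω ∈ Ω, R ω ⊆ Z
      · obtain ⟨ω, h1, h2⟩ := h
        exact ⟨ω, fun _ => ⟨h1, h2⟩⟩
      · exact ⟨ω0, fun h' => absurd h' h⟩
    choose f hf using this
    exact ⟨f, hf⟩
  obtain ⟨ωh, hωh⟩ := hhat
  set w : Finset β → ℝ := fun W => p ^ W.card * (1 - p) ^ (X.card - W.card) with hw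
  have hw0 : ∀ W, 0 ≤ w W := fun W => by simp only [hw]; positivity
  set P : Finset β → Finset (Finset β) := fun Z =>
    if ωh Z ∈ Ω then (R (ωh Z)).powersetCard t else ∅ with hP
  have key : ∀ W ∈ X.powerset, ∀ ω ∈ Ω, w W * (if (Tf ω W).card = t then 1 else 0)
      ≤ ∑ Z ∈ X.powerset, ∑ T ∈ P Z,
        (if T ⊆ R ω then 1 else 0) * (if W = Z \ T then 1 else 0) * (w Z * (1 / p) ^ t) := by
    intro W hW ω hω
    have hpos : ∀ Z ∈ X.powerset, ∀ T ∈ P Z, 0 ≤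
        (if T ⊆ R ω then (1:ℝ) else 0) * (if W = Z \ T then 1 else 0) * (w Z * (1 / p) ^ t) := by
      intro Z _ T _
      have := hw0 Z
      positivity
    by_cases ht : (Tf ω W).card = t
    swap
    · rw [if_neg ht, mul_zero]
      exact Finset.sum_nonneg fun Z hZ => Finset.sum_nonneg fun T hT => hpos Z hZ T hT
    rw [if_pos ht, mul_one]
    obtain ⟨h1, h2, h3, h4⟩ := hTf ω hω W
    set T := Tf ω W with hT
    have hWX := Finset.mem_powerset.1 hW
    have hZX : W ∪ T ∈ X.powerset := Finset.mem_powerset.2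
      (Finset.union_subset hWX (h1.trans (hRX ω hω)))
    obtain ⟨h5, h6⟩ := hωh (W ∪ T) h3
    have hTR : T ⊆ R (ωh (W ∪ T)) :=
      h4 _ h5 (h6.trans (Finset.union_subset_union_right h1)) h6
    have hTP : T ∈ P (W ∪ T) := by
      simp only [hP, if_pos h5]
      exact Finset.mem_powersetCard.2 ⟨hTR, ht⟩
    refine le_trans ?_ (Finset.single_le_sum
      (fun Z hZ => Finset.sum_nonneg fun T hT => hpos Z hZ T hT) hZX)
    refine le_trans ?_ (Finset.single_le_sum (hpos _ hZX) hTP)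
    have hWZ : W = (W ∪ T) \ T := by
      rw [Finset.union_sdiff_right, Finset.sdiff_eq_self_of_disjoint h2]
    rw [if_pos h1, if_pos hWZ, one_mul, one_mul]
    have hc : (W ∪ T).card = W.card + t := by rw [Finset.card_union_of_disjoint h2, ht]
    have hc2 : W.card + t ≤ X.card := by
      rw [← hc]; exact Finset.card_le_card (Finset.mem_powerset.1 hZX)
    simp only [hw, hc]
    have e1 : p ^ (W.card + t) * (1 - p) ^ (X.card - (W.card + t)) * (1 / p) ^ t
        = p ^ W.card * (1 - p) ^ (X.card - (W.card + t)) := by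
      rw [pow_add, one_div, inv_pow]; field_simp
    rw [e1]
    refine mul_le_mul_of_nonneg_left ?_ (by positivity)
    exact pow_le_pow_of_le_one hp1' (by linarith) (by omega)
  have hsum : bw X p (fun W => ((Ω.filter fun ω => (Tf ω W).card = t).card : ℝ))
      = ∑ W ∈ X.powerset, ∑ ω ∈ Ω, w W * (if (Tf ω W).card = t then 1 else 0) := by
    unfold bw
    refine Finset.sum_congr rfl fun W _ => ?_
    rw [← Finset.mul_sum]
    beta_reduce
    rw [Finset.card_filter]
    push_cast
    rfl
  rw [hsum]
  calc ∑ W ∈ X.powerset, ∑ ω ∈ Ω, w W * (if (Tf ω W).card = t then 1 else 0)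
      ≤ ∑ W ∈ X.powerset, ∑ ω ∈ Ω, ∑ Z ∈ X.powerset, ∑ T ∈ P Z,
        (if T ⊆ R ω then 1 else 0) * (if W = Z \ T then 1 else 0) * (w Z * (1 / p) ^ t) :=
        Finset.sum_le_sum fun W hW => Finset.sum_le_sum fun ω hω => key W hW ω hω
    _ = ∑ Z ∈ X.powerset, ∑ T ∈ P Z, ∑ ω ∈ Ω, ∑ W ∈ X.powerset,
        (if T ⊆ R ω then 1 else 0) * (if W = Z \ T then 1 else 0) * (w Z * (1 / p) ^ t) := by
        rw [Finset.sum_comm]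
        simp_rw [fun ω => Finset.sum_comm (s := X.powerset) (t := X.powerset)
          (f := fun W Z => ∑ T ∈ P Z, (if T ⊆ R ω then (1:ℝ) else 0) *
            (if W = Z \ T then 1 else 0) * (w Z * (1 / p) ^ t))]
        rw [Finset.sum_comm]
        refine Finset.sum_congr rfl fun Z _ => ?_
        simp_rw [fun ω => Finset.sum_comm (s := X.powerset) (t := P Z)
          (f := fun W T => (if T ⊆ R ω then (1:ℝ) else 0) *
            (if W = Z \ T then 1 else 0) * (w Z * (1 / p) ^ t))]
        rw [Finset.sum_comm]
    _ ≤ ∑ Z ∈ X.powerset, ∑ T ∈ P Z, (M * q ^ t) * (w Z * (1 / p) ^ t) := by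
        refine Finset.sum_le_sum fun Z hZ => Finset.sum_le_sum fun T hT => ?_
        have hZ0 : 0 ≤ w Z * (1 / p) ^ t := by have := hw0 Z; positivity
        simp_rw [← Finset.sum_mul, ← Finset.mul_sum]
        refine mul_le_mul_of_nonneg_right ?_ hZ0
        rw [← Finset.sum_mul]
        have hTc : T.card = t := by
          simp only [hP] at hT
          split_ifs at hT with h
          · exact (Finset.mem_powersetCard.1 hT).2
          · simp at hT
        have h1 : ∑ i ∈ X.powerset, (if i = Z \ T then (1:ℝ) else 0) ≤ 1 := by
          rw [Finset.sum_ite_eq']; split_ifs <;> norm_num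
        have h2 := hS T
        rw [Finset.card_filter] at h2
        push_cast at h2
        rw [hTc] at h2
        have h3 : 0 ≤ ∑ i ∈ Ω, (if T ⊆ R i then (1:ℝ) else 0) :=
          Finset.sum_nonneg fun i _ => by split_ifs <;> norm_num
        nlinarith
    _ ≤ ∑ Z ∈ X.powerset, w Z * (M * B * (q / p) ^ t) := by
        refine Finset.sum_le_sum fun Z hZ => ?_
        rw [Finset.sum_const, nsmul_eq_mul]
        have hc : ((P Z).card : ℝ) ≤ B := by
          simp only [hP]
          split_ifs with h
          · rw [Finset.card_powersetCard]; exact hB _ h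
          · simpa using hB0
        have e : w Z * (M * B * (q / p) ^ t) = B * (M * q ^ t * (w Z * (1 / p) ^ t)) := by
          rw [div_eq_mul_one_div q p, mul_pow]; ring
        rw [e]
        have := hw0 Z
        exact mul_le_mul_of_nonneg_right hc (by positivity)
    _ = M * B * (q / p) ^ t := by
        exact bw_const X p (M * B * (q / p) ^ t)

lemma choose_bound {r t : ℕ} {ρ : ℝ} (hρ : 0 ≤ ρ) (ht : 1 ≤ t) (h : (r : ℝ) ≤ ρ * t) :
    ((r.choose t : ℕ) : ℝ) ≤ (Real.exp 1 * ρ) ^ t := by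
  have h1 : ((r.choose t : ℕ) : ℝ) ≤ (r : ℝ) ^ t / (t.factorial : ℝ) := Nat.choose_le_pow_div t r
  have ht0 : (0 : ℝ) < t := by exact_mod_cast ht
  have h2 := Real.pow_div_factorial_le_exp (t : ℝ) ht0.le t
  have hf : (0 : ℝ) < t.factorial := by exact_mod_cast t.factorial_pos
  calc ((r.choose t : ℕ) : ℝ) ≤ (r : ℝ) ^ t / (t.factorial : ℝ) := h1
    _ ≤ (ρ * t) ^ t / (t.factorial : ℝ) := by gcongr
    _ = ρ ^ t * ((t : ℝ) ^ t / (t.factorial : ℝ)) := by rw [mul_pow]; ring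
    _ ≤ ρ ^ t * Real.exp t := by gcongr
    _ = (Real.exp 1 * ρ) ^ t := by rw [mul_pow, ← Real.exp_nat_mul, mul_one]; ring

lemma geom_bound (x : ℝ) (hx0 : 0 ≤ x) (hx : x ≤ 1 / 2) (s : Finset ℕ) (hs : ∀ t ∈ s, 1 ≤ t) :
    ∑ t ∈ s, x ^ t ≤ 2 * x := by
  have h1 : ∑ t ∈ s, x ^ t ≤ ∑ t ∈ Finset.Ico 1 (s.sup id + 1), x ^ t := by
    refine Finset.sum_le_sum_of_subset_of_nonneg ?_ fun _ _ _ => by positivity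
    intro t ht
    rw [Finset.mem_Ico]
    exact ⟨hs t ht, Nat.lt_succ_of_le (Finset.le_sup (f := id) ht)⟩
  refine h1.trans ?_
  have h2 := geom_sum_Ico_le_of_lt_one (m := 1) (n := s.sup id + 1) hx0 (by linarith)
  refine h2.trans ?_
  rw [pow_one, div_le_iff₀ (by linarith)]
  nlinarith

lemma frag_iter {β : Type*} {ι : Type*} (X : Finset β) (ρ q p : ℝ) (hρ : 1 ≤ ρ) (hq : 0 ≤ q) (hp : 0 < p)
    (hx : Real.exp 1 * ρ * (q / p) ≤ 1 / 2) :
    ∀ (J : ℕ) (Ω : Finset ι) (R : ι → Finset β) (K : ℝ), J * p ≤ 1 → Ω.Nonempty → 0 ≤ K →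
      (∀ ω ∈ Ω, R ω ⊆ X) → (∀ ω ∈ Ω, ((R ω).card : ℝ) < ρ ^ J) →
      (∀ S : Finset β, ((Ω.filter fun ω => S ⊆ R ω).card : ℝ) ≤ K * Ω.card * q ^ S.card) →
      1 - 4 * K * (Real.exp 1 * ρ * (q / p)) * (2 ^ J - 1) ≤
        bw X (J * p) (fun E => if ∃ ω ∈ Ω, R ω ⊆ E then 1 else 0) := by
  intro J
  have hρ0 : 0 ≤ ρ := by linarith
  induction J with
  | zero =>
    intro Ω R K _ hne hK _ hR _
    obtain ⟨ω, hω⟩ := hne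
    have h0 : R ω = ∅ := by
      have := hR ω hω
      rw [pow_zero] at this
      rw [← Finset.card_eq_zero]
      have : (R ω).card < 1 := by exact_mod_cast this
      omega
    have : bw X ((0:ℕ) * p) (fun E => if ∃ ω ∈ Ω, R ω ⊆ E then (1:ℝ) else 0) = 1 := by
      refine (bw_congr (F' := fun _ => 1) fun E _ => ?_).trans (bw_const _ _ _)
      rw [if_pos ⟨ω, hω, by simp [h0]⟩]
    rw [this]; simp
  | succ J ih =>
    intro Ω R K hJp hne hK hRX hR hS
    set x := Real.exp 1 * ρ * (q / p) with hxdef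
    have hx0 : 0 ≤ x := by positivity
    have hp1 : p ≤ 1 := by
      push_cast at hJp
      have : 0 ≤ (J : ℝ) * p := by positivity
      nlinarith
    have hJp' : (J : ℝ) * p ≤ 1 := by push_cast at hJp; nlinarith
    have hΩ : (0 : ℝ) < Ω.card := by exact_mod_cast hne.card_pos
    obtain ⟨Tf, hTf⟩ := exists_frag Ω R
    set bad : Finset β → Finset ι := fun W => Ω.filter fun ω => ρ ^ J ≤ ((Tf ω W).card : ℝ) with hbad
    set s : Finset ℕ := (Finset.range (X.card + 1)).filter fun t : ℕ => ρ ^ J ≤ (t : ℝ) with hs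
    have hs1 : ∀ t ∈ s, 1 ≤ t := by
      intro t ht
      have h1 : ρ ^ J ≤ (t : ℝ) := (Finset.mem_filter.1 ht).2
      have h2 : (1:ℝ) ≤ t := (one_le_pow₀ hρ).trans h1
      exact_mod_cast h2
    have hbadW : bw X p (fun W => ((bad W).card : ℝ)) ≤ K * Ω.card * (2 * x) := by
      have h1 : bw X p (fun W => ((bad W).card : ℝ)) ≤
          bw X p (fun W => ∑ t ∈ s, ((Ω.filter fun ω => (Tf ω W).card = t).card : ℝ)) := by
        refine bw_mono hp.le hp1 fun W hW => ?_
        rw [← Nat.cast_sum, Nat.cast_le]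
        have : bad W ⊆ s.biUnion (fun t => Ω.filter fun ω => (Tf ω W).card = t) := by
          intro ω hω
          obtain ⟨h1, h2⟩ := Finset.mem_filter.1 hω
          refine Finset.mem_biUnion.2 ⟨(Tf ω W).card, ?_, Finset.mem_filter.2 ⟨h1, rfl⟩⟩
          refine Finset.mem_filter.2 ⟨?_, h2⟩
          rw [Finset.mem_range]
          exact Nat.lt_succ_of_le (Finset.card_le_card ((hTf ω h1 W).1.trans (hRX ω h1)))
        exact (Finset.card_le_card this).trans Finset.card_biUnion_le
      refine h1.trans ?_
      rw [bw_sum]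
      calc ∑ t ∈ s, bw X p (fun W => ((Ω.filter fun ω => (Tf ω W).card = t).card : ℝ))
          ≤ ∑ t ∈ s, K * Ω.card * x ^ t := by
            refine Finset.sum_le_sum fun t ht => ?_
            have ht1 := hs1 t ht
            have ht2 : ρ ^ J ≤ (t : ℝ) := (Finset.mem_filter.1 ht).2
            have := frag_count X Ω R hne hRX Tf hTf t ((Real.exp 1 * ρ) ^ t) q (K * Ω.card) p hq
              (by positivity) hp hp1 (by positivity) (fun ω hω => choose_bound hρ0 ht1 (by
                have := (hR ω hω).le
                rw [pow_succ] at this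
                nlinarith)) hS
            refine this.trans (le_of_eq ?_)
            rw [hxdef, mul_pow (Real.exp 1 * ρ), mul_assoc]
        _ = K * Ω.card * ∑ t ∈ s, x ^ t := by rw [Finset.mul_sum]
        _ ≤ K * Ω.card * (2 * x) := by
            have := geom_bound x hx0 hx s hs1
            gcongr
    set a := 4 * (2 * K) * x * (2 ^ J - 1) with ha
    have h2J : (1:ℝ) ≤ 2 ^ J := one_le_pow₀ (by norm_num)
    have ha0 : 0 ≤ a := by
      have : (0:ℝ) ≤ 2 ^ J - 1 := by linarith
      positivity
    set G : Finset β → ℝ := fun E => if ∃ ω ∈ Ω, R ω ⊆ E then 1 else 0 with hG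
    have hinner : ∀ W ⊆ X, 1 - 2 / Ω.card * ((bad W).card : ℝ) - a ≤
        bw X (J * p) (fun E₂ => G (W ∪ E₂)) := by
      intro W hW
      by_cases hb : 2 * ((bad W).card : ℝ) ≤ Ω.card
      · set Ω' := Ω.filter fun ω => ((Tf ω W).card : ℝ) < ρ ^ J with hΩ'
        have hcard : (bad W).card + Ω'.card = Ω.card := by
          rw [← Finset.card_filter_add_card_filter_not (s := Ω) (fun ω => ρ ^ J ≤ ((Tf ω W).card : ℝ))]
          congr 2
          refine Finset.filter_congr fun ω _ => ?_
          rw [not_le]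
        have hcard' : ((bad W).card : ℝ) + Ω'.card = Ω.card := by exact_mod_cast hcard
        have hne' : Ω'.Nonempty := by
          rw [← Finset.card_pos]
          have : (0 : ℝ) < Ω'.card := by linarith
          exact_mod_cast this
        have := ih Ω' (fun ω => Tf ω W) (2 * K) hJp' hne' (by positivity)
          (fun ω hω => ((hTf ω (Finset.mem_filter.1 hω).1 W).1.trans (hRX ω (Finset.mem_filter.1 hω).1)))
          (fun ω hω => (Finset.mem_filter.1 hω).2) (fun S => by
            have h1 : ((Ω'.filter fun ω => S ⊆ Tf ω W).card : ℝ) ≤ (Ω.filter fun ω => S ⊆ R ω).card := by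
              rw [Nat.cast_le]
              refine Finset.card_le_card fun ω hω => ?_
              obtain ⟨h1, h2⟩ := Finset.mem_filter.1 hω
              have h3 := (Finset.mem_filter.1 h1).1
              exact Finset.mem_filter.2 ⟨h3, h2.trans (hTf ω h3 W).1⟩
            refine (h1.trans (hS S)).trans ?_
            have : (Ω.card : ℝ) ≤ 2 * Ω'.card := by linarith
            calc K * Ω.card * q ^ S.card ≤ K * (2 * Ω'.card) * q ^ S.card := by gcongr
              _ = _ := by ring)
        have hpos : 0 ≤ 2 / Ω.card * ((bad W).card : ℝ) := by positivity
        refine le_trans (by linarith) (this.trans ?_)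
        refine bw_mono (by positivity) hJp' fun E _ => ?_
        split_ifs with h
        · obtain ⟨ω, hω, hE⟩ := h
          obtain ⟨ω', h1, h2⟩ := (hTf ω (Finset.mem_filter.1 hω).1 W).2.2.1
          simp only [hG]
          rw [if_pos ⟨ω', h1, h2.trans (Finset.union_subset_union_right hE)⟩]
        · simp only [hG]; split_ifs <;> norm_num
      · have h1 : 1 ≤ 2 / Ω.card * ((bad W).card : ℝ) := by
          rw [div_mul_eq_mul_div, le_div_iff₀ hΩ]; linarith
        have h2 : 0 ≤ bw X (J * p) (fun E₂ => G (W ∪ E₂)) := by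
          rw [← bw_const X (J * p) 0]
          refine bw_mono (by positivity) hJp' fun E _ => ?_
          simp only [hG]; split_ifs <;> norm_num
        linarith
    have hGmono : ∀ E E', E ⊆ E' → G E ≤ G E' := by
      intro E E' h
      simp only [hG]
      split_ifs with h1 h2 <;> try norm_num
      obtain ⟨ω, hω, h3⟩ := h1
      exact h2 ⟨ω, hω, h3.trans h⟩
    calc 1 - 4 * K * x * (2 ^ (J + 1) - 1)
        = (1 - a) - 2 / Ω.card * (K * Ω.card * (2 * x)) := by
          rw [ha, pow_succ]; field_simp; ring
      _ ≤ (1 - a) - 2 / Ω.card * bw X p (fun W => ((bad W).card : ℝ)) := by gcongr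
      _ = bw X p (fun W => (1 - a) + (- (2 / Ω.card)) * ((bad W).card : ℝ)) := by
          rw [bw_add, bw_const, bw_mul]; ring
      _ ≤ bw X p (fun W => bw X (J * p) (fun E₂ => G (W ∪ E₂))) := by
          refine bw_mono hp.le hp1 fun W hW => ?_
          have := hinner W hW
          linarith
      _ = bw X (p + J * p - p * (J * p)) G := bw_union _ _ _ _
      _ ≤ bw X ((J + 1 : ℕ) * p) G := by
          have h0 : 0 ≤ p * (J * p) := by positivity
          refine bw_mono_p X ?_ ?_ hJp hGmono
          · have : 0 ≤ (J : ℝ) * p := by positivity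
            nlinarith
          · push_cast; linarith

lemma exists_blockSwap {P ι : Type*} (b y : ι → P) (hb : Function.Injective b)
    (hy : Function.Injective y) (hby : ∀ i j, b i ≠ y j) :
    ∃ σ : Equiv.Perm P, (∀ i, σ (b i) = y i) ∧ (∀ i, σ (y i) = b i) ∧
      ∀ x, (∀ i, x ≠ b i) → (∀ i, x ≠ y i) → σ x = x := by
  set f : P → P := fun x => if h : ∃ i, x = b i then y h.choose else
    if h : ∃ i, x = y i then b h.choose else x with hf
  have h1 : ∀ i, f (b i) = y i := by
    intro i
    have h : ∃ j, b i = b j := ⟨i, rfl⟩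
    simp only [hf]
    rw [dif_pos h]
    rw [← hb h.choose_spec]
  have h2 : ∀ i, f (y i) = b i := by
    intro i
    have h : ∃ j, y i = y j := ⟨i, rfl⟩
    have h' : ¬ ∃ j, y i = b j := by rintro ⟨j, hj⟩; exact hby j i hj.symm
    simp only [hf]
    rw [dif_neg h', dif_pos h]
    rw [← hy h.choose_spec]
  have h3 : ∀ x, (∀ i, x ≠ b i) → (∀ i, x ≠ y i) → f x = x := by
    intro x hx hx'
    have e1 : ¬ ∃ i, x = b i := by rintro ⟨i, hi⟩; exact hx i hi
    have e2 : ¬ ∃ i, x = y i := by rintro ⟨i, hi⟩; exact hx' i hi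
    simp only [hf]
    rw [dif_neg e1, dif_neg e2]
  have hinv : Function.Involutive f := by
    intro x
    by_cases e1 : ∃ i, x = b i
    · obtain ⟨i, rfl⟩ := e1; rw [h1, h2]
    by_cases e2 : ∃ i, x = y i
    · obtain ⟨i, rfl⟩ := e2; rw [h2, h1]
    push Not at e1 e2
    rw [h3 x e1 e2, h3 x e1 e2]
  exact ⟨hinv.toPerm f, h1, h2, h3⟩

lemma card_edges_meeting {n k : ℕ} (hk : 1 ≤ k) (H : Finset (Finset (Fin n))) (hH : H ⊆ kSets n k)
    (Q : Finset (Fin n)) : (H.filter fun e => ¬ Disjoint e Q).card ≤ Q.card * n ^ (k - 1) := by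
  have h1 : (H.filter fun e => ¬ Disjoint e Q) ⊆ Q.biUnion fun v =>
      ((Finset.univ : Finset (Fin n)).powersetCard (k - 1)).image (fun f => insert v f) := by
    intro e he
    obtain ⟨he1, he2⟩ := Finset.mem_filter.1 he
    rw [Finset.not_disjoint_iff] at he2
    obtain ⟨v, hv, hvQ⟩ := he2
    refine Finset.mem_biUnion.2 ⟨v, hvQ, Finset.mem_image.2 ⟨e.erase v, ?_, Finset.insert_erase hv⟩⟩
    have := (Finset.mem_powersetCard.1 (hH he1)).2
    exact Finset.mem_powersetCard.2 ⟨Finset.subset_univ _, by rw [Finset.card_erase_of_mem hv, this]⟩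
  refine (Finset.card_le_card h1).trans ?_
  refine Finset.card_biUnion_le_card_mul _ _ _ fun v _ => ?_
  refine Finset.card_image_le.trans ?_
  rw [Finset.card_powersetCard, Finset.card_univ, Fintype.card_fin]
  exact Nat.choose_le_pow n (k - 1)

/-- free tuples spanning an edge -/
noncomputable def freeTup {n k : ℕ} {P : Type*} [Fintype P] (H : Finset (Finset (Fin n)))
    (F : Finset P) (π : P ≃ Fin n) : Finset (Fin k → P) :=
  Finset.univ.filter fun y => Function.Injective y ∧ (∀ i, y i ∈ F) ∧
    Finset.univ.image (fun i => π (y i)) ∈ H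

lemma card_freeTup {n k : ℕ} (hk : 1 ≤ k) {P : Type*} [Fintype P] (H : Finset (Finset (Fin n)))
    (hH : H ⊆ kSets n k) (F : Finset P) (π : P ≃ Fin n) :
    H.card ≤ (freeTup (k := k) H F π).card + (Fᶜ).card * n ^ (k - 1) := by
  set Q : Finset (Fin n) := (Fᶜ).image π with hQ
  have hQc : Q.card = (Fᶜ).card := Finset.card_image_of_injective _ π.injective
  have h0 := card_edges_meeting hk H hH Q
  have h1 : (H.filter fun e => Disjoint e Q).card ≤ (freeTup (k := k) H F π).card := by
    have : (H.filter fun e => Disjoint e Q) ⊆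
        (freeTup (k := k) H F π).image (fun y => Finset.univ.image (fun i => π (y i))) := by
      intro e he
      obtain ⟨he1, he2⟩ := Finset.mem_filter.1 he
      have hc := (Finset.mem_powersetCard.1 (hH he1)).2
      have eqv : Fin k ≃ e := (e.equivFinOfCardEq hc).symm
      refine Finset.mem_image.2 ⟨fun i => π.symm (eqv i), Finset.mem_filter.2
        ⟨Finset.mem_univ _, ?_, ?_, ?_⟩, ?_⟩
      · intro i j hij
        exact eqv.injective (Subtype.ext (π.symm.injective hij))
      · intro i
        by_contra hi
        refine Finset.disjoint_left.1 he2 (eqv i).2 ?_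
        rw [hQ]
        exact Finset.mem_image.2 ⟨π.symm (eqv i), by simpa using hi, by simp⟩
      · have : Finset.univ.image (fun i => π (π.symm (eqv i))) = e := by
          ext v
          simp only [Equiv.apply_symm_apply, Finset.mem_image, Finset.mem_univ, true_and]
          constructor
          · rintro ⟨i, rfl⟩; exact (eqv i).2
          · intro hv; exact ⟨eqv.symm ⟨v, hv⟩, by simp⟩
        rw [this]; exact he1
      · ext v
        simp only [Equiv.apply_symm_apply, Finset.mem_image, Finset.mem_univ, true_and]
        constructor
        · rintro ⟨i, rfl⟩; exact (eqv i).2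
        · intro hv; exact ⟨eqv.symm ⟨v, hv⟩, by simp⟩
    exact (Finset.card_le_card this).trans Finset.card_image_le
  have h2 := Finset.card_filter_add_card_filter_not (s := H) (fun e => Disjoint e Q)
  rw [hQc] at h0
  omega

section spread
variable {n k N : ℕ} {P : Type*} [Fintype P]

noncomputable def freePos (B : Fin N → Fin k → P) : Finset P :=
  Finset.univ.filter fun x => ∀ j i, x ≠ B j i

/-- bijections with all blocks being edges and prescribed on `T` -/
noncomputable def blkOm (H : Finset (Finset (Fin n))) (B : Fin N → Fin k → P)
    (g : P → Fin n) (T : Finset P) : Finset (P ≃ Fin n) :=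
  Finset.univ.filter fun π => (∀ j, Finset.univ.image (fun i => π (B j i)) ∈ H) ∧ ∀ x ∈ T, π x = g x

lemma blk_step (hk : 1 ≤ k) (H : Finset (Finset (Fin n))) (hH : H ⊆ kSets n k)
    (B : Fin N → Fin k → P) (hB : Function.Injective (fun x : Fin N × Fin k => B x.1 x.2))
    (hP : Fintype.card P = n) (g : P → Fin n) (T : Finset P) (j : Fin N)
    (hT1 : Disjoint T (freePos B)) (hT2 : ∀ i, B j i ∉ T) (I : Finset (Fin k)) :
    (blkOm H B g (T ∪ I.image (B j))).card * (H.card - (N * k) * n ^ (k - 1)) ≤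
      (blkOm H B g T).card * n ^ (k - I.card) := by
  have hBj : ∀ j, Function.Injective (B j) := by
    intro j i i' h
    have := @hB (j, i) (j, i') h
    exact (Prod.mk.inj this).2
  have hfc : (freePos B)ᶜ.card ≤ N * k := by
    have : (freePos B)ᶜ ⊆ Finset.univ.image (fun x : Fin N × Fin k => B x.1 x.2) := by
      intro x hx
      simp only [freePos, Finset.mem_compl, Finset.mem_filter, Finset.mem_univ, true_and] at hx
      push Not at hx
      obtain ⟨j, i, h⟩ := hx
      exact Finset.mem_image.2 ⟨(j, i), Finset.mem_univ _, h.symm⟩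
    refine (Finset.card_le_card this).trans (Finset.card_image_le.trans ?_)
    simp
  have hsw : ∀ y : Fin k → P, ∃ σ : Equiv.Perm P, Function.Injective y → (∀ i, y i ∈ freePos B) →
      ((∀ i, σ (B j i) = y i) ∧ (∀ i, σ (y i) = B j i) ∧
      ∀ x, (∀ i, x ≠ B j i) → (∀ i, x ≠ y i) → σ x = x) := by
    intro y
    by_cases h : Function.Injective y ∧ (∀ i, y i ∈ freePos B)
    · obtain ⟨σ, hσ⟩ := exists_blockSwap (B j) y (hBj j) h.1 (fun i i' hh => by
        have := (Finset.mem_filter.1 (h.2 i')).2 j i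
        exact this hh.symm)
      exact ⟨σ, fun _ _ => hσ⟩
    · exact ⟨1, fun h1 h2 => absurd ⟨h1, h2⟩ h⟩
  choose sw hsw using hsw
  set S := (blkOm H B g (T ∪ I.image (B j))).sigma (fun π => freeTup (k := k) H (freePos B) π) with hS
  set D := (blkOm H B g T).sigma (fun π => Fintype.piFinset
    (fun i => if i ∈ I then ({π.symm (g (B j i))} : Finset P) else Finset.univ)) with hD
  have hSD : S.card ≤ D.card := by
    refine Finset.card_le_card_of_injOn
      (fun x => (⟨(sw x.2).trans x.1, x.2⟩ : Σ _ : P ≃ Fin n, Fin k → P)) ?_ ?_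
    · rintro ⟨π, y⟩ hx
      simp only [hS, Finset.mem_coe, Finset.mem_sigma] at hx
      obtain ⟨h1, h2⟩ := hx
      simp only [blkOm, Finset.mem_filter, Finset.mem_univ, true_and] at h1
      simp only [freeTup, Finset.mem_filter, Finset.mem_univ, true_and] at h2
      obtain ⟨h1a, h1b⟩ := h1
      obtain ⟨h2a, h2b, h2c⟩ := h2
      obtain ⟨s1, s2, s3⟩ := hsw y h2a h2b
      simp only [hD, Finset.mem_coe, Finset.mem_sigma, blkOm, Finset.mem_filter, Finset.mem_univ,
        true_and, Fintype.mem_piFinset]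
      have hyne : ∀ i j' i', y i ≠ B j' i' := fun i j' i' => (Finset.mem_filter.1 (h2b i)).2 j' i'
      refine ⟨⟨?_, ?_⟩, ?_⟩
      · intro j'
        by_cases hj : j' = j
        · subst hj
          simpa [s1] using h2c
        · have : ∀ i, (sw y) (B j' i) = B j' i := by
            intro i
            refine s3 _ (fun i' hh => hj ?_) (fun i' hh => hyne _ _ _ hh.symm)
            have := @hB (j', i) (j, i') hh
            exact (Prod.mk.inj this).1
          simpa [this] using h1a j'
      · intro x hx
        have : sw y x = x := by
          refine s3 _ (fun i hh => hT2 i (hh ▸ hx)) (fun i hh => ?_)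
          exact Finset.disjoint_left.1 hT1 hx (hh ▸ h2b i)
        simp only [Equiv.trans_apply, this]
        exact h1b x (Finset.mem_union_left _ hx)
      · intro i
        split_ifs with hi
        · rw [Finset.mem_singleton, Equiv.eq_symm_apply]
          simp only [Equiv.trans_apply, s2]
          exact h1b _ (Finset.mem_union_right _ (Finset.mem_image_of_mem _ hi))
        · exact Finset.mem_univ _
    · rintro ⟨π, y⟩ hx ⟨π', y'⟩ hx' h
      simp only [Sigma.mk.injEq, heq_eq_eq] at h
      obtain ⟨h1, h2⟩ := h
      subst h2
      congr 1
      ext x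
      have := congrArg (fun e : P ≃ Fin n => e ((sw y).symm x)) h1
      simpa using congrArg Fin.val this
  have hD' : D.card = (blkOm H B g T).card * n ^ (k - I.card) := by
    rw [hD, Finset.card_sigma, Finset.sum_const_nat]
    intro π _
    rw [Fintype.card_piFinset]
    have : ∀ i : Fin k, (if i ∈ I then ({π.symm (g (B j i))} : Finset P) else Finset.univ).card
        = if i ∈ I then 1 else n := by
      intro i; split_ifs <;> simp [hP]
    simp_rw [this]
    rw [Finset.prod_ite, Finset.prod_const_one, one_mul, Finset.prod_const]
    congr 1
    rw [Finset.filter_not, Finset.card_sdiff_of_subset (Finset.filter_subset _ _)]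
    simp
  have hS' : (blkOm H B g (T ∪ I.image (B j))).card * (H.card - (N * k) * n ^ (k - 1)) ≤ S.card := by
    rw [hS, Finset.card_sigma, ← smul_eq_mul]
    refine Finset.card_nsmul_le_sum _ _ _ fun π _ => ?_
    have h1 := card_freeTup hk H hH (freePos B) π
    have h2 : (freePos B)ᶜ.card * n ^ (k - 1) ≤ (N * k) * n ^ (k - 1) := Nat.mul_le_mul_right _ hfc
    omega
  rw [← hD']
  exact hS'.trans hSD

lemma free_step (H : Finset (Finset (Fin n)))
    (B : Fin N → Fin k → P) (g : P → Fin n) (T : Finset P) (x : P) (hx : x ∈ freePos B) (hxT : x ∉ T) :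
    (blkOm H B g (insert x T)).card * ((freePos B) \ T).card ≤ (blkOm H B g T).card := by
  rw [← Finset.card_product]
  refine Finset.card_le_card_of_injOn (fun z => (Equiv.swap x z.2).trans z.1) ?_ ?_
  · rintro ⟨π, y⟩ hz
    simp only [Finset.mem_coe, Finset.mem_product, Finset.mem_sdiff] at hz
    obtain ⟨h1, h2, h3⟩ := hz
    simp only [blkOm, Finset.mem_coe, Finset.mem_filter, Finset.mem_univ, true_and] at h1 ⊢
    have hx' := (Finset.mem_filter.1 hx).2
    have hy' := (Finset.mem_filter.1 h2).2
    refine ⟨fun j => ?_, fun z hz => ?_⟩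
    · have : ∀ i, Equiv.swap x y (B j i) = B j i := fun i =>
        Equiv.swap_apply_of_ne_of_ne (hx' j i).symm (hy' j i).symm
      simpa [this] using h1.1 j
    · have : Equiv.swap x y z = z := Equiv.swap_apply_of_ne_of_ne
        (fun h => hxT (h ▸ hz)) (fun h => h3 (h ▸ hz))
      simp only [Equiv.trans_apply, this]
      exact h1.2 z (Finset.mem_insert_of_mem hz)
  · rintro ⟨π, y⟩ hz ⟨π', y'⟩ hz' h
    simp only [Finset.mem_coe, Finset.mem_product, blkOm, Finset.mem_filter, Finset.mem_univ,
      true_and] at hz hz'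
    have e1 : π x = g x := hz.1.2 x (Finset.mem_insert_self _ _)
    have e2 : π' x = g x := hz'.1.2 x (Finset.mem_insert_self _ _)
    simp only at h
    have h1 := congrArg (fun e : P ≃ Fin n => e y) h
    simp only [Equiv.trans_apply, Equiv.swap_apply_right, e1] at h1
    rw [← e2] at h1
    have h2 := π'.injective h1
    have hy : y = y' := by
      have := congrArg (Equiv.swap x y') h2
      simpa using this.symm
    subst hy
    congr 1
    ext z
    have := congrArg (fun e : P ≃ Fin n => e (Equiv.swap x y z)) h
    simpa using congrArg Fin.val this

end spread

lemma descFactorial_bound (f t : ℕ) (ht : t ≤ f) :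
    ((f : ℝ) / Real.exp 1) ^ t ≤ (f.descFactorial t : ℝ) := by
  induction f generalizing t with
  | zero =>
    have : t = 0 := by omega
    subst this; simp
  | succ f ih =>
    cases t with
    | zero => simp
    | succ t =>
      rw [Nat.succ_descFactorial_succ, pow_succ]
      push_cast
      have h1 := ih t (by omega)
      have hexp : 0 < Real.exp 1 := Real.exp_pos 1
      rcases Nat.eq_zero_or_pos t with h0 | h0
      · subst h0
        simp only [pow_zero, one_mul, Nat.descFactorial_zero, Nat.cast_one, mul_one]
        refine div_le_self (by positivity) ?_
        have := Real.add_one_le_exp (1:ℝ)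
        linarith
      · have hf : (0:ℝ) < f := by
          have : 0 < f := by omega
          exact_mod_cast this
        have h2 : (((f : ℝ) + 1) / f) ^ t ≤ Real.exp 1 := by
          have e1 : ((f : ℝ) + 1) / f ≤ Real.exp (1 / f) := by
            have := Real.add_one_le_exp (1 / (f:ℝ))
            rw [add_div, div_self hf.ne']; linarith
          calc (((f : ℝ) + 1) / f) ^ t ≤ (Real.exp (1 / f)) ^ t := by gcongr
            _ = Real.exp (t * (1 / f)) := by rw [← Real.exp_nat_mul]
            _ ≤ Real.exp 1 := by
              gcongr
              rw [mul_one_div, div_le_one hf]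
              exact_mod_cast (by omega : t ≤ f)
        have h3 : (((f : ℝ) + 1) / Real.exp 1) ^ t = (((f : ℝ) + 1) / f) ^ t * ((f : ℝ) / Real.exp 1) ^ t := by
          rw [← mul_pow]; congr 1; field_simp
        rw [h3]
        calc (((f : ℝ) + 1) / f) ^ t * ((f : ℝ) / Real.exp 1) ^ t * ((f + 1) / Real.exp 1)
            ≤ Real.exp 1 * (f.descFactorial t : ℝ) * ((f + 1) / Real.exp 1) := by gcongr
          _ = (f + 1) * (f.descFactorial t : ℝ) := by field_simp

section spread
variable {n k N : ℕ} {P : Type*} [Fintype P]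

lemma card_freePos_compl (B : Fin N → Fin k → P) : (freePos B)ᶜ.card ≤ N * k := by
  have : (freePos B)ᶜ ⊆ Finset.univ.image (fun x : Fin N × Fin k => B x.1 x.2) := by
    intro x hx
    simp only [freePos, Finset.mem_compl, Finset.mem_filter, Finset.mem_univ, true_and] at hx
    push Not at hx
    obtain ⟨j, i, h⟩ := hx
    exact Finset.mem_image.2 ⟨(j, i), Finset.mem_univ _, h.symm⟩
  refine (Finset.card_le_card this).trans (Finset.card_image_le.trans ?_)
  simp

lemma blkOm_nonempty (hk : 1 ≤ k) (H : Finset (Finset (Fin n))) (hH : H ⊆ kSets n k)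
    (B : Fin N → Fin k → P) (hB : Function.Injective (fun x : Fin N × Fin k => B x.1 x.2))
    (hP : Fintype.card P = n) (g : P → Fin n) (hlt : N * k * n ^ (k - 1) < H.card) :
    (blkOm H B g ∅).Nonempty := by
  have hBj : ∀ j, Function.Injective (B j) := by
    intro j i i' h
    have := @hB (j, i) (j, i') h
    exact (Prod.mk.inj this).2
  have : ∀ m : ℕ, ∃ π : P ≃ Fin n, ∀ j : Fin N, (j : ℕ) < m →
      Finset.univ.image (fun i => π (B j i)) ∈ H := by
    intro m
    induction m with
    | zero => exact ⟨Fintype.equivFinOfCardEq hP, fun j hj => absurd hj (by omega)⟩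
    | succ m ih =>
      obtain ⟨π, hπ⟩ := ih
      by_cases hm : m < N
      swap
      · exact ⟨π, fun j hj => hπ j (by omega)⟩
      have h1 := card_freeTup hk H hH (freePos B) π
      have h2 : (freePos B)ᶜ.card * n ^ (k - 1) ≤ (N * k) * n ^ (k - 1) :=
        Nat.mul_le_mul_right _ (card_freePos_compl B)
      obtain ⟨y, hy⟩ := Finset.card_pos.1 (show 0 < (freeTup (k := k) H (freePos B) π).card by omega)
      simp only [freeTup, Finset.mem_filter, Finset.mem_univ, true_and] at hy
      obtain ⟨h2a, h2b, h2c⟩ := hy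
      have hyne : ∀ i j' i', y i ≠ B j' i' := fun i j' i' => (Finset.mem_filter.1 (h2b i)).2 j' i'
      obtain ⟨σ, s1, s2, s3⟩ := exists_blockSwap (B ⟨m, hm⟩) y (hBj _) h2a
        (fun i j hh => hyne _ _ _ hh.symm)
      refine ⟨σ.trans π, fun j hj => ?_⟩
      by_cases hjm : j = ⟨m, hm⟩
      · subst hjm; simpa [s1] using h2c
      · have : ∀ i, σ (B j i) = B j i := by
          intro i
          refine s3 _ (fun i' hh => hjm ?_) (fun i' hh => hyne _ _ _ hh.symm)
          have := @hB (j, i) (⟨m, hm⟩, i') hh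
          exact (Prod.mk.inj this).1
        have hj' : (j : ℕ) < m := by
          have : (j : ℕ) ≠ m := fun h => hjm (Fin.ext h)
          omega
        simpa [this] using hπ j hj'
  obtain ⟨π, hπ⟩ := this N
  exact ⟨π, by simp only [blkOm, Finset.mem_filter, Finset.mem_univ, true_and]; exact
    ⟨fun j => hπ j j.2, by simp⟩⟩

lemma vertex_spread (hk : 1 ≤ k) (hn : 1 ≤ n) (H : Finset (Finset (Fin n))) (hH : H ⊆ kSets n k)
    (B : Fin N → Fin k → P) (hB : Function.Injective (fun x : Fin N × Fin k => B x.1 x.2))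
    (hP : Fintype.card P = n) (c A : ℝ) (hc : 0 < c)
    (hcH : c * (n : ℝ) ^ k ≤ ((H.card - (N * k) * n ^ (k - 1) : ℕ) : ℝ))
    (hN : 2 * (N * k) ≤ n) (hA1 : 1 ≤ A) (hA2 : 1 / c ≤ A) (hA3 : 2 * Real.exp 1 ≤ A)
    (g : P → Fin n) (T : Finset P) :
    ((blkOm H B g T).card : ℝ) ≤ (A / n) ^ T.card * ((blkOm H B g ∅).card : ℝ) := by
  have hn0 : (0 : ℝ) < n := by exact_mod_cast hn
  have hA0 : 0 < A := by linarith
  -- blocks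
  have hblk : ∀ J : Finset (Fin N),
      ((blkOm H B g (T.filter fun x => ∃ j ∈ J, ∃ i, x = B j i)).card : ℝ) ≤
        (A / n) ^ (T.filter fun x => ∃ j ∈ J, ∃ i, x = B j i).card * ((blkOm H B g ∅).card : ℝ) := by
    intro J
    induction J using Finset.induction_on with
    | empty => simp
    | insert j J hj ih =>
      set T' := T.filter fun x => ∃ j ∈ J, ∃ i, x = B j i with hT'
      set I := Finset.univ.filter fun i => B j i ∈ T with hI
      have hBj : Function.Injective (B j) := by
        intro i i' h
        have := @hB (j, i) (j, i') h
        exact (Prod.mk.inj this).2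
      have e : (T.filter fun x => ∃ j' ∈ insert j J, ∃ i, x = B j' i) = T' ∪ I.image (B j) := by
        ext x
        simp only [hT', hI, Finset.mem_filter, Finset.mem_union, Finset.mem_image, Finset.mem_univ,
          true_and, Finset.mem_insert]
        constructor
        · rintro ⟨h1, j', h2 | h2, i, h3⟩
          · subst h2; exact Or.inr ⟨i, h3 ▸ h1, h3.symm⟩
          · exact Or.inl ⟨h1, j', h2, i, h3⟩
        · rintro (⟨h1, j', h2, i, h3⟩ | ⟨i, h1, h2⟩)
          · exact ⟨h1, j', Or.inr h2, i, h3⟩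
          · exact ⟨h2 ▸ h1, j, Or.inl rfl, i, h2.symm⟩
      have hT2 : ∀ i, B j i ∉ T' := by
        intro i hi
        obtain ⟨_, j', h2, i', h3⟩ := Finset.mem_filter.1 hi
        have := @hB (j, i) (j', i') h3
        exact hj ((Prod.mk.inj this).1 ▸ h2)
      have hT1 : Disjoint T' (freePos B) := by
        rw [Finset.disjoint_left]
        intro x hx hx'
        obtain ⟨_, j', h2, i', h3⟩ := Finset.mem_filter.1 hx
        exact (Finset.mem_filter.1 hx').2 j' i' h3
      have hst := blk_step hk H hH B hB hP g T' j hT1 hT2 I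
      have hdisj : Disjoint T' (I.image (B j)) := by
        rw [Finset.disjoint_right]
        intro x hx
        obtain ⟨i, _, rfl⟩ := Finset.mem_image.1 hx
        exact hT2 i
      rw [e, Finset.card_union_of_disjoint hdisj, Finset.card_image_of_injective _ hBj]
      rcases Finset.eq_empty_or_nonempty I with h0 | h0
      · rw [h0] at *; simpa using ih
      · have hIk : I.card ≤ k := by simpa using Finset.card_le_univ I
        have hst' : ((blkOm H B g (T' ∪ I.image (B j))).card : ℝ) * (c * (n : ℝ) ^ k) ≤
            (blkOm H B g T').card * (n : ℝ) ^ (k - I.card) := by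
          have h1 : ((blkOm H B g (T' ∪ I.image (B j))).card : ℝ) *
            ((H.card - (N * k) * n ^ (k - 1) : ℕ) : ℝ) ≤
            (blkOm H B g T').card * (n : ℝ) ^ (k - I.card) := by exact_mod_cast hst
          refine le_trans ?_ h1
          gcongr
        have hpow : (n : ℝ) ^ k = (n : ℝ) ^ (k - I.card) * (n : ℝ) ^ I.card := by
          rw [← pow_add]; congr 1; omega
        have h2 : ((blkOm H B g (T' ∪ I.image (B j))).card : ℝ) * (c * (n : ℝ) ^ I.card) ≤
            (blkOm H B g T').card := by
          rw [hpow] at hst'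
          have hpos : (0:ℝ) < (n : ℝ) ^ (k - I.card) := by positivity
          refine le_of_mul_le_mul_right ?_ hpos
          linarith
        have h3 : ((blkOm H B g (T' ∪ I.image (B j))).card : ℝ) ≤
            (A / n) ^ I.card * (blkOm H B g T').card := by
          have h4 : (1:ℝ) ≤ A ^ I.card * c := by
            have h5 : A ≤ A ^ I.card := le_self_pow₀ hA1 (by have := h0.card_pos; omega)
            have h6 : 1 ≤ A * c := by rwa [div_le_iff₀ hc] at hA2
            nlinarith
          rw [div_pow, div_mul_eq_mul_div, le_div_iff₀ (by positivity)]
          calc ((blkOm H B g (T' ∪ I.image (B j))).card : ℝ) * (n : ℝ) ^ I.card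
              ≤ (A ^ I.card * c) * (((blkOm H B g (T' ∪ I.image (B j))).card : ℝ) * (n : ℝ) ^ I.card) :=
                le_mul_of_one_le_left (by positivity) h4
            _ = A ^ I.card * (((blkOm H B g (T' ∪ I.image (B j))).card : ℝ) * (c * (n : ℝ) ^ I.card)) := by ring
            _ ≤ A ^ I.card * (blkOm H B g T').card := by gcongr
        refine h3.trans ?_
        rw [add_comm T'.card, pow_add, mul_assoc]
        gcongr
  set TB := T.filter fun x => ∃ j ∈ (Finset.univ : Finset (Fin N)), ∃ i, x = B j i with hTB
  have hTB1 := hblk Finset.univ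
  rw [← hTB] at hTB1
  have hTBf : Disjoint TB (freePos B) := by
    rw [Finset.disjoint_left]
    intro x hx hx'
    obtain ⟨_, j', h2, i', h3⟩ := Finset.mem_filter.1 hx
    exact (Finset.mem_filter.1 hx').2 j' i' h3
  set f := (freePos B).card with hf
  have hfree : ∀ U : Finset P, U ⊆ freePos B →
      (blkOm H B g (TB ∪ U)).card * f.descFactorial U.card ≤ (blkOm H B g TB).card := by
    intro U
    induction U using Finset.induction_on with
    | empty => simp
    | insert x U hx ih =>
      intro hU
      have hxf := hU (Finset.mem_insert_self _ _)
      have hUf := (Finset.subset_insert x U).trans hU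
      have h1 := ih hUf
      have h2 := free_step H B g (TB ∪ U) x hxf (by
        rw [Finset.mem_union]; rintro (h | h)
        · exact Finset.disjoint_left.1 hTBf h hxf
        · exact hx h)
      have h3 : ((freePos B) \ (TB ∪ U)).card = f - U.card := by
        have h4 : (freePos B) \ (TB ∪ U) = freePos B \ U := by
          ext z
          simp only [Finset.mem_sdiff, Finset.mem_union]
          constructor
          · rintro ⟨a, b⟩; exact ⟨a, fun h => b (Or.inr h)⟩
          · rintro ⟨a, b⟩; exact ⟨a, fun h => h.elim (fun h => Finset.disjoint_left.1 hTBf h a) b⟩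
        rw [h4, Finset.card_sdiff_of_subset hUf]
      rw [Finset.card_insert_of_notMem hx, Nat.descFactorial_succ, Finset.union_insert]
      rw [h3] at h2
      calc _ = ((blkOm H B g (insert x (TB ∪ U))).card * (f - U.card)) * f.descFactorial U.card := by ring
        _ ≤ (blkOm H B g (TB ∪ U)).card * f.descFactorial U.card := Nat.mul_le_mul_right _ h2
        _ ≤ _ := h1
  set TF := T ∩ freePos B with hTF
  have hT : T = TB ∪ TF := by
    ext x
    simp only [hTB, hTF, freePos, Finset.mem_union, Finset.mem_filter, Finset.mem_inter, Finset.mem_univ,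
      true_and]
    by_cases h : ∃ j, ∃ i, x = B j i
    · simp [h]
    · have : ∀ j i, x ≠ B j i := by push Not at h; exact h
      simp [h]
      exact fun _ => this
  have hTc : T.card = TF.card + TB.card := by
    conv_lhs => rw [hT]
    rw [Finset.card_union_of_disjoint (hTBf.mono_right Finset.inter_subset_right), add_comm]
  have h1 := hfree TF Finset.inter_subset_right
  rw [← hT] at h1
  have hTFf : TF.card ≤ f := Finset.card_le_card Finset.inter_subset_right
  have hfn : (n : ℝ) ≤ 2 * f := by
    have h2 := card_freePos_compl B
    have h3 := Finset.card_add_card_compl (freePos B)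
    rw [hP] at h3
    exact_mod_cast (by omega : n ≤ 2 * f)
  have h2 := descFactorial_bound f TF.card hTFf
  have h3 : ((n : ℝ) / A) ^ TF.card ≤ (f.descFactorial TF.card : ℝ) := by
    refine le_trans ?_ h2
    gcongr ?_ ^ _
    rw [div_le_div_iff₀ hA0 (Real.exp_pos 1)]
    have := Real.exp_pos 1
    have : (0:ℝ) ≤ f := Nat.cast_nonneg _
    nlinarith
  have h4 : ((blkOm H B g T).card : ℝ) * ((n : ℝ) / A) ^ TF.card ≤ (blkOm H B g TB).card := by
    have h1' : ((blkOm H B g T).card : ℝ) * (f.descFactorial TF.card : ℝ) ≤ (blkOm H B g TB).card := by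
      exact_mod_cast h1
    exact le_trans (mul_le_mul_of_nonneg_left h3 (Nat.cast_nonneg _)) h1'
  have h5 : ((blkOm H B g T).card : ℝ) ≤ (A / n) ^ TF.card * (blkOm H B g TB).card := by
    have : (A / n) ^ TF.card * ((n : ℝ) / A) ^ TF.card = 1 := by
      rw [← mul_pow]; rw [show A / n * (n / A) = 1 by field_simp]; simp
    calc ((blkOm H B g T).card : ℝ)
        = (A / n) ^ TF.card * (((blkOm H B g T).card : ℝ) * ((n : ℝ) / A) ^ TF.card) := by
          rw [mul_comm ((blkOm H B g T).card : ℝ), ← mul_assoc, this, one_mul]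
      _ ≤ _ := by gcongr
  rw [hTc, pow_add, mul_assoc]
  refine h5.trans ?_
  gcongr
end spread

/-- the positions of the `i`-th edge -/
noncomputable def posEdge (r d k : ℕ) [NeZero d] (i : ZMod r) : Finset (ZMod r × Fin d) :=
  (Finset.range k).image fun j => (i + ((j / d : ℕ) : ZMod r), Fin.ofNat d j)

lemma zmod_reach {r : ℕ} [NeZero r] (a b : ZMod r) : ∃ t : ℕ, a + t = b :=
  ⟨(b - a).val, by simp⟩

lemma union_lb {r d k m : ℕ} [NeZero r] [NeZero d] (hm : 1 ≤ m) (hkd : d + 2 ≤ k)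
    (hr : 8 * m ≤ r) (Hx : Finset (ZMod r)) (hHx : ∀ i : ZMod r, ∃ t : ℕ, t < 2 * m ∧ i + (t : ZMod r) ∈ Hx)
    (I : Finset (ZMod r)) (hI : I.Nonempty) (hIH : Disjoint I Hx) :
    (4 * m * d + 1) * I.card + 4 * m ≤ 4 * m * (I.biUnion (posEdge r d k)).card := by
  have hd : 0 < d := Nat.pos_of_ne_zero (NeZero.ne d)
  set U := I.biUnion (posEdge r d k) with hU
  set Ends := I.filter fun i => i + 1 ∉ I with hEnds
  have memU : ∀ i ∈ I, ∀ j < k, (i + ((j / d : ℕ) : ZMod r), Fin.ofNat d j) ∈ U := by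
    intro i hi j hj
    exact Finset.mem_biUnion.2 ⟨i, hi, Finset.mem_image.2 ⟨j, Finset.mem_range.2 hj, rfl⟩⟩
  have hE : I.card ≤ 2 * m * Ends.card := by
    have hsub : I ⊆ (Finset.range (2 * m)).biUnion
        (fun t => Ends.image fun e => e - ((t : ℕ) : ZMod r)) := by
      intro i hi
      obtain ⟨t, ht, hti⟩ := hHx i
      have hex : ∃ t : ℕ, i + t ∉ I := ⟨t, fun h => Finset.disjoint_left.1 hIH h hti⟩
      have hspec := Nat.find_spec hex
      have hle : Nat.find hex ≤ t := Nat.find_min' hex (fun h => Finset.disjoint_left.1 hIH h hti)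
      have hpos : Nat.find hex ≠ 0 := by
        intro h0; rw [h0] at hspec; simp at hspec; exact hspec hi
      refine Finset.mem_biUnion.2 ⟨Nat.find hex - 1, Finset.mem_range.2 (by omega), ?_⟩
      refine Finset.mem_image.2 ⟨i + ((Nat.find hex - 1 : ℕ) : ZMod r), ?_, by ring⟩
      refine Finset.mem_filter.2 ⟨?_, ?_⟩
      · have := Nat.find_min hex (m := Nat.find hex - 1) (by omega)
        push Not at this
        exact this
      · have : i + ((Nat.find hex - 1 : ℕ) : ZMod r) + 1 = i + (Nat.find hex : ℕ) := by
          rw [add_assoc]; congr 1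
          have : Nat.find hex = (Nat.find hex - 1) + 1 := by omega
          conv_rhs => rw [this]
          push_cast; ring
        rw [this]; exact hspec
    refine (Finset.card_le_card hsub).trans ?_
    refine (Finset.card_biUnion_le_card_mul _ _ Ends.card fun t _ => Finset.card_image_le).trans ?_
    rw [Finset.card_range]
  set X0 := I ×ˢ (Finset.univ : Finset (Fin d)) with hX0
  set X1 := Ends.image (fun i => ((i + 1, 0) : ZMod r × Fin d)) with hX1
  have hX0U : X0 ⊆ U := by
    rintro ⟨i, j⟩ h
    have hi := (Finset.mem_product.1 h).1
    have := memU i hi j.1 (by have := j.2; omega)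
    rw [Nat.div_eq_of_lt j.2] at this
    simpa using this
  have hX1U : X1 ⊆ U := by
    intro x hx
    obtain ⟨i, hi, rfl⟩ := Finset.mem_image.1 hx
    have := memU i (Finset.mem_filter.1 hi).1 d (by omega)
    rw [Nat.div_self hd] at this
    have h0 : Fin.ofNat d d = 0 := by ext; simp
    rw [h0] at this
    simpa using this
  have h01 : Disjoint X0 X1 := by
    rw [Finset.disjoint_right]
    intro x hx hx'
    obtain ⟨i, hi, rfl⟩ := Finset.mem_image.1 hx
    exact (Finset.mem_filter.1 hi).2 (Finset.mem_product.1 hx').1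
  have hc0 : X0.card = I.card * d := by rw [hX0, Finset.card_product]; simp
  have hc1 : X1.card = Ends.card := Finset.card_image_of_injective _ (fun a b h => by
    simpa using h)
  by_cases hA : ∃ i ∈ I, i + 1 ∉ I ∧ i + 2 ∉ I
  · obtain ⟨i, hi, hi1, hi2⟩ := hA
    have hz := memU i hi (d + 1) (by omega)
    set z : ZMod r × Fin d := (i + (((d + 1) / d : ℕ) : ZMod r), Fin.ofNat d (d + 1)) with hzdef
    have hz01 : z ∉ X0 ∪ X1 := by
      rw [Finset.mem_union]
      by_cases hd1 : d = 1
      · subst hd1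
        have e : z.1 = i + 2 := by simp [hzdef]
        rintro (h | h)
        · exact hi2 (e ▸ (Finset.mem_product.1 h).1)
        · obtain ⟨i', hi', h'⟩ := Finset.mem_image.1 h
          have := congrArg Prod.fst h'
          rw [e] at this
          have h3 : i' = i + 1 := by
            have : i' + 1 = i + 1 + 1 := by
              have h4 : i' + 1 = i + 2 := this
              rw [h4]; ring
            exact add_right_cancel this
          exact hi1 (h3 ▸ (Finset.mem_filter.1 hi').1)
      · have hd2 : (d + 1) / d = 1 := by
          rw [Nat.div_eq_iff hd]; omega
        have e : z.1 = i + 1 := by simp only [hzdef, hd2]; simp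
        have e2 : (z.2 : ℕ) = 1 := by
          simp only [hzdef, Fin.ofNat]
          rw [Nat.add_mod_left, Nat.mod_eq_of_lt (by omega)]
        rintro (h | h)
        · exact hi1 (e ▸ (Finset.mem_product.1 h).1)
        · obtain ⟨i', hi', h'⟩ := Finset.mem_image.1 h
          have := congrArg (fun x => (x.2 : ℕ)) h'
          simp only [e2] at this
          simp at this
    have hsub : insert z (X0 ∪ X1) ⊆ U :=
      Finset.insert_subset hz (Finset.union_subset hX0U hX1U)
    have := Finset.card_le_card hsub
    rw [Finset.card_insert_of_notMem hz01, Finset.card_union_of_disjoint h01, hc0, hc1] at this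
    nlinarith
  · push Not at hA
    obtain ⟨i0, hi0⟩ := hI
    have hall : ∀ t : ℕ, i0 + t ∈ I ∨ i0 + t + 1 ∈ I := by
      intro t
      induction t with
      | zero => left; simpa using hi0
      | succ t ih =>
        push_cast
        by_cases h1 : i0 + t + 1 ∈ I
        · left; rwa [← add_assoc]
        · right
          have h2 := ih.resolve_right h1
          have := hA _ h2 h1
          convert this using 1; ring
    have hr2 : r ≤ 2 * I.card := by
      have hsub : (Finset.univ : Finset (ZMod r)) ⊆ I ∪ I.image (fun i => i - 1) := by
        intro x _
        obtain ⟨t, rfl⟩ := zmod_reach i0 x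
        rcases hall t with h | h
        · exact Finset.mem_union_left _ h
        · exact Finset.mem_union_right _ (Finset.mem_image.2 ⟨_, h, by ring⟩)
      have h1 := Finset.card_le_card hsub
      rw [Finset.card_univ, ZMod.card] at h1
      have h2 := Finset.card_union_le I (I.image (fun i => i - 1))
      have h3 : (I.image (fun i => i - 1)).card ≤ I.card := Finset.card_image_le
      omega
    have hsub : (X0 ∪ X1) ⊆ U := Finset.union_subset hX0U hX1U
    have := Finset.card_le_card hsub
    rw [Finset.card_union_of_disjoint h01, hc0, hc1] at this
    nlinarith

lemma count_phi {W A : Type*} [Fintype W] [AddCommGroup A] [Fintype A] (G : SimpleGraph W)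
    [Fintype G.ConnectedComponent] (Δ : Finset A) (h0 : (0 : A) ∈ Δ) (Φ : Finset (W → A))
    (hΦ : ∀ φ ∈ Φ, ∀ a b, G.Adj a b → φ a - φ b ∈ Δ) :
    Φ.card ≤ Fintype.card A ^ Fintype.card G.ConnectedComponent * Δ.card ^ Fintype.card W := by
  have hroot : ∀ C : G.ConnectedComponent, ∃ v, G.connectedComponentMk v = C := fun C =>
    ⟨_, C.out_eq⟩
  choose root hroot using hroot
  have hpar : ∀ w : W, ∃ u : W, (w = root (G.connectedComponentMk w) ∧ u = w) ∨
      (G.Adj w u ∧ G.dist u (root (G.connectedComponentMk w)) < G.dist w (root (G.connectedComponentMk w))) := by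
    intro w
    by_cases hw : w = root (G.connectedComponentMk w)
    · exact ⟨w, Or.inl ⟨hw, rfl⟩⟩
    · have hreach : G.Reachable w (root (G.connectedComponentMk w)) :=
        SimpleGraph.ConnectedComponent.exact (hroot _).symm
      obtain ⟨p, hp⟩ := hreach.exists_walk_length_eq_dist
      generalize root (G.connectedComponentMk w) = v at *
      cases p with
      | nil => exact absurd rfl hw
      | cons h q =>
        refine ⟨_, Or.inr ⟨h, ?_⟩⟩
        rw [← hp, SimpleGraph.Walk.length_cons]
        exact Nat.lt_succ_of_le (SimpleGraph.dist_le q)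
  choose par hpar using hpar
  have : Φ.card ≤ ((Fintype.piFinset (fun _ : G.ConnectedComponent => (Finset.univ : Finset A))) ×ˢ
      (Fintype.piFinset (fun _ : W => Δ))).card := by
    refine Finset.card_le_card_of_injOn (fun φ => (fun C => φ (root C), fun w => φ w - φ (par w))) ?_ ?_
    · intro φ hφ
      refine Finset.mem_coe.2 (Finset.mem_product.2 ⟨by simp, ?_⟩)
      simp only [Fintype.mem_piFinset]
      intro w
      rcases hpar w with ⟨_, h⟩ | ⟨h, _⟩
      · rw [h]; simpa using h0
      · exact hΦ φ hφ _ _ h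
    · intro φ _ φ' _ h
      have h1 := (Prod.mk.inj h).1
      have h2 := (Prod.mk.inj h).2
      have key : ∀ t : ℕ, ∀ w, G.dist w (root (G.connectedComponentMk w)) = t → φ w = φ' w := by
        intro t
        induction t using Nat.strong_induction_on with
        | _ t ih =>
          intro w hw
          rcases hpar w with ⟨h, _⟩ | ⟨h, h'⟩
          · have := congrFun h1 (G.connectedComponentMk w)
            beta_reduce at this
            rw [← h] at this
            exact this
          · have hc : G.connectedComponentMk (par w) = G.connectedComponentMk w :=
              SimpleGraph.ConnectedComponent.sound h.symm.reachable
            have e1 := ih _ (hw ▸ h') (par w) (by rw [hc])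
            have e2 := congrFun h2 w
            simp only [e1] at e2
            exact sub_left_injective e2
      funext w
      exact key _ w rfl
  refine this.trans (le_of_eq ?_)
  rw [Finset.card_product, Fintype.card_piFinset, Fintype.card_piFinset]
  simp

lemma card_posEdge_le (r d k : ℕ) [NeZero d] (i : ZMod r) : (posEdge r d k i).card ≤ k := by
  unfold posEdge
  exact Finset.card_image_le.trans (by simp)

noncomputable def RPi (r d k : ℕ) [NeZero r] [NeZero d] {n : ℕ} (Hx : Finset (ZMod r))
    (π : (ZMod r × Fin d) ≃ Fin n) : Finset (Finset (Fin n)) :=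
  (Finset.univ.filter fun i => i ∉ Hx).image fun i => (posEdge r d k i).image π

lemma phi_T_bound {r d k m n : ℕ} [NeZero r] [NeZero d] (hm : 1 ≤ m) (hkd : d + 2 ≤ k)
    (hr : 8 * m ≤ r) (Hx : Finset (ZMod r))
    (hHx : ∀ i : ZMod r, ∃ t : ℕ, t < 2 * m ∧ i + (t : ZMod r) ∈ Hx)
    (S : Finset (Finset (Fin n))) (φ : S → ZMod r) (hφ : ∀ e, φ e ∉ Hx)
    (π : (ZMod r × Fin d) ≃ Fin n) (hπ : ∀ e : S, (posEdge r d k (φ e)).image π = e)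
    (G : SimpleGraph S) (hG : ∀ e e' : S, G.Adj e e' ↔ e ≠ e' ∧ ¬ Disjoint (e : Finset (Fin n)) e')
    [Fintype G.ConnectedComponent] :
    (4 * m * d + 1) * S.card + 4 * m * Fintype.card G.ConnectedComponent ≤
      4 * m * ((Finset.univ : Finset S).biUnion fun e => posEdge r d k (φ e)).card := by
  have hinj : Function.Injective φ := by
    intro e e' h
    apply Subtype.ext
    rw [← hπ e, ← hπ e', h]
  set comp : G.ConnectedComponent → Finset S := fun C =>
    Finset.univ.filter fun e => G.connectedComponentMk e = C with hcomp
  set TC : G.ConnectedComponent → Finset (ZMod r × Fin d) := fun C =>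
    ((comp C).image φ).biUnion (posEdge r d k) with hTC
  have h1 : ∀ C, (4 * m * d + 1) * (comp C).card + 4 * m ≤ 4 * m * (TC C).card := by
    intro C
    have := union_lb hm hkd hr Hx hHx ((comp C).image φ) (by
      refine Finset.Nonempty.image ?_ _
      exact ⟨C.out, Finset.mem_filter.2 ⟨Finset.mem_univ _, C.out_eq⟩⟩) (by
      rw [Finset.disjoint_left]
      intro x hx
      obtain ⟨e, _, rfl⟩ := Finset.mem_image.1 hx
      exact hφ e)
    rwa [Finset.card_image_of_injective _ hinj] at this
  have hdisj : ∀ C ∈ (Finset.univ : Finset G.ConnectedComponent), ∀ C' ∈ (Finset.univ : Finset G.ConnectedComponent),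
      C ≠ C' → Disjoint (TC C) (TC C') := by
    intro C _ C' _ hne
    rw [Finset.disjoint_left]
    intro x hx hx'
    obtain ⟨i, hi, hxi⟩ := Finset.mem_biUnion.1 hx
    obtain ⟨i', hi', hxi'⟩ := Finset.mem_biUnion.1 hx'
    obtain ⟨e, he, rfl⟩ := Finset.mem_image.1 hi
    obtain ⟨e', he', rfl⟩ := Finset.mem_image.1 hi'
    have he1 := (Finset.mem_filter.1 he).2
    have he2 := (Finset.mem_filter.1 he').2
    apply hne
    rw [← he1, ← he2]
    by_cases hee : e = e'
    · rw [hee]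
    · refine SimpleGraph.ConnectedComponent.sound (SimpleGraph.Adj.reachable ((hG _ _).2 ⟨hee, ?_⟩))
      rw [Finset.not_disjoint_iff]
      refine ⟨π x, ?_, ?_⟩
      · rw [← hπ e]; exact Finset.mem_image_of_mem _ hxi
      · rw [← hπ e']; exact Finset.mem_image_of_mem _ hxi'
  have h2 : (Finset.univ.biUnion TC) ⊆ ((Finset.univ : Finset S).biUnion fun e => posEdge r d k (φ e)) := by
    intro x hx
    obtain ⟨C, _, hx⟩ := Finset.mem_biUnion.1 hx
    obtain ⟨i, hi, hxi⟩ := Finset.mem_biUnion.1 hx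
    obtain ⟨e, he, rfl⟩ := Finset.mem_image.1 hi
    exact Finset.mem_biUnion.2 ⟨e, Finset.mem_univ _, hxi⟩
  have h3 := Finset.card_le_card h2
  rw [Finset.card_biUnion (fun C hC C' hC' h => hdisj C hC C' hC' h)] at h3
  have h4 : ∑ C, (comp C).card = S.card := by
    have := Finset.card_eq_sum_card_fiberwise (f := fun e : S => G.connectedComponentMk e)
      (s := Finset.univ) (t := Finset.univ) (fun _ _ => Finset.mem_coe.2 (Finset.mem_univ _))
    rw [Finset.card_univ, Fintype.card_coe] at this
    rw [this]
  calc (4 * m * d + 1) * S.card + 4 * m * Fintype.card G.ConnectedComponent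
      = ∑ C, ((4 * m * d + 1) * (comp C).card + 4 * m) := by
        rw [Finset.sum_add_distrib, ← Finset.mul_sum, h4, Finset.sum_const, Finset.card_univ,
          smul_eq_mul, mul_comm (4 * m) (Fintype.card _)]
    _ ≤ ∑ C, 4 * m * (TC C).card := Finset.sum_le_sum fun C _ => h1 C
    _ = 4 * m * ∑ C, (TC C).card := by rw [Finset.mul_sum]
    _ ≤ _ := Nat.mul_le_mul_left _ h3

lemma phi_count_pi {r d k n : ℕ} [NeZero r] [NeZero d] (A : ℝ) (hA : 0 ≤ A)
    (Ω : Finset ((ZMod r × Fin d) ≃ Fin n))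
    (hvs : ∀ (g : ZMod r × Fin d → Fin n) (T : Finset (ZMod r × Fin d)),
      ((Ω.filter fun π => ∀ x ∈ T, π x = g x).card : ℝ) ≤ (A / n) ^ T.card * Ω.card)
    (S : Finset (Finset (Fin n))) (φ : S → ZMod r) :
    ((Ω.filter fun π : (ZMod r × Fin d) ≃ Fin n => ∀ e : S, (posEdge r d k (φ e)).image π = (e : Finset (Fin n))).card : ℝ) ≤
      (k * A / n) ^ ((Finset.univ : Finset S).biUnion fun e => posEdge r d k (φ e)).card * Ω.card := by
  set T := (Finset.univ : Finset S).biUnion fun e => posEdge r d k (φ e) with hT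
  set Ω' := Ω.filter fun π : (ZMod r × Fin d) ≃ Fin n => ∀ e : S, (posEdge r d k (φ e)).image π = (e : Finset (Fin n)) with hΩ'
  rcases Finset.eq_empty_or_nonempty Ω' with h0 | ⟨π0, hπ0⟩
  · rw [h0]; simp only [Finset.card_empty, Nat.cast_zero]; positivity
  have hπ0' := (Finset.mem_filter.1 hπ0).2
  have hex : ∀ x, ∃ s : Finset (Fin n), (x ∈ T → s.card ≤ k ∧ ∀ π ∈ Ω', π x ∈ s) ∧
      (x ∉ T → s = {π0 x}) := by
    intro x
    by_cases hx : x ∈ T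
    · obtain ⟨e, _, hxe⟩ := Finset.mem_biUnion.1 hx
      refine ⟨e, fun _ => ⟨?_, fun π hπ => ?_⟩, fun h => absurd hx h⟩
      · rw [← hπ0' e]
        exact Finset.card_image_le.trans (card_posEdge_le _ _ _ _)
      · rw [← (Finset.mem_filter.1 hπ).2 e]
        exact Finset.mem_image_of_mem _ hxe
    · exact ⟨{π0 x}, fun h => absurd h hx, fun _ => rfl⟩
  choose ex hex1 hex2 using hex
  set Gs := Fintype.piFinset ex with hGs
  have hsub : Ω' ⊆ Gs.biUnion fun g => Ω.filter fun π => ∀ x ∈ T, π x = g x := by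
    intro π hπ
    refine Finset.mem_biUnion.2 ⟨fun x => if x ∈ T then π x else π0 x, ?_, ?_⟩
    · rw [hGs, Fintype.mem_piFinset]
      intro x
      split_ifs with h
      · exact (hex1 x h).2 π hπ
      · rw [hex2 x h]; simp
    · refine Finset.mem_filter.2 ⟨(Finset.mem_filter.1 hπ).1, fun x hx => ?_⟩
      beta_reduce
      rw [if_pos hx]
  have hGc : Gs.card ≤ k ^ T.card := by
    rw [hGs, Fintype.card_piFinset]
    calc ∏ x, (ex x).card ≤ ∏ x, (if x ∈ T then k else 1) := by
          refine Finset.prod_le_prod' fun x _ => ?_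
          split_ifs with h
          · exact (hex1 x h).1
          · rw [hex2 x h]; simp
      _ = k ^ T.card := by rw [Finset.prod_ite_mem]; simp
  calc (Ω'.card : ℝ) ≤ ((Gs.biUnion fun g => Ω.filter fun π => ∀ x ∈ T, π x = g x).card : ℝ) := by
        exact_mod_cast Finset.card_le_card hsub
    _ ≤ ∑ g ∈ Gs, ((Ω.filter fun π => ∀ x ∈ T, π x = g x).card : ℝ) := by
        exact_mod_cast Finset.card_biUnion_le
    _ ≤ ∑ g ∈ Gs, (A / n) ^ T.card * Ω.card := Finset.sum_le_sum fun g _ => hvs g T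
    _ = Gs.card * ((A / n) ^ T.card * Ω.card) := by rw [Finset.sum_const, nsmul_eq_mul]
    _ ≤ (k : ℝ) ^ T.card * ((A / n) ^ T.card * Ω.card) := by
        gcongr
        exact_mod_cast hGc
    _ = _ := by rw [mul_div_assoc, mul_pow]; ring

lemma edge_spread {r d k m n : ℕ} [NeZero r] [NeZero d] (hm : 1 ≤ m) (hkd : d + 2 ≤ k)
    (hr : 8 * m ≤ r) (hrn : r ≤ n) (Hx : Finset (ZMod r))
    (hHx : ∀ i : ZMod r, ∃ t : ℕ, t < 2 * m ∧ i + (t : ZMod r) ∈ Hx)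
    (A : ℝ) (hA : 1 ≤ A)
    (Ω : Finset ((ZMod r × Fin d) ≃ Fin n))
    (hvs : ∀ (g : ZMod r × Fin d → Fin n) (T : Finset (ZMod r × Fin d)),
      ((Ω.filter fun π => ∀ x ∈ T, π x = g x).card : ℝ) ≤ (A / n) ^ T.card * Ω.card)
    (S : Finset (Finset (Fin n))) :
    ((Ω.filter fun π => S ⊆ RPi r d k Hx π).card : ℝ) ≤
      Ω.card * ((k : ℝ) ^ 2 * (k * A) ^ k * (n : ℝ) ^ (-((d : ℝ) + 1 / (4 * m)))) ^ S.card := by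
  have hn0 : (0:ℝ) < n := by
    have : 0 < n := by omega
    exact_mod_cast this
  have hn1 : (1:ℝ) ≤ n := by
    have : 1 ≤ n := by omega
    exact_mod_cast this
  have hm0 : (0:ℝ) < m := by exact_mod_cast hm
  have hk1 : (1:ℝ) ≤ k := by
    have : 1 ≤ k := by omega
    exact_mod_cast this
  set Φ : Finset (S → ZMod r) := Finset.univ.filter fun φ => (∀ e, φ e ∉ Hx) ∧
    ∃ π : (ZMod r × Fin d) ≃ Fin n, ∀ e : S, (posEdge r d k (φ e)).image π = e with hΦ
  let G : SimpleGraph S :=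
    { Adj := fun e e' => e ≠ e' ∧ ¬ Disjoint (e : Finset (Fin n)) e'
      symm := ⟨fun e e' h => ⟨h.1.symm, fun h' => h.2 h'.symm⟩⟩
      loopless := ⟨fun e h => h.1 rfl⟩ }
  have hG : ∀ e e' : S, G.Adj e e' ↔ e ≠ e' ∧ ¬ Disjoint (e : Finset (Fin n)) e' := fun _ _ => Iff.rfl
  have : Fintype G.ConnectedComponent := Fintype.ofFinite _
  set cc := Fintype.card G.ConnectedComponent with hcc
  set Δ : Finset (ZMod r) := ((Finset.range k) ×ˢ (Finset.range k)).image
    (fun x => ((x.2 / d : ℕ) : ZMod r) - ((x.1 / d : ℕ) : ZMod r)) with hΔ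
  have hΔc : Δ.card ≤ k ^ 2 := by
    refine Finset.card_image_le.trans ?_
    rw [Finset.card_product, Finset.card_range, sq]
  have hΦc : (Φ.card : ℝ) ≤ (n : ℝ) ^ cc * ((k : ℝ) ^ 2) ^ S.card := by
    have h1 := count_phi G Δ (by
      refine Finset.mem_image.2 ⟨(0, 0), ?_, by simp⟩
      simp; omega) Φ (by
      intro φ hφ a b hab
      obtain ⟨_, π, hπ⟩ := (Finset.mem_filter.1 hφ).2
      have h2 := ((hG _ _).1 hab).2
      rw [Finset.not_disjoint_iff] at h2
      obtain ⟨v, hva, hvb⟩ := h2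
      rw [← hπ a] at hva
      rw [← hπ b] at hvb
      obtain ⟨x, hx, rfl⟩ := Finset.mem_image.1 hva
      obtain ⟨y, hy, hxy⟩ := Finset.mem_image.1 hvb
      have := π.injective hxy
      subst this
      obtain ⟨i, hi, rfl⟩ := Finset.mem_image.1 hx
      obtain ⟨j, hj, hij⟩ := Finset.mem_image.1 hy
      have e := congrArg Prod.fst hij
      simp only at e
      refine Finset.mem_image.2 ⟨(i, j), Finset.mem_product.2 ⟨hi, hj⟩, ?_⟩
      simp only
      rw [sub_eq_sub_iff_add_eq_add, add_comm, e])
    rw [ZMod.card, Fintype.card_coe] at h1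
    have h2 : Φ.card ≤ n ^ cc * (k ^ 2) ^ S.card := by
      refine h1.trans (Nat.mul_le_mul (Nat.pow_le_pow_left hrn _) (Nat.pow_le_pow_left hΔc _))
    exact_mod_cast h2
  have hsub : (Ω.filter fun π => S ⊆ RPi r d k Hx π) ⊆
      Φ.biUnion fun φ => Ω.filter fun π : (ZMod r × Fin d) ≃ Fin n => ∀ e : S, (posEdge r d k (φ e)).image π = (e : Finset (Fin n)) := by
    intro π hπ
    obtain ⟨h1, h2⟩ := Finset.mem_filter.1 hπ
    have : ∀ e : S, ∃ i, i ∉ Hx ∧ (posEdge r d k i).image π = e := by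
      intro e
      obtain ⟨i, hi, h⟩ := Finset.mem_image.1 (h2 e.2)
      exact ⟨i, (Finset.mem_filter.1 hi).2, h⟩
    choose φ hφ1 hφ2 using this
    exact Finset.mem_biUnion.2 ⟨φ, Finset.mem_filter.2 ⟨Finset.mem_univ _, hφ1, π, hφ2⟩,
      Finset.mem_filter.2 ⟨h1, hφ2⟩⟩
  set η : ℝ := 1 / (4 * m) with hη
  set s := S.card with hs
  have hone : ∀ φ ∈ Φ, ((Ω.filter fun π : (ZMod r × Fin d) ≃ Fin n => ∀ e : S, (posEdge r d k (φ e)).image π = (e : Finset (Fin n))).card : ℝ) ≤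
      ((k * A) ^ k) ^ s * (n : ℝ) ^ (-((d + η) * s + cc)) * Ω.card := by
    intro φ hφ
    refine (phi_count_pi A (by linarith) Ω hvs S φ).trans ?_
    obtain ⟨h1, π, hπ⟩ := (Finset.mem_filter.1 hφ).2
    have hb := phi_T_bound hm hkd hr Hx hHx S φ h1 π hπ G hG
    set T := ((Finset.univ : Finset S).biUnion fun e => posEdge r d k (φ e)) with hT
    have hTle : T.card ≤ k * s := by
      have := Finset.card_biUnion_le_card_mul (Finset.univ : Finset S) (fun e => posEdge r d k (φ e)) k
        (fun e _ => card_posEdge_le _ _ _ _)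
      rw [Finset.card_univ, Fintype.card_coe] at this
      rw [mul_comm]; exact this
    have hTge : ((d : ℝ) + η) * s + cc ≤ T.card := by
      have hb' : (4 * m * d + 1 : ℝ) * s + 4 * m * cc ≤ 4 * m * T.card := by exact_mod_cast hb
      have h4m : (0:ℝ) < 4 * m := by positivity
      have e : 4 * (m:ℝ) * (((d : ℝ) + η) * s + cc) = (4 * m * d + 1 : ℝ) * s + 4 * m * cc := by
        rw [hη]; field_simp
      rw [← e] at hb'
      exact le_of_mul_le_mul_left hb' h4m
    have hkA : 1 ≤ (k:ℝ) * A := by nlinarith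
    refine mul_le_mul_of_nonneg_right ?_ (by positivity)
    rw [div_pow, div_eq_mul_inv, ← Real.rpow_natCast (n : ℝ) T.card, ← Real.rpow_neg hn0.le, ← pow_mul]
    refine mul_le_mul (pow_le_pow_right₀ hkA hTle) ?_ (by positivity) (by positivity)
    exact Real.rpow_le_rpow_of_exponent_le hn1 (by linarith)
  calc ((Ω.filter fun π => S ⊆ RPi r d k Hx π).card : ℝ)
      ≤ ((Φ.biUnion fun φ => Ω.filter fun π : (ZMod r × Fin d) ≃ Fin n => ∀ e : S, (posEdge r d k (φ e)).image π = (e : Finset (Fin n))).card : ℝ) := by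
        exact_mod_cast Finset.card_le_card hsub
    _ ≤ ∑ φ ∈ Φ, ((Ω.filter fun π : (ZMod r × Fin d) ≃ Fin n => ∀ e : S, (posEdge r d k (φ e)).image π = (e : Finset (Fin n))).card : ℝ) := by
        exact_mod_cast Finset.card_biUnion_le
    _ ≤ ∑ φ ∈ Φ, ((k * A) ^ k) ^ s * (n : ℝ) ^ (-((d + η) * s + cc)) * Ω.card :=
        Finset.sum_le_sum hone
    _ = Φ.card * (((k * A) ^ k) ^ s * (n : ℝ) ^ (-((d + η) * s + cc)) * Ω.card) := by
        rw [Finset.sum_const, nsmul_eq_mul]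
    _ ≤ ((n : ℝ) ^ cc * ((k : ℝ) ^ 2) ^ s) * (((k * A) ^ k) ^ s * (n : ℝ) ^ (-((d + η) * s + cc)) * Ω.card) := by
        gcongr
    _ = Ω.card * ((k : ℝ) ^ 2 * (k * A) ^ k * (n : ℝ) ^ (-((d : ℝ) + η))) ^ s := by
        have e1 : (n : ℝ) ^ cc * (n : ℝ) ^ (-((d + η) * s + cc)) = ((n : ℝ) ^ (-((d : ℝ) + η))) ^ s := by
          rw [← Real.rpow_natCast, ← Real.rpow_add hn0, ← Real.rpow_mul_natCast hn0.le]
          congr 1; ring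
        rw [mul_pow ((k : ℝ) ^ 2 * (k * A) ^ k), mul_pow ((k : ℝ) ^ 2), ← e1]; ring

lemma card_H_lb {n k : ℕ} (hk : 1 ≤ k) (H : Finset (Finset (Fin n))) (hH : H ⊆ kSets n k) (α : ℝ)
    (hdeg : ∀ v : Fin n, α * (n : ℝ) ^ (k - 1) ≤ (degOf H {v} : ℝ)) :
    α * (n : ℝ) ^ k ≤ k * H.card := by
  have h1 : ∑ v : Fin n, degOf H {v} = k * H.card := by
    simp only [degOf, Finset.singleton_subset_iff, Finset.card_filter]
    rw [Finset.sum_comm]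
    have : ∀ e ∈ H, ∑ v : Fin n, (if v ∈ e then 1 else 0) = k := by
      intro e he
      rw [← Finset.card_filter]
      rw [show (Finset.univ.filter fun v => v ∈ e) = e by ext; simp]
      exact (Finset.mem_powersetCard.1 (hH he)).2
    rw [Finset.sum_congr rfl this, Finset.sum_const, smul_eq_mul, mul_comm]
  have h2 : ∑ v : Fin n, α * (n : ℝ) ^ (k - 1) ≤ ∑ v : Fin n, (degOf H {v} : ℝ) :=
    Finset.sum_le_sum fun v _ => hdeg v
  rw [Finset.sum_const, Finset.card_univ, Fintype.card_fin, nsmul_eq_mul] at h2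
  have h3 : (∑ v : Fin n, (degOf H {v} : ℝ)) = k * H.card := by exact_mod_cast h1
  rw [h3] at h2
  have : (n : ℝ) ^ k = n * (n : ℝ) ^ (k - 1) := by
    rw [← pow_succ']; congr 1; omega
  rw [this]; linarith

lemma zmod_cast_inj {r a b : ℕ} (ha : a < r) (hb : b < r) (h : (a : ZMod r) = b) : a = b := by
  rw [ZMod.natCast_eq_natCast_iff] at h
  exact Nat.ModEq.eq_of_lt_of_lt h ha hb

lemma card_posEdge {r d k : ℕ} [NeZero r] [NeZero d] (hk : k ≤ r * d) (i : ZMod r) :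
    (posEdge r d k i).card = k := by
  have hd : 0 < d := Nat.pos_of_ne_zero (NeZero.ne d)
  unfold posEdge
  rw [Finset.card_image_of_injOn, Finset.card_range]
  intro a ha b hb h
  have ha' := Finset.mem_range.1 (Finset.mem_coe.1 ha)
  have hb' := Finset.mem_range.1 (Finset.mem_coe.1 hb)
  obtain ⟨h1, h2⟩ := Prod.mk.inj h
  have h1' := zmod_cast_inj ((Nat.div_lt_iff_lt_mul hd).2 (by omega))
    ((Nat.div_lt_iff_lt_mul hd).2 (by omega)) (add_left_cancel h1)
  have h2' : a % d = b % d := by simpa [Fin.ofNat] using congrArg Fin.val h2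
  rw [← Nat.div_add_mod a d, ← Nat.div_add_mod b d, h1', h2']

lemma ham_of_pi {n k ℓ r d : ℕ} [NeZero r] [NeZero d] (hd : d = k - ℓ) (hn : n = r * d)
    (E : Finset (Finset (Fin n))) (π : (ZMod r × Fin d) ≃ Fin n)
    (h : ∀ i : ZMod r, (posEdge r d k i).image π ∈ E) : IsHamCycle n k ℓ E := by
  have hd0 : 0 < d := Nat.pos_of_ne_zero (NeZero.ne d)
  have hr0 : 0 < r := Nat.pos_of_ne_zero (NeZero.ne r)
  have : NeZero n := ⟨by rw [hn]; positivity⟩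
  refine ⟨fun z => π (((z.val / d : ℕ) : ZMod r), Fin.ofNat d z.val), ?_, ?_⟩
  · rw [Fintype.bijective_iff_injective_and_card]
    refine ⟨?_, by rw [ZMod.card, Fintype.card_fin]⟩
    intro a b hab
    obtain ⟨h1, h2⟩ := Prod.mk.inj (π.injective hab)
    have ha := ZMod.val_lt a
    have hb := ZMod.val_lt b
    have h1' := zmod_cast_inj ((Nat.div_lt_iff_lt_mul hd0).2 (by omega))
      ((Nat.div_lt_iff_lt_mul hd0).2 (by omega)) h1
    have h2' : a.val % d = b.val % d := by simpa [Fin.ofNat] using congrArg Fin.val h2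
    apply ZMod.val_injective
    rw [← Nat.div_add_mod a.val d, ← Nat.div_add_mod b.val d, h1', h2']
  · intro i _
    rw [← hd]
    convert h (i : ZMod r) using 1
    unfold posEdge
    rw [Finset.image_image]
    refine Finset.image_congr fun j _ => ?_
    simp only [Function.comp]
    congr 1
    rw [ZMod.val_natCast]
    refine Prod.ext ?_ ?_
    · simp only
      rw [hn, mul_comm r d, Nat.mod_mul_right_div_self, ZMod.natCast_mod,
        show (i * d + j) / d = i + j / d by rw [add_comm, Nat.add_mul_div_right _ _ hd0, add_comm]]
      push_cast; rfl
    · ext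
      simp only [Fin.ofNat]
      rw [Nat.mod_mod_of_dvd _ (hn ▸ Dvd.intro_left r rfl), add_comm, Nat.add_mul_mod_self_right]

lemma mem_blkOm {n k N : ℕ} {P : Type*} [Fintype P] {H : Finset (Finset (Fin n))}
    {B : Fin N → Fin k → P} {g : P → Fin n} {T : Finset P} {π : P ≃ Fin n} :
    π ∈ blkOm H B g T ↔ (∀ j, Finset.univ.image (fun i => π (B j i)) ∈ H) ∧ ∀ x ∈ T, π x = g x := by
  simp [blkOm]

lemma blkOm_empty {n k N : ℕ} {P : Type*} [Fintype P] (H : Finset (Finset (Fin n)))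
    (B : Fin N → Fin k → P) (g g0 : P → Fin n) :
    blkOm H B g ∅ = blkOm H B g0 ∅ := by
  ext π; simp [blkOm]

set_option maxHeartbeats 4000000 in
theorem case_ge2 (k ℓ : ℕ) (hl2 : 2 ≤ ℓ) (hlk : ℓ ≤ k - 1) (α : ℝ) (hα : 0 < α) :
    ∃ ε : ℝ, 0 < ε ∧ ∀ δ : ℝ, 0 < δ → ∃ n₀ : ℕ, ∀ n : ℕ, n₀ ≤ n → (k - ℓ) ∣ n →
        ∀ H : Finset (Finset (Fin n)), H ⊆ kSets n k →
          (∀ v : Fin n, α * (n : ℝ) ^ (k - 1) ≤ (degOf H {v} : ℝ)) →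
          ∀ p : ℝ, p ≤ 1 → (n : ℝ) ^ (-((k : ℝ) - (ℓ : ℝ)) - ε) ≤ p →
            1 - δ ≤ gProb n k p (fun E => IsHamCycle n k ℓ (H ∪ E)) := by
  obtain ⟨d, hd⟩ : ∃ d, d = k - ℓ := ⟨_, rfl⟩
  have hd0 : 0 < d := by omega
  have hk3 : 3 ≤ k := by omega
  have hkd : d + 2 ≤ k := by omega
  have : NeZero d := ⟨by omega⟩
  have hdR : (k : ℝ) - ℓ = d := by
    rw [hd, Nat.cast_sub (by omega)]
  have hk0 : (0:ℝ) < k := by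
    have : 0 < k := by omega
    exact_mod_cast this
  set m : ℕ := ⌈2 * (k:ℝ) ^ 2 / α⌉₊ + 2 * k + 1 with hm
  have hm1 : 1 ≤ m := by omega
  have hmR : 2 * (k:ℝ) ^ 2 / α ≤ m := by
    have := Nat.le_ceil (2 * (k:ℝ) ^ 2 / α)
    rw [hm]; push_cast; linarith
  have hm0 : (0:ℝ) < m := by exact_mod_cast hm1
  set c : ℝ := α / (2 * k) with hc
  have hc0 : 0 < c := by positivity
  set A : ℝ := 1 + 1 / c + 2 * Real.exp 1 with hA
  have hA1 : 1 ≤ A := by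
    have := Real.exp_pos 1
    have : 0 < 1 / c := by positivity
    linarith
  have hA2 : 1 / c ≤ A := by
    have := Real.exp_pos 1
    linarith
  have hA3 : 2 * Real.exp 1 ≤ A := by
    have : 0 < 1 / c := by positivity
    linarith
  set η : ℝ := 1 / (4 * m) with hη
  have hη0 : 0 < η := by positivity
  set J : ℕ := 32 * m + 1 with hJ
  set Q : ℝ := (k : ℝ) ^ 2 * (k * A) ^ k with hQ
  have hQ0 : 0 < Q := by positivity
  refine ⟨η / 2, by positivity, fun δ hδ => ?_⟩
  have hlim : Filter.Tendsto (fun n : ℕ => (Real.exp 1 * Q * J) * (n : ℝ) ^ (-(3 * η / 8))) Filter.atTop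
      (nhds ((Real.exp 1 * Q * J) * 0)) := by
    refine Filter.Tendsto.const_mul _ ?_
    exact (tendsto_rpow_neg_atTop (by positivity)).comp tendsto_natCast_atTop_atTop
  rw [mul_zero] at hlim
  have h2J : (1:ℝ) ≤ 2 ^ J := one_le_pow₀ (by norm_num)
  have hev := hlim.eventually_lt_const (show (0:ℝ) < min (1/2) (δ / (4 * 2 ^ J)) by positivity)
  obtain ⟨n1, hn1⟩ := Filter.eventually_atTop.1 hev
  refine ⟨n1 + 8 * m * d + 2 * m * d + 2, fun n hn hdn H hH hdeg p hp1 hp => ?_⟩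
  rw [← hd] at hdn
  obtain ⟨r, hr⟩ := hdn
  have hn' : n = r * d := by rw [hr, mul_comm]
  have hr8 : 8 * m ≤ r := by
    by_contra hcon
    push Not at hcon
    have : r * d ≤ 8 * m * d := Nat.mul_le_mul_right _ hcon.le
    omega
  have : NeZero r := ⟨by omega⟩
  have hrn : r ≤ n := by rw [hn']; exact Nat.le_mul_of_pos_right r hd0
  have hnpos : 1 ≤ n := by omega
  have hn0 : (0:ℝ) < n := by exact_mod_cast hnpos
  have hn2 : (1:ℝ) < n := by
    have : 1 < n := by omega
    exact_mod_cast this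
  have hkmd : k ≤ m * d := by
    have : k ≤ m := by omega
    calc k ≤ m := this
      _ ≤ m * d := Nat.le_mul_of_pos_right m hd0
  have hkrd : k ≤ r * d := hkmd.trans (Nat.mul_le_mul_right _ (by omega))
  set N := r / m with hN
  have hNm : m * N ≤ r := Nat.mul_div_le r m
  have hN1 : 1 ≤ N := (Nat.one_le_div_iff (by omega)).2 (by omega)
  set B : Fin N → Fin k → (ZMod r × Fin d) := fun j i =>
    (((m * j.1 + i.1 / d : ℕ) : ZMod r), Fin.ofNat d i.1) with hBdef
  have hlt1 : ∀ i : Fin k, i.1 / d < m := fun i => (Nat.div_lt_iff_lt_mul hd0).2 (by omega)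
  have hlt2 : ∀ (j : Fin N) (i : Fin k), m * j.1 + i.1 / d < r := by
    intro j i
    have h1 := hlt1 i
    have h2 : m * (j.1 + 1) ≤ m * N := Nat.mul_le_mul_left _ j.2
    rw [mul_add] at h2
    omega
  have hB : Function.Injective (fun x : Fin N × Fin k => B x.1 x.2) := by
    rintro ⟨j, i⟩ ⟨j', i'⟩ h
    obtain ⟨h1, h2⟩ := Prod.mk.inj h
    have h3 := zmod_cast_inj (hlt2 j i) (hlt2 j' i') h1
    have h4 : i.1 % d = i'.1 % d := by simpa [Fin.ofNat] using congrArg Fin.val h2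
    have hj : j.1 = j'.1 := by
      have := congrArg (· / m) h3
      beta_reduce at this
      rw [Nat.mul_add_div (by omega), Nat.mul_add_div (by omega), Nat.div_eq_of_lt (hlt1 i),
        Nat.div_eq_of_lt (hlt1 i')] at this
      omega
    have hi : i.1 / d = i'.1 / d := by rw [hj] at h3; omega
    have hi' : i.1 = i'.1 := by rw [← Nat.div_add_mod i.1 d, ← Nat.div_add_mod i'.1 d, hi, h4]
    exact Prod.ext (Fin.ext hj) (Fin.ext hi')
  have hP : Fintype.card (ZMod r × Fin d) = n := by
    rw [Fintype.card_prod, ZMod.card, Fintype.card_fin, hn']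
  set Hx : Finset (ZMod r) := Finset.univ.image (fun j : Fin N => ((m * j.1 : ℕ) : ZMod r)) with hHxdef
  have hHx : ∀ i : ZMod r, ∃ t : ℕ, t < 2 * m ∧ i + (t : ZMod r) ∈ Hx := by
    intro i
    have hiv := ZMod.val_lt i
    have hcast : ((i.val : ℕ) : ZMod r) = i := ZMod.natCast_zmod_val i
    by_cases hcase : i.val ≤ m * (N - 1)
    · set j := (i.val + (m - 1)) / m with hj
      have hj1 : m * j ≤ i.val + (m - 1) := Nat.mul_div_le _ _
      have hj2 : i.val ≤ m * j := by
        have := Nat.lt_mul_div_succ (i.val + (m - 1)) (show 0 < m by omega)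
        rw [← hj, mul_add] at this
        omega
      have hjN : j < N := by
        by_contra hcon
        push Not at hcon
        have h1 : m * N ≤ m * j := Nat.mul_le_mul_left _ hcon
        have h2 : m * N = m * (N - 1) + m := by
          rw [← Nat.mul_succ]; congr 1; omega
        omega
      refine ⟨m * j - i.val, by omega, Finset.mem_image.2 ⟨⟨j, hjN⟩, Finset.mem_univ _, ?_⟩⟩
      simp only
      have : m * j = i.val + (m * j - i.val) := by omega
      conv_lhs => rw [this]
      rw [Nat.cast_add, hcast]
    · refine ⟨r - i.val, ?_, Finset.mem_image.2 ⟨⟨0, hN1⟩, Finset.mem_univ _, ?_⟩⟩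
      · have h1 := Nat.lt_mul_div_succ r (show 0 < m by omega)
        rw [← hN, mul_add] at h1
        have h2 : m * N = m * (N - 1) + m := by
          rw [← Nat.mul_succ]; congr 1; omega
        omega
      · simp only [mul_zero, Nat.cast_zero]
        have : (((i.val + (r - i.val) : ℕ)) : ZMod r) = 0 := by
          rw [show i.val + (r - i.val) = r by omega]; simp
        rw [Nat.cast_add, hcast] at this
        exact this.symm
  -- size of N
  have hNn : (N:ℝ) * m ≤ n := by
    have : N * m ≤ n := by rw [mul_comm]; omega
    exact_mod_cast this
  have hHc := card_H_lb (by omega) H hH α hdeg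
  have hcH' : c * (n : ℝ) ^ k + ((N * k) * n ^ (k - 1) : ℕ) ≤ H.card := by
    have e0 : (n : ℝ) ^ k = n * (n : ℝ) ^ (k - 1) := by
      rw [← pow_succ']; congr 1; omega
    have h1 : (N : ℝ) * k ≤ c * n := by
      have h3 : 2 * (k:ℝ)^2 ≤ m * α := by rwa [div_le_iff₀ hα] at hmR
      have h4 : (N:ℝ) * (2 * (k:ℝ)^2) ≤ N * (m * α) := by gcongr
      have h5 : (N:ℝ) * (m * α) ≤ n * α := by nlinarith
      rw [hc, div_mul_eq_mul_div, le_div_iff₀ (by positivity)]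
      nlinarith
    have h2 : α * (n:ℝ) ^ k / k ≤ H.card := by
      rw [div_le_iff₀ hk0]; linarith
    have h3 : α * (n:ℝ) ^ k / k = 2 * (c * (n : ℝ) ^ k) := by
      rw [hc]; field_simp
    have h4 : (((N * k) * n ^ (k - 1) : ℕ) : ℝ) ≤ c * (n:ℝ) ^ k := by
      push_cast
      rw [e0, ← mul_assoc]
      gcongr
    linarith
  have hltH : N * k * n ^ (k - 1) < H.card := by
    have h1 : 0 < c * (n : ℝ) ^ k := by positivity
    have : (((N * k) * n ^ (k - 1) : ℕ) : ℝ) < H.card := by linarith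
    exact_mod_cast this
  have hcH : c * (n : ℝ) ^ k ≤ ((H.card - (N * k) * n ^ (k - 1) : ℕ) : ℝ) := by
    rw [Nat.cast_sub hltH.le]; linarith
  have h2N : 2 * (N * k) ≤ n := by
    have : N * (2 * k) ≤ N * m := Nat.mul_le_mul_left _ (by omega)
    have h2 : N * m ≤ n := by rw [mul_comm]; omega
    nlinarith
  set g0 : ZMod r × Fin d → Fin n := fun _ => ⟨0, hnpos⟩ with hg0
  set Ω := blkOm H B g0 ∅ with hΩ
  have hΩne : Ω.Nonempty := blkOm_nonempty (by omega) H hH B hB hP g0 hltH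
  have hvs : ∀ (g : ZMod r × Fin d → Fin n) (T : Finset (ZMod r × Fin d)),
      ((Ω.filter fun π => ∀ x ∈ T, π x = g x).card : ℝ) ≤ (A / n) ^ T.card * Ω.card := by
    intro g T
    have h1 := vertex_spread (by omega) hnpos H hH B hB hP c A hc0 hcH h2N hA1 hA2 hA3 g T
    have h2 : (Ω.filter fun π => ∀ x ∈ T, π x = g x).card ≤ (blkOm H B g T).card := by
      refine Finset.card_le_card fun π hπ => ?_
      rw [Finset.mem_filter] at hπ
      have h3 := (mem_blkOm.1 hπ.1).1
      exact mem_blkOm.2 ⟨h3, hπ.2⟩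
    have h3 : (blkOm H B g ∅).card = Ω.card := congrArg _ (blkOm_empty H B g g0)
    rw [h3] at h1
    exact (Nat.cast_le.2 h2).trans h1
  have hsp := edge_spread hm1 hkd hr8 hrn Hx hHx A hA1 Ω hvs
  rw [← hη, ← hQ] at hsp
  set q : ℝ := Q * (n : ℝ) ^ (-((d:ℝ) + η)) with hq
  set ρ : ℝ := (n:ℝ) ^ (η / 8) with hρ
  set p0 : ℝ := (n:ℝ) ^ (-((d:ℝ)) - η / 2) / J with hp0
  have hJ0 : (0:ℝ) < J := by
    have : 0 < J := by omega
    exact_mod_cast this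
  have hp0pos : 0 < p0 := by positivity
  have hJp0 : J * p0 ≤ p := by
    rw [hdR] at hp
    rw [hp0, mul_div_cancel₀ _ hJ0.ne']; exact hp
  have hx : Real.exp 1 * ρ * (q / p0) = (Real.exp 1 * Q * J) * (n : ℝ) ^ (-(3 * η / 8)) := by
    have e : (n : ℝ) ^ (-(3 * η / 8)) = ρ * (n : ℝ) ^ (-((d:ℝ) + η)) / (n:ℝ) ^ (-((d:ℝ)) - η / 2) := by
      rw [hρ, ← Real.rpow_add hn0, ← Real.rpow_sub hn0]; congr 1; ring
    rw [e, hq, hp0]; field_simp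
  have hxsmall := hn1 n (by omega)
  rw [← hx, lt_min_iff] at hxsmall
  have hρ1 : 1 ≤ ρ := Real.one_le_rpow hn2.le (by positivity)
  have hfi := frag_iter (kSets n k) ρ q p0 hρ1 (by positivity) hp0pos hxsmall.1.le J Ω
    (RPi r d k Hx) 1 (hJp0.trans hp1) hΩne zero_le_one (by
      intro π hπ e he
      obtain ⟨i, _, rfl⟩ := Finset.mem_image.1 he
      refine Finset.mem_powersetCard.2 ⟨Finset.subset_univ _, ?_⟩
      rw [Finset.card_image_of_injective _ π.injective, card_posEdge hkrd]) (by
      intro π hπ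
      have h1 : (RPi r d k Hx π).card ≤ n := by
        refine Finset.card_image_le.trans ((Finset.card_filter_le _ _).trans ?_)
        rw [Finset.card_univ, ZMod.card]; exact hrn
      have h2 : ((RPi r d k Hx π).card : ℝ) ≤ n := by exact_mod_cast h1
      refine lt_of_le_of_lt h2 ?_
      rw [hρ, ← Real.rpow_mul_natCast hn0.le]
      have h3 : 1 < η / 8 * J := by
        rw [hη, hJ]; push_cast
        rw [div_div, div_mul_eq_mul_div, lt_div_iff₀ (by positivity)]; linarith
      calc (n:ℝ) = (n:ℝ) ^ (1:ℝ) := (Real.rpow_one _).symm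
        _ < _ := Real.rpow_lt_rpow_of_exponent_lt hn2 h3) (by
      intro S
      rw [one_mul]; convert hsp S)
  rw [gProb_eq_bw]
  have hle : 1 - δ ≤ 1 - 4 * 1 * (Real.exp 1 * ρ * (q / p0)) * (2 ^ J - 1) := by
    have h1 := hxsmall.2.le
    rw [le_div_iff₀ (by positivity)] at h1
    have h0 : 0 ≤ Real.exp 1 * ρ * (q / p0) := by positivity
    nlinarith
  refine hle.trans (hfi.trans ?_)
  refine (bw_mono (by positivity) (hJp0.trans hp1) (F' := fun E => if IsHamCycle n k ℓ (H ∪ E) then 1 else 0)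
    fun E _ => ?_).trans (bw_mono_p _ (by positivity) hJp0 hp1 ?_)
  · split_ifs with h1 h2 <;> try norm_num
    obtain ⟨π, hπ, hE⟩ := h1
    apply h2
    refine ham_of_pi hd hn' (H ∪ E) π fun i => ?_
    by_cases hi : i ∈ Hx
    · obtain ⟨j, _, rfl⟩ := Finset.mem_image.1 hi
      refine Finset.mem_union_left _ ?_
      have h3 := (mem_blkOm.1 hπ).1 j
      convert h3 using 1
      ext v
      simp only [posEdge, hBdef, Finset.mem_image, Finset.mem_range, Finset.mem_univ, true_and]
      constructor
      · rintro ⟨x, ⟨a, ha, rfl⟩, rfl⟩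
        exact ⟨⟨a, ha⟩, by push_cast; rfl⟩
      · rintro ⟨a, rfl⟩
        exact ⟨_, ⟨a.1, a.2, rfl⟩, by push_cast; rfl⟩
    · exact Finset.mem_union_right _ (hE (Finset.mem_image.2 ⟨i, by simp [hi], rfl⟩))
  · intro E E' hEE
    split_ifs with h1 h2 <;> try norm_num
    obtain ⟨f, hf1, hf2⟩ := h1
    exact h2 ⟨f, hf1, fun i hi => Finset.union_subset_union_right hEE (hf2 i hi)⟩

/-- loose path from `u` to `v` with vertex set `X` -/
inductive LP {n : ℕ} (E : Finset (Finset (Fin n))) : Fin n → Fin n → Finset (Fin n) → Prop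
  | nil (u : Fin n) : LP E u u {u}
  | cons {u w v : Fin n} {e X : Finset (Fin n)} (he : e ∈ E) (hu : u ∈ e) (huw : u ≠ w)
      (hX : e ∩ X = {w}) (h : LP E w v X) : LP E u v (e ∪ X)

section lp
variable {n j : ℕ} {E : Finset (Finset (Fin n))}

lemma LP.mem_left {u v : Fin n} {X : Finset (Fin n)} (h : LP E u v X) : u ∈ X := by
  cases h with
  | nil => simp
  | cons he hu huw hX h => simp [hu]

lemma LP.mem_right {u v : Fin n} {X : Finset (Fin n)} (h : LP E u v X) : v ∈ X := by
  induction h with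
  | nil => simp
  | cons he hu huw hX h ih => simp [ih]

lemma LP.mono {E' : Finset (Finset (Fin n))} (hE : E ⊆ E') {u v : Fin n} {X : Finset (Fin n)}
    (h : LP E u v X) : LP E' u v X := by
  induction h with
  | nil u => exact LP.nil u
  | cons he hu huw hX h ih => exact LP.cons (hE he) hu huw hX ih

lemma LP.concat {u v w : Fin n} {X X' : Finset (Fin n)} (h : LP E u v X) (h' : LP E v w X')
    (hd : X ∩ X' = {v}) : LP E u w (X ∪ X') := by
  induction h with
  | nil u => 
    have : u ∈ X' := h'.mem_left
    rwa [Finset.singleton_union, Finset.insert_eq_self.2 this]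
  | @cons u w' v e X1 he hu huw hX h ih =>
    have hv := h.mem_right
    have hv' := h'.mem_left
    have h1 : X1 ∩ X' = {v} := by
      ext a
      have := Finset.ext_iff.1 hd a
      simp only [Finset.mem_inter, Finset.mem_union, Finset.mem_singleton] at this ⊢
      constructor
      · rintro ⟨h1, h2⟩; exact this.1 ⟨Or.inr h1, h2⟩
      · rintro rfl; exact ⟨hv, hv'⟩
    rw [Finset.union_assoc]
    refine LP.cons he hu huw ?_ (ih h' h1)
    ext a
    have h2 := Finset.ext_iff.1 hd a
    have h3 := Finset.ext_iff.1 hX a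
    have h4 := Finset.ext_iff.1 hX w'
    simp only [Finset.mem_inter, Finset.mem_union, Finset.mem_singleton, iff_true] at h2 h3 h4 ⊢
    constructor
    · rintro ⟨h5, h6 | h6⟩
      · exact h3.1 ⟨h5, h6⟩
      · have := h2.1 ⟨Or.inl h5, h6⟩
        subst this
        exact h3.1 ⟨h5, hv⟩
    · rintro rfl; exact ⟨h4.1, Or.inl h4.2⟩

/-- one edge -/
lemma LP.single {e : Finset (Fin n)} (he : e ∈ E) {u v : Fin n} (hu : u ∈ e) (hv : v ∈ e) (huv : u ≠ v) :
    LP E u v e := by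
  have := LP.cons he hu huv (X := {v}) (by simp [hv]) (LP.nil v)
  rwa [Finset.union_eq_left.2 (by simpa using hv)] at this

/-- add an edge at the left end -/
lemma LP.card (hE : E ⊆ kSets n (j + 1)) {u v : Fin n} {X : Finset (Fin n)} (h : LP E u v X) :
    ∃ a, X.card = a * j + 1 := by
  induction h with
  | nil u => exact ⟨0, by simp⟩
  | @cons u w v e X he hu huw hX h ih =>
    obtain ⟨a, ha⟩ := ih
    have h1 := Finset.card_union_add_card_inter e X
    have h2 : e.card = j + 1 := (Finset.mem_powersetCard.1 (hE he)).2
    rw [hX, Finset.card_singleton] at h1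
    refine ⟨a + 1, ?_⟩
    rw [add_mul]; omega

/-- enumerate a finset with prescribed first element -/
lemma enum_first {s : Finset (Fin n)} {u : Fin n} (hu : u ∈ s) (hj : s.card = j) :
    ∃ h : ℕ → Fin n, h 0 = u ∧ Set.InjOn h (Set.Iio j) ∧ (Finset.range j).image h = s := by
  obtain ⟨j, rfl⟩ : ∃ i, j = i + 1 := ⟨j - 1, by have := Finset.card_pos.2 ⟨u, hu⟩; omega⟩
  have hc : (s.erase u).card = j := by rw [Finset.card_erase_of_mem hu]; omega
  let φ := (s.erase u).equivFinOfCardEq hc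
  let h : ℕ → Fin n := fun t => if ht : t - 1 < j ∧ 0 < t then (φ.symm ⟨t - 1, ht.1⟩ : Fin n) else u
  have hin : ∀ t (ht : t - 1 < j ∧ 0 < t), h t = (φ.symm ⟨t - 1, ht.1⟩ : Fin n) := fun t ht => dif_pos ht
  have h0 : h 0 = u := dif_neg (by simp)
  have hmem : ∀ t, t < j + 1 → 0 < t → h t ∈ s.erase u := by
    intro t ht h0
    rw [hin t ⟨by omega, h0⟩]; exact (φ.symm _).2
  refine ⟨h, h0, ?_, ?_⟩
  · intro a ha b hb hab
    simp only [Set.mem_Iio] at ha hb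
    rcases Nat.eq_zero_or_pos a with rfl | ha0 <;> rcases Nat.eq_zero_or_pos b with rfl | hb0
    · rfl
    · have := hmem b hb hb0; rw [← hab, h0] at this; simp at this
    · have := hmem a ha ha0; rw [hab, h0] at this; simp at this
    · rw [hin a ⟨by omega, ha0⟩, hin b ⟨by omega, hb0⟩] at hab
      have := φ.symm.injective (Subtype.ext hab)
      simp at this; omega
  · ext x
    simp only [Finset.mem_image, Finset.mem_range]
    constructor
    · rintro ⟨t, ht, rfl⟩
      rcases Nat.eq_zero_or_pos t with rfl | h1
      · rwa [h0]
      · exact Finset.mem_of_mem_erase (hmem t ht h1)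
    · intro hx
      by_cases hxu : x = u
      · exact ⟨0, by omega, by rw [h0, hxu]⟩
      · have hx' : x ∈ s.erase u := Finset.mem_erase.2 ⟨hxu, hx⟩
        refine ⟨(φ ⟨x, hx'⟩).1 + 1, by omega, ?_⟩
        rw [hin _ ⟨by have := (φ ⟨x, hx'⟩).2; omega, by omega⟩]
        simp

/-- prepend an edge -/
lemma seq_cons {g : ℕ → Fin n} {a : ℕ} (hj : 1 ≤ j)
    (hg : ∀ i < a, ((Finset.range (j + 1)).image fun t => g (i * j + t)) ∈ E)
    {e : Finset (Fin n)} (he : e ∈ E) (hec : e.card = j + 1) {u : Fin n} (hu : u ∈ e) (hw : g 0 ∈ e)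
    (huw : u ≠ g 0) :
    ∃ h : ℕ → Fin n, h 0 = u ∧ Set.InjOn h (Set.Iio j) ∧ (Finset.range j).image h = e.erase (g 0) ∧
      (∀ t, h (j + t) = g t) ∧
      (∀ i < a + 1, ((Finset.range (j + 1)).image fun t => h (i * j + t)) ∈ E) := by
  obtain ⟨h0, h00, h0i, h0e⟩ := enum_first (j := j) (Finset.mem_erase.2 ⟨huw, hu⟩)
    (by rw [Finset.card_erase_of_mem hw]; omega)
  let h : ℕ → Fin n := fun t => if t < j then h0 t else g (t - j)
  have hlt : ∀ t, t < j → h t = h0 t := fun t ht => if_pos ht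
  have hge : ∀ t, h (j + t) = g t := fun t => by simp [h]
  have him : (Finset.range j).image h = e.erase (g 0) := by
    rw [← h0e]; exact Finset.image_congr fun t ht => hlt t (by simpa using ht)
  refine ⟨h, by rw [hlt 0 (by omega), h00], ?_, him, hge, ?_⟩
  · intro a ha b hb hab
    rw [hlt a ha, hlt b hb] at hab
    exact h0i ha hb hab
  · intro i hi
    cases i with
    | zero =>
      convert he
      simp only [zero_mul, zero_add]
      rw [Finset.range_add_one, Finset.image_insert, him, show h j = g 0 from hge 0, Finset.insert_erase hw]
    | succ i =>
      convert hg i (by omega) using 2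
      funext t
      rw [show (i + 1) * j + t = j + (i * j + t) by ring, hge]

lemma LP.seq (hj : 1 ≤ j) (hE : E ⊆ kSets n (j + 1)) {u v : Fin n} {X : Finset (Fin n)} (h : LP E u v X) :
    ∃ (a : ℕ) (g : ℕ → Fin n), X.card = a * j + 1 ∧ g 0 = u ∧ g (a * j) = v ∧
      Set.InjOn g (Set.Iio (a * j + 1)) ∧ (Finset.range (a * j + 1)).image g = X ∧
      (∀ i < a, ((Finset.range (j + 1)).image fun t => g (i * j + t)) ∈ E) := by
  induction h with
  | nil u =>
    refine ⟨0, fun _ => u, by simp, rfl, rfl, ?_, by simp, by simp⟩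
    intro a ha b hb _
    simp at ha hb; omega
  | @cons u w v e X he hu huw hX h ih =>
    obtain ⟨a, g, hc, g0, gl, gi, gX, gE⟩ := ih
    have hec : e.card = j + 1 := (Finset.mem_powersetCard.1 (hE he)).2
    have hwe : w ∈ e := by
      have : w ∈ e ∩ X := by rw [hX]; simp
      exact (Finset.mem_inter.1 this).1
    subst g0
    obtain ⟨h', h0, h1, h2, h3, h4⟩ := seq_cons hj gE he hec hu hwe huw
    have hc' : (e ∪ X).card = (a + 1) * j + 1 := by
      have h1 := Finset.card_union_add_card_inter e X
      rw [hX, Finset.card_singleton] at h1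
      rw [add_mul]; omega
    have him : (Finset.range ((a + 1) * j + 1)).image h' = e ∪ X := by
      rw [show (a + 1) * j + 1 = j + (a * j + 1) by ring, Finset.range_add, Finset.image_union, h2]
      have : (Finset.image h' (Finset.map (addLeftEmbedding j) (Finset.range (a * j + 1)))) = X := by
        rw [← gX, Finset.map_eq_image, Finset.image_image]
        congr 1
        funext t
        simp [h3]
      rw [this]
      ext x
      simp only [Finset.mem_union, Finset.mem_erase]
      have : g 0 ∈ X := h.mem_left
      constructor
      · rintro (⟨_, h⟩ | h) <;> tauto
      · rintro (h | h)
        · by_cases hx : x = g 0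
          · subst hx; tauto
          · tauto
        · tauto
    refine ⟨a + 1, h', hc', h0, ?_, ?_, him, h4⟩
    · rw [show (a + 1) * j = j + a * j by ring, h3, gl]
    · have := (Finset.card_image_iff (s := Finset.range ((a + 1) * j + 1)) (f := h')).1
        (by rw [him, hc', Finset.card_range])
      intro x hx y hy hxy
      exact this (by simpa using hx) (by simpa using hy) hxy

lemma LP.ham (hj : 1 ≤ j) (hE : E ⊆ kSets n (j + 1)) {u v : Fin n} {X e : Finset (Fin n)}
    (h : LP E u v X) (huv : u ≠ v) (he : e ∈ E) (hX : e ∩ X = {u, v}) (hall : e ∪ X = Finset.univ) :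
    IsHamCycle n (j + 1) 1 E := by
  obtain ⟨a, g, hc, g0, gl, gi, gX, gE⟩ := h.seq hj hE
  have hec : e.card = j + 1 := (Finset.mem_powersetCard.1 (hE he)).2
  have hue : u ∈ e ∧ v ∈ e := by
    have h1 : u ∈ e ∩ X := by rw [hX]; simp
    have h2 : v ∈ e ∩ X := by rw [hX]; simp
    exact ⟨(Finset.mem_inter.1 h1).1, (Finset.mem_inter.1 h2).1⟩
  subst g0
  obtain ⟨h', h0, h1, h2, h3, h4⟩ := seq_cons hj gE he hec hue.2 hue.1 huv.symm
  have hn : n = (a + 1) * j := by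
    have h1 := Finset.card_union_add_card_inter e X
    rw [hX, hall, Finset.card_univ, Fintype.card_fin, Finset.card_pair huv] at h1
    rw [add_mul]; omega
  have hper : h' n = h' 0 := by
    have : n = j + a * j := by rw [hn]; ring
    rw [h0, congrArg h' this, h3, gl]
  have him : (Finset.range n).image h' = Finset.univ := by
    have hr : Finset.range n = Finset.range (j + a * j) := congrArg _ (by rw [hn]; ring)
    rw [hr, Finset.range_add, Finset.image_union, h2]
    have : (Finset.image h' (Finset.map (addLeftEmbedding j) (Finset.range (a * j)))) = (Finset.range (a * j)).image g := by
      rw [Finset.map_eq_image, Finset.image_image]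
      congr 1
      funext t
      simp [h3]
    rw [this, Finset.eq_univ_iff_forall]
    intro x
    have hx : x ∈ e ∪ X := by rw [hall]; simp
    rw [← gX, Finset.range_add_one, Finset.image_insert, gl] at hx
    simp only [Finset.mem_union, Finset.mem_erase, Finset.mem_insert] at hx ⊢
    by_cases hxu : x = g 0
    · by_cases ha : a = 0
      · subst ha; simp at gl; exact absurd gl huv
      · right; rw [hxu]
        exact Finset.mem_image_of_mem _ (Finset.mem_range.2 (by positivity))
    · rcases hx with hx | rfl | hx
      · exact Or.inl ⟨hxu, hx⟩
      · exact Or.inl ⟨hxu, hue.2⟩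
      · exact Or.inr hx
  have hn0 : 0 < n := Fin.pos v
  have : NeZero n := ⟨hn0.ne'⟩
  have hinj := (Finset.card_image_iff (s := Finset.range n) (f := h')).1
        (by rw [him]; simp)
  refine ⟨fun z => h' z.val, ?_, ?_⟩
  · rw [Fintype.bijective_iff_injective_and_card]
    refine ⟨fun x y hxy => ?_, by simp [ZMod.card]⟩
    exact ZMod.val_injective n (hinj (by simpa using ZMod.val_lt x) (by simpa using ZMod.val_lt y) hxy)
  · intro i hi
    simp only [Nat.add_sub_cancel] at hi ⊢
    have hdiv : n / j = a + 1 := by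
      conv_lhs => rw [hn]
      exact Nat.mul_div_cancel _ (by omega)
    rw [hdiv] at hi
    convert h4 i hi using 1
    refine Finset.image_congr fun t ht => ?_
    simp only [Finset.coe_range, Set.mem_Iio] at ht
    simp only [ZMod.val_natCast]
    have hle : i * j + t ≤ n := by
      have : (i + 1) * j ≤ (a + 1) * j := Nat.mul_le_mul_right _ (by omega)
      rw [← hn, add_mul] at this; omega
    rcases hle.lt_or_eq with h | h
    · rw [Nat.mod_eq_of_lt h]
    · rw [h, Nat.mod_self, hper]

/-- flexible path -/
def Flex (E : Finset (Finset (Fin n))) (u v : Fin n) (X : Finset (Fin n)) (T : Set (Finset (Fin n))) : Prop :=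
  u ∈ X ∧ v ∈ X ∧ ∀ Y ∈ T, Disjoint Y X → LP E u v (X ∪ Y)

def TT (T T' : Set (Finset (Fin n))) : Set (Finset (Fin n)) :=
  {Y | ∃ Y₁ ∈ T, ∃ Y₂ ∈ T', Disjoint Y₁ Y₂ ∧ Y = Y₁ ∪ Y₂}

lemma Flex.concat {u v w : Fin n} {X X' : Finset (Fin n)} {T T' : Set (Finset (Fin n))}
    (h : Flex E u v X T) (h' : Flex E v w X' T') (hd : X ∩ X' = {v}) :
    Flex E u w (X ∪ X') (TT T T') := by
  refine ⟨Finset.mem_union_left _ h.1, Finset.mem_union_right _ h'.2.1, ?_⟩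
  rintro Y ⟨Y₁, hY₁, Y₂, hY₂, hdY, rfl⟩ hdis
  rw [Finset.disjoint_union_left, Finset.disjoint_union_right, Finset.disjoint_union_right] at hdis
  obtain ⟨⟨d1, d2⟩, d3, d4⟩ := hdis
  have := (h.2.2 Y₁ hY₁ d1).concat (h'.2.2 Y₂ hY₂ d4) (by
    ext a
    have h1 := Finset.ext_iff.1 hd a
    have e1 : a ∈ _ → a ∉ _ := fun h => Finset.disjoint_left.1 d1 h
    have e2 : a ∈ _ → a ∉ _ := fun h => Finset.disjoint_left.1 d2 h
    have e3 : a ∈ _ → a ∉ _ := fun h => Finset.disjoint_left.1 d3 h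
    have e5 : a ∈ _ → a ∉ _ := fun h => Finset.disjoint_left.1 hdY h
    simp only [Finset.mem_inter, Finset.mem_union, Finset.mem_singleton] at h1 ⊢
    tauto)
  convert this using 1
  ext a; simp only [Finset.mem_union]; tauto

lemma TT_empty (T : Set (Finset (Fin n))) : TT T {∅} = T := by
  ext Y; constructor
  · rintro ⟨Y₁, h1, Y₂, h2, _, rfl⟩
    rw [Set.mem_singleton_iff] at h2; subst h2; simpa using h1
  · intro h; exact ⟨Y, h, ∅, rfl, by simp, by simp⟩

lemma flex_of_LP {u v : Fin n} {X : Finset (Fin n)} (h : LP E u v X) : Flex E u v X {∅} := by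
  refine ⟨h.mem_left, h.mem_right, fun Y hY _ => ?_⟩
  rw [Set.mem_singleton_iff] at hY; subst hY; simpa using h

end lp

section det
variable {n j : ℕ}

/-- link of a vertex -/
noncomputable def link (H : Finset (Finset (Fin n))) (j : ℕ) (v : Fin n) : Finset (Finset (Fin n)) :=
  (kSets n j).filter fun f => v ∉ f ∧ insert v f ∈ H

lemma mem_link {H : Finset (Finset (Fin n))} {v : Fin n} {f : Finset (Fin n)} :
    f ∈ link H j v ↔ f.card = j ∧ v ∉ f ∧ insert v f ∈ H := by
  simp [link, kSets]

/-- avoiding degree condition -/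
def DegB (H : Finset (Finset (Fin n))) (j B : ℕ) : Prop :=
  ∀ (v : Fin n) (A : Finset (Fin n)), A.card ≤ B → ∃ f ∈ link H j v, Disjoint f A

/-- transversal property of the random graph -/
def PP (G : Finset (Finset (Fin n))) (j M : ℕ) : Prop :=
  ∀ W : Fin (j + 1) → Finset (Fin n), (∀ i, M ≤ (W i).card) →
    ∃ x : Fin (j + 1) → Fin n, Function.Injective x ∧ (∀ i, x i ∈ W i) ∧ Finset.univ.image x ∈ G

lemma PP3 {G : Finset (Finset (Fin n))} {M : ℕ} (hj : 2 ≤ j) (hP : PP G j M) {S0 S1 S2 : Finset (Fin n)}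
    (h0 : M ≤ S0.card) (h1 : M ≤ S1.card) (h2 : M ≤ S2.card) :
    ∃ y ∈ S0, ∃ y' ∈ S1, ∃ g ∈ G, y ≠ y' ∧ y ∈ g ∧ y' ∈ g ∧ ∀ a ∈ g, a ≠ y → a ≠ y' → a ∈ S2 := by
  obtain ⟨x, hx, hW, hG⟩ := hP (fun i => if i.val = 0 then S0 else if i.val = 1 then S1 else S2)
    (by intro i; split_ifs <;> assumption)
  refine ⟨x ⟨0, by omega⟩, by simpa using hW ⟨0, by omega⟩, x ⟨1, by omega⟩, by simpa using hW ⟨1, by omega⟩,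
    _, hG, ?_, by simp, by simp, ?_⟩
  · intro h; have := hx h; simp at this
  · intro a ha h1 h2
    obtain ⟨i, _, rfl⟩ := Finset.mem_image.1 ha
    have := hW i
    rw [if_neg, if_neg] at this
    · exact this
    · intro h; apply h2; congr 1; exact Fin.ext h
    · intro h; apply h1; congr 1; exact Fin.ext h

lemma star {H : Finset (Finset (Fin n))} {B : ℕ} (hj : 1 ≤ j) (hD : DegB H j B) (v : Fin n)
    (A : Finset (Fin n)) (m : ℕ) (hA : A.card + m * j ≤ B) :
    ∃ (Y : Finset (Fin n)) (e : Fin n → Finset (Fin n)), Y.card = m ∧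
      (∀ y ∈ Y, y ∈ e y ∧ e y ∈ link H j v ∧ Disjoint (e y) A) ∧
      (∀ y ∈ Y, ∀ y' ∈ Y, y ≠ y' → Disjoint (e y) (e y')) := by
  induction m with
  | zero => exact ⟨∅, fun _ => ∅, by simp, by simp, by simp⟩
  | succ m ih =>
    rw [add_mul] at hA
    obtain ⟨Y, e, hc, h1, h2⟩ := ih (by omega)
    have hcu : (Y.biUnion e).card ≤ m * j := by
      rw [← hc]
      exact Finset.card_biUnion_le_card_mul _ _ _ fun y hy => (mem_link.1 (h1 y hy).2.1).1.le
    obtain ⟨f, hf, hfd⟩ := hD v (A ∪ Y.biUnion e) ((Finset.card_union_le _ _).trans (by omega))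
    rw [Finset.disjoint_union_right] at hfd
    obtain ⟨z, hz⟩ : f.Nonempty := Finset.card_pos.1 (by rw [(mem_link.1 hf).1]; omega)
    have hd : ∀ y ∈ Y, Disjoint f (e y) := fun y hy =>
      hfd.2.mono_right (Finset.subset_biUnion_of_mem e hy)
    have hzY : z ∉ Y := fun h => Finset.disjoint_left.1 (hd z h) hz (h1 z h).1
    have hzn : ∀ y ∈ Y, y ≠ z := fun y hy h => hzY (h ▸ hy)
    refine ⟨insert z Y, Function.update e z f, by rw [Finset.card_insert_of_notMem hzY, hc], ?_, ?_⟩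
    · intro y hy
      rcases Finset.mem_insert.1 hy with rfl | hy2
      · simp [hz, hf, hfd.1]
      · rw [Function.update_of_ne (hzn _ hy2)]; exact h1 y hy2
    · intro y hy y' hy' hne
      rcases Finset.mem_insert.1 hy with h3 | h3 <;> rcases Finset.mem_insert.1 hy' with h4 | h4
      · exact absurd (h3.trans h4.symm) hne
      · rw [h3, Function.update_self, Function.update_of_ne (hzn _ h4)]; exact hd y' h4
      · rw [h4, Function.update_self, Function.update_of_ne (hzn _ h3)]; exact (hd y h3).symm
      · rw [Function.update_of_ne (hzn _ h3),
          Function.update_of_ne (hzn _ h4)]; exact h2 y h3 y' h4 hne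

variable {H G : Finset (Finset (Fin n))} {B M : ℕ}

lemma star_card {v : Fin n} {Y : Finset (Fin n)} {e : Fin n → Finset (Fin n)} 
    (h1 : ∀ y ∈ Y, e y ∈ link H j v) : (Y.biUnion e).card ≤ Y.card * j :=
  Finset.card_biUnion_le_card_mul _ _ _ fun y hy => (mem_link.1 (h1 y hy)).1.le

lemma link_path (hj : 2 ≤ j) (hH : H ⊆ kSets n (j + 1)) (hG : G ⊆ kSets n (j + 1))
    (hD : DegB H j B) (hP : PP G j M) (hBn : B ≤ n) (v u : Fin n) (hvu : v ≠ u)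
    (A : Finset (Fin n)) (hv : v ∈ A) (hu : u ∈ A) (hA : A.card + (2 * M * j + M) ≤ B) :
    ∃ K, LP (H ∪ G) v u K ∧ K ∩ A = {v, u} ∧ K.card ≤ 3 * (j + 1) := by
  have e0 : 2 * M * j = M * j + M * j := by ring
  obtain ⟨Y, e, hc, h1, h2⟩ := star (by omega) hD v A M (by omega)
  have hcu := star_card fun y hy => (h1 y hy).2.1
  rw [hc] at hcu
  have hcA1 := Finset.card_union_le A (Y.biUnion e)
  obtain ⟨Y', e', hc', h1', h2'⟩ := star (by omega) hD u (A ∪ Y.biUnion e) M (by omega)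
  have hcu' := star_card fun y hy => (h1' y hy).2.1
  rw [hc'] at hcu'
  have hcA2 := Finset.card_union_le (A ∪ Y.biUnion e) (Y'.biUnion e')
  obtain ⟨y, hy, y', hy', g, hg, hne, hyg, hyg', hrest⟩ := PP3 hj hP (S0 := Y) (S1 := Y')
    (S2 := (A ∪ Y.biUnion e ∪ Y'.biUnion e')ᶜ) hc.ge hc'.ge (by
      rw [Finset.card_compl, Fintype.card_fin]; omega)
  have hl := mem_link.1 (h1 y hy).2.1
  have hl' := mem_link.1 (h1' y' hy').2.1
  have hye := (h1 y hy).1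
  have hye' := (h1' y' hy').1
  have hdA := (h1 y hy).2.2
  have hdA' := (Finset.disjoint_union_right.1 (h1' y' hy').2.2).1
  have hdee : Disjoint (e' y') (e y) := (Finset.disjoint_union_right.1 (h1' y' hy').2.2).2.mono_right
    (Finset.subset_biUnion_of_mem e hy)
  have hrest' : ∀ a ∈ g, a ≠ y → a ≠ y' → a ∉ A ∧ a ∉ e y ∧ a ∉ e' y' := by
    intro a ha ha1 ha2
    have := hrest a ha ha1 ha2
    simp only [Finset.mem_compl, Finset.mem_union, Finset.mem_biUnion, not_or, not_exists, not_and] at this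
    exact ⟨this.1.1, this.1.2 y hy, this.2 y' hy'⟩
  have dA : ∀ a ∈ e y, a ∉ A := fun a ha => Finset.disjoint_left.1 hdA ha
  have dA' : ∀ a ∈ e' y', a ∉ A := fun a ha => Finset.disjoint_left.1 hdA' ha
  have dee : ∀ a ∈ e' y', a ∉ e y := fun a ha => Finset.disjoint_left.1 hdee ha
  have hyA := dA y hye
  have hyA' := dA' y' hye'
  have p1 : LP (H ∪ G) v y (insert v (e y)) := LP.single (Finset.mem_union_left _ hl.2.2) (by simp)
    (by simp [hye]) (by rintro rfl; exact hyA hv)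
  have p2 : LP (H ∪ G) y y' g := LP.single (Finset.mem_union_right _ hg) hyg hyg' hne
  have p3 : LP (H ∪ G) y' u (insert u (e' y')) := LP.single (Finset.mem_union_left _ hl'.2.2)
    (by simp [hye']) (by simp) (by rintro rfl; exact hyA' hu)
  have p12 := p1.concat p2 (by
    ext a
    simp only [Finset.mem_inter, Finset.mem_insert, Finset.mem_singleton]
    constructor
    · rintro ⟨h3, h4⟩
      by_contra hay
      by_cases hay' : a = y'
      · subst hay'
        rcases h3 with rfl | h3
        · exact hyA' hv
        · exact dee _ hye' h3
      · have := hrest' a h4 hay hay'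
        rcases h3 with rfl | h3
        · exact this.1 hv
        · exact this.2.1 h3
    · rintro rfl; exact ⟨Or.inr hye, hyg⟩)
  have p := p12.concat p3 (by
    ext a
    simp only [Finset.mem_inter, Finset.mem_insert, Finset.mem_singleton, Finset.mem_union]
    constructor
    · rintro ⟨h3, h4⟩
      by_contra hay'
      rcases h3 with (rfl | h3) | h3
      · rcases h4 with h4 | h4
        · exact hvu h4
        · exact dA' _ h4 hv
      · rcases h4 with rfl | h4
        · exact dA _ h3 hu
        · exact dee _ h4 h3
      · by_cases hay : a = y
        · subst hay
          rcases h4 with rfl | h4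
          · exact hyA hu
          · exact dee _ h4 hye
        · have := hrest' a h3 hay hay'
          rcases h4 with rfl | h4
          · exact this.1 hu
          · exact this.2.2 h4
    · rintro rfl; exact ⟨Or.inr hyg', Or.inr hye'⟩)
  refine ⟨_, p, ?_, ?_⟩
  · ext a
    simp only [Finset.mem_inter, Finset.mem_insert, Finset.mem_singleton, Finset.mem_union]
    constructor
    · rintro ⟨((rfl | h3) | h3) | (rfl | h3), h4⟩
      · simp
      · exact absurd h4 (dA _ h3)
      · by_cases hay : a = y
        · subst hay; exact absurd h4 hyA
        by_cases hay' : a = y'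
        · subst hay'; exact absurd h4 hyA'
        exact absurd h4 (hrest' a h3 hay hay').1
      · simp
      · exact absurd h4 (dA' _ h3)
    · rintro (rfl | rfl)
      · exact ⟨by simp, hv⟩
      · exact ⟨by simp, hu⟩
  · have c1 : (insert v (e y)).card = j + 1 := by rw [Finset.card_insert_of_notMem hl.2.1, hl.1]
    have c2 : g.card = j + 1 := (Finset.mem_powersetCard.1 (hG hg)).2
    have c3 : (insert u (e' y')).card = j + 1 := by rw [Finset.card_insert_of_notMem hl'.2.1, hl'.1]
    have := Finset.card_union_le (insert v (e y)) g
    have := Finset.card_union_le (insert v (e y) ∪ g) (insert u (e' y'))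
    omega

lemma join (hj : 2 ≤ j) (hH : H ⊆ kSets n (j + 1)) (hG : G ⊆ kSets n (j + 1))
    (hD : DegB H j B) (hP : PP G j M) (hBn : B ≤ n) {u v a b : Fin n} {X X' A : Finset (Fin n)}
    {T T' : Set (Finset (Fin n))} (h : Flex (H ∪ G) u v X T) (h' : Flex (H ∪ G) a b X' T')
    (hd : Disjoint X X') (hA : X.card + X'.card + A.card + (2 * M * j + M) ≤ B) :
    ∃ X'', Flex (H ∪ G) u b X'' (TT T T') ∧ X ⊆ X'' ∧ X' ⊆ X'' ∧
      X''.card ≤ X.card + X'.card + 3 * (j + 1) ∧ (∀ x ∈ X'', x ∉ X → x ∉ X' → x ∉ A) := by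
  have hva : v ≠ a := by rintro rfl; exact Finset.disjoint_left.1 hd h.2.1 h'.1
  have c1 := Finset.card_union_le X X'
  have c2 := Finset.card_union_le (X ∪ X') A
  obtain ⟨K, hK, hKA, hKc⟩ := link_path hj hH hG hD hP hBn v a hva (X ∪ X' ∪ A)
    (by simp [h.2.1]) (by simp [h'.1]) (by omega)
  have hv := h.2.1
  have ha := h'.1
  have hvX' : v ∉ X' := fun hx => Finset.disjoint_left.1 hd hv hx
  have haX : a ∉ X := fun hx => Finset.disjoint_left.1 hd hx ha
  have hKA' : ∀ x ∈ K, x ∈ X ∨ x ∈ X' ∨ x ∈ A → x = v ∨ x = a := by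
    intro x hx hx2
    have : x ∈ K ∩ (X ∪ X' ∪ A) := by simp only [Finset.mem_inter, Finset.mem_union]; tauto
    rw [hKA] at this; simpa using this
  have f1 := h.concat (flex_of_LP hK) (by
    ext x
    simp only [Finset.mem_inter, Finset.mem_singleton]
    constructor
    · rintro ⟨h1, h2⟩
      rcases hKA' x h2 (Or.inl h1) with h | rfl
      · exact h
      · exact absurd h1 haX
    · rintro rfl; exact ⟨hv, hK.mem_left⟩)
  have f2 := f1.concat h' (by
    ext x
    simp only [Finset.mem_inter, Finset.mem_singleton, Finset.mem_union]
    constructor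
    · rintro ⟨h1 | h1, h2⟩
      · exact absurd h2 (Finset.disjoint_left.1 hd h1)
      · rcases hKA' x h1 (Or.inr (Or.inl h2)) with rfl | h
        · exact absurd h2 hvX'
        · exact h
    · rintro rfl; exact ⟨Or.inr hK.mem_right, ha⟩)
  rw [TT_empty] at f2
  refine ⟨_, f2, fun x hx => by simp [hx], fun x hx => by simp [hx], ?_, ?_⟩
  · have := Finset.card_union_le X K
    have := Finset.card_union_le (X ∪ K) X'
    omega
  · intro x hx h1 h2 h3
    simp only [Finset.mem_union] at hx
    rcases hx with (hx | hx) | hx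
    · exact h1 hx
    · rcases hKA' x hx (Or.inr (Or.inr h3)) with rfl | rfl
      · exact h1 hv
      · exact h2 ha
    · exact h2 hx

/-- DFS -/
lemma dfs (hj : 2 ≤ j) (hG : G ⊆ kSets n (j + 1)) (hP : PP G j M) (hM : 1 ≤ M) {R U : Finset (Fin n)}
    (hR : M ≤ R.card) (hRU : Disjoint R U) :
    ∃ r ∈ R, ∃ x X, LP G x r X ∧ X ⊆ insert r U ∧ (U \ X).card ≤ (j + 1) * M := by
  have key : ∀ N : ℕ, ∀ (x r : Fin n) (X D U' : Finset (Fin n)), 2 * U'.card + X.card + (R \ D).card ≤ N →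
      LP G x r X → r ∈ R → X ⊆ insert r U → Disjoint X U' → U' ⊆ U → Disjoint D U' → Disjoint D X →
      (∀ d ∈ D, ∀ g ∈ G, d ∈ g → ∃ a ∈ g, a ≠ d ∧ a ∉ U') → (U \ (X ∪ U')).card ≤ j * D.card →
      (D.card < M) →
      ∃ r ∈ R, ∃ x X, LP G x r X ∧ X ⊆ insert r U ∧ (U \ X).card ≤ (j + 1) * M := by
    intro N
    induction N with
    | zero =>
      intro x r X D U' hN hLP hr _ _ _ _ _ _ _ _
      have := Finset.card_pos.2 ⟨_, hLP.mem_left⟩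
      omega
    | succ N ih =>
      intro x r X D U' hN hLP hr hXU hXU' hU'U hDU' hDX hDe hcard hDM
      by_cases hUM : U'.card < M
      · refine ⟨r, hr, x, X, hLP, hXU, ?_⟩
        have h1 : U \ X ⊆ (U \ (X ∪ U')) ∪ U' := by
          intro a; simp only [Finset.mem_sdiff, Finset.mem_union]; tauto
        have h2 := (Finset.card_le_card h1).trans (Finset.card_union_le _ _)
        have h3 : j * D.card ≤ j * M := Nat.mul_le_mul_left _ hDM.le
        rw [add_mul, one_mul]; omega
      push Not at hUM
      by_cases hext : ∃ g ∈ G, x ∈ g ∧ ∀ a ∈ g, a ≠ x → a ∈ U'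
      · obtain ⟨g, hg, hxg, hgU⟩ := hext
        have hgc : g.card = j + 1 := (Finset.mem_powersetCard.1 (hG hg)).2
        have hxc : (g.erase x).card = j := by rw [Finset.card_erase_of_mem hxg, hgc]; omega
        obtain ⟨z, hz⟩ : (g.erase x).Nonempty := Finset.card_pos.1 (by omega)
        have hsub : g.erase x ⊆ U' := fun a ha => hgU a (Finset.mem_of_mem_erase ha) (Finset.ne_of_mem_erase ha)
        have hxX := hLP.mem_left
        have hgX : g ∩ X = {x} := by
          ext a
          simp only [Finset.mem_inter, Finset.mem_singleton]
          constructor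
          · rintro ⟨h1, h2⟩
            by_contra hax
            exact Finset.disjoint_left.1 hXU' h2 (hgU a h1 hax)
          · rintro rfl; exact ⟨hxg, hxX⟩
        have hnew : LP G z r (g ∪ X) := LP.cons hg (Finset.mem_of_mem_erase hz) (Finset.ne_of_mem_erase hz) hgX hLP
        have hgX2 : g ∪ X = g.erase x ∪ X := by
          ext a; simp only [Finset.mem_union, Finset.mem_erase]
          by_cases hax : a = x
          · subst hax; tauto
          · tauto
        have c1 : (U' \ g.erase x).card + j = U'.card := by
          rw [← hxc]; exact Finset.card_sdiff_add_card_eq_card hsub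
        have c2 : (g ∪ X).card ≤ j + X.card := by
          rw [hgX2, ← hxc]; exact Finset.card_union_le _ _
        refine ih z r (g ∪ X) D (U' \ g.erase x) (by omega) hnew hr ?_ ?_ ?_ ?_ ?_ ?_ ?_ hDM
        · rw [hgX2]; exact Finset.union_subset ((hsub.trans hU'U).trans (Finset.subset_insert _ _)) hXU
        · rw [hgX2, Finset.disjoint_union_left]
          exact ⟨Finset.disjoint_sdiff, hXU'.mono_right Finset.sdiff_subset⟩
        · exact Finset.sdiff_subset.trans hU'U
        · exact hDU'.mono_right Finset.sdiff_subset
        · rw [hgX2, Finset.disjoint_union_right]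
          exact ⟨hDU'.mono_right hsub, hDX⟩
        · intro d hd g' hg' hdg
          obtain ⟨a, h1, h2, h3⟩ := hDe d hd g' hg' hdg
          exact ⟨a, h1, h2, fun h => h3 (Finset.mem_sdiff.1 h).1⟩
        · refine le_trans (Finset.card_le_card ?_) hcard
          intro a
          rw [hgX2]
          simp only [Finset.mem_sdiff, Finset.mem_union]; tauto
      · push Not at hext
        have hxX := hLP.mem_left
        have hxD : x ∉ D := fun h => Finset.disjoint_left.1 hDX h hxX
        have hDe' : ∀ d ∈ insert x D, ∀ g ∈ G, d ∈ g → ∃ a ∈ g, a ≠ d ∧ a ∉ U' := by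
          intro d hd g hg hdg
          rcases Finset.mem_insert.1 hd with rfl | hd
          · exact hext g hg hdg
          · exact hDe d hd g hg hdg
        have hDM' : (insert x D).card < M := by
          by_contra hcon
          push Not at hcon
          obtain ⟨y, hy, y', hy', g, hg, hne, hyg, hyg', hrest⟩ := PP3 hj hP hcon hUM hUM
          obtain ⟨a, h1, h2, h3⟩ := hDe' y hy g hg hyg
          by_cases ha : a = y'
          · subst ha; exact h3 hy'
          · exact h3 (hrest a h1 h2 ha)
        have hxU' : x ∉ U' := fun h => Finset.disjoint_left.1 hXU' hxX h
        have hDU'' : Disjoint (insert x D) U' := by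
          rw [Finset.disjoint_insert_left]; exact ⟨hxU', hDU'⟩
        have hcD : (insert x D).card = D.card + 1 := Finset.card_insert_of_notMem hxD
        cases hLP with
        | nil =>
          obtain ⟨r', hr', hr'D⟩ : ∃ r' ∈ R, r' ∉ insert x D := by
            by_contra hcon
            push Not at hcon
            exact absurd (Finset.card_le_card hcon) (by omega)
          refine ih r' r' {r'} (insert x D) U' ?_ (LP.nil r') hr' (by simp) ?_ hU'U hDU'' (by simpa using hr'D) hDe' ?_ hDM'
          · have : (R \ insert x D).card < (R \ D).card := by
              refine Finset.card_lt_card (Finset.ssubset_iff_subset_ne.2 ⟨?_, ?_⟩)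
              · exact Finset.sdiff_subset_sdiff le_rfl (Finset.subset_insert _ _)
              · intro h
                have : x ∈ R \ D := Finset.mem_sdiff.2 ⟨hr, hxD⟩
                rw [← h] at this; simp at this
            simp only [Finset.card_singleton] at hN ⊢
            omega
          · rw [Finset.disjoint_singleton_left]
            exact fun h => Finset.disjoint_left.1 hRU hr' (hU'U h)
          · have h1 : U \ ({r'} ∪ U') ⊆ insert x (U \ ({x} ∪ U')) := by
              intro a; simp only [Finset.mem_sdiff, Finset.mem_union, Finset.mem_insert, Finset.mem_singleton]; tauto
            have h2 := (Finset.card_le_card h1).trans (Finset.card_insert_le _ _)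
            rw [hcD, mul_add]; omega
        | @cons _ w _ e X1 he hu huw hX h1 =>
          have hec : e.card = j + 1 := (Finset.mem_powersetCard.1 (hG he)).2
          have hw : w ∈ e ∩ X1 := by rw [hX]; simp
          have hw' := Finset.mem_inter.1 hw
          have cc := Finset.card_union_add_card_inter e X1
          rw [hX, Finset.card_singleton] at cc
          have hxX1 : x ∉ X1 := by
            intro h
            have : x ∈ e ∩ X1 := Finset.mem_inter.2 ⟨hu, h⟩
            rw [hX] at this; exact huw (by simpa using this)
          refine ih w r X1 (insert x D) U' ?_ h1 hr (Finset.subset_union_right.trans hXU)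
            (hXU'.mono_left Finset.subset_union_right) hU'U hDU'' ?_ hDe' ?_ hDM'
          · have : (R \ insert x D).card ≤ (R \ D).card :=
              Finset.card_le_card (Finset.sdiff_subset_sdiff le_rfl (Finset.subset_insert _ _))
            omega
          · rw [Finset.disjoint_insert_left]
            exact ⟨hxX1, hDX.mono_right Finset.subset_union_right⟩
          · have h2 : U \ (X1 ∪ U') ⊆ (U \ (e ∪ X1 ∪ U')) ∪ e.erase w := by
              intro a ha
              simp only [Finset.mem_sdiff, Finset.mem_union, Finset.mem_erase] at ha ⊢
              by_cases haw : a = w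
              · subst haw; tauto
              · tauto
            have h3 := (Finset.card_le_card h2).trans (Finset.card_union_le _ _)
            rw [Finset.card_erase_of_mem hw'.1, hec] at h3
            rw [hcD, mul_add]; omega
  obtain ⟨r, hr⟩ : R.Nonempty := Finset.card_pos.1 (by omega)
  refine key _ r r {r} ∅ U le_rfl (LP.nil r) hr (by simp) ?_ le_rfl (by simp) (by simp) (by simp) ?_ (by simp; omega)
  · rw [Finset.disjoint_singleton_left]; exact fun h => Finset.disjoint_left.1 hRU hr h
  · simp

lemma trim {E : Finset (Finset (Fin n))} (hE : E ⊆ kSets n (j + 1)) (hj : 1 ≤ j) (q : ℕ) : ∀ {x r : Fin n} {X : Finset (Fin n)},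
    LP E x r X → q * j < X.card →
    ∃ J : Finset (Fin n), J.card = q ∧ J ⊆ X ∧ ∀ y ∈ J, ∃ X', X' ⊆ X ∧ LP E y r X' ∧ (X \ X').card ≤ q * j := by
  induction q with
  | zero => intro x r X _ _; exact ⟨∅, by simp⟩
  | succ q ih =>
    intro x r X h hc
    rw [add_mul] at hc
    cases h with
    | nil => simp at hc; omega
    | @cons _ w _ e X1 he hu huw hX h1 =>
      have hec : e.card = j + 1 := (Finset.mem_powersetCard.1 (hE he)).2
      have hw : w ∈ e ∩ X1 := by rw [hX]; simp
      have hw' := Finset.mem_inter.1 hw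
      have cc := Finset.card_union_add_card_inter e X1
      rw [hX, Finset.card_singleton] at cc
      have hxX1 : x ∉ X1 := by
        intro h
        have : x ∈ e ∩ X1 := Finset.mem_inter.2 ⟨hu, h⟩
        rw [hX] at this; exact huw (by simpa using this)
      obtain ⟨J, hJc, hJX, hJ⟩ := ih h1 (by omega)
      refine ⟨insert x J, by rw [Finset.card_insert_of_notMem (fun h => hxX1 (hJX h)), hJc], ?_, ?_⟩
      · refine Finset.insert_subset (by simp [hu]) (hJX.trans Finset.subset_union_right)
      · intro y hy
        rcases Finset.mem_insert.1 hy with rfl | hy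
        · exact ⟨_, le_rfl, LP.cons he hu huw hX h1, by simp⟩
        · obtain ⟨X', h2, h3, h4⟩ := hJ y hy
          refine ⟨X', h2.trans Finset.subset_union_right, h3, ?_⟩
          have h5 : (e ∪ X1) \ X' ⊆ (X1 \ X') ∪ e.erase w := by
            intro a ha
            simp only [Finset.mem_sdiff, Finset.mem_union, Finset.mem_erase] at ha ⊢
            by_cases haw : a = w
            · subst haw; tauto
            · tauto
          have h6 := (Finset.card_le_card h5).trans (Finset.card_union_le _ _)
          rw [Finset.card_erase_of_mem hw'.1, hec] at h6
          rw [add_mul]; omega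

end det

section det
variable {n j : ℕ} {H G : Finset (Finset (Fin n))} {B M : ℕ}

set_option maxHeartbeats 1000000 in
lemma finish (hj : 2 ≤ j) (hH : H ⊆ kSets n (j + 1)) (hG : G ⊆ kSets n (j + 1))
    (hD : DegB H j B) (hP : PP G j M) (hM : 1 ≤ M) (hBn : B ≤ n) (hjn : j ∣ n) {a b : Fin n} (hab : a ≠ b)
    {X : Finset (Fin n)} {T : Set (Finset (Fin n))} (hF : Flex (H ∪ G) a b X T)
    (hT : ∀ L : Finset (Fin n), Disjoint L X → j ∣ L.card → L.card ≤ 6 * (j + 1) * M → L ∈ T)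
    (hX : X.card + 6 * (j + 1) * M < B) : IsHamCycle n (j + 1) 1 (H ∪ G) := by
  have hE : H ∪ G ⊆ kSets n (j + 1) := Finset.union_subset hH hG
  have e0 : 6 * (j + 1) * M = 6 * (M * j) + 6 * M := by ring
  rw [e0] at hX hT
  obtain ⟨ha, hb, hF⟩ := hF
  obtain ⟨Y, e, hc, h1, h2⟩ := star (by omega) hD a X M (by omega)
  have hcu := star_card fun y hy => (h1 y hy).2.1
  rw [hc] at hcu
  have hcA1 := Finset.card_union_le X (Y.biUnion e)
  obtain ⟨Y', e', hc', h1', h2'⟩ := star (by omega) hD b (X ∪ Y.biUnion e) M (by omega)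
  have hcu' := star_card fun y hy => (h1' y hy).2.1
  rw [hc'] at hcu'
  set Q := X ∪ Y.biUnion e ∪ Y'.biUnion e' with hQ
  have hcQ : Q.card ≤ X.card + M * j + M * j := (Finset.card_union_le _ _).trans (by omega)
  obtain ⟨W, hWQ, hWc⟩ : ∃ W ⊆ Qᶜ, W.card = M := Finset.exists_subset_card_eq (by
    rw [Finset.card_compl, Fintype.card_fin]; omega)
  set U := (Q ∪ W)ᶜ with hU
  have hcU : n ≤ U.card + X.card + M * j + M * j + M := by
    have := Finset.card_union_le Q W
    rw [hU, Finset.card_compl, Fintype.card_fin]; omega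
  have hYQ : ∀ y ∈ Y, ∀ x ∈ e y, x ∈ Q := by
    intro y hy x hx
    simp only [hQ, Finset.mem_union, Finset.mem_biUnion]
    exact Or.inl (Or.inr ⟨y, hy, hx⟩)
  have hYQ' : ∀ y ∈ Y', ∀ x ∈ e' y, x ∈ Q := by
    intro y hy x hx
    simp only [hQ, Finset.mem_union, Finset.mem_biUnion]
    exact Or.inr ⟨y, hy, hx⟩
  have hXQ : ∀ x ∈ X, x ∈ Q := fun x hx => by simp [hQ, hx]
  obtain ⟨r, hr, x0, XD, hLP, hXD, hUX⟩ := dfs hj hG hP hM (R := Y) (U := U) hc.ge (by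
    rw [Finset.disjoint_left]
    intro y hy hyU
    have := hYQ y hy y (h1 y hy).1
    rw [hU, Finset.mem_compl, Finset.mem_union] at hyU
    exact hyU (Or.inl this))
  have hcXD : M * j < XD.card := by
    have : U.card ≤ (U \ XD).card + XD.card := by
      rw [← Finset.card_sdiff_add_card_inter U XD]
      exact Nat.add_le_add_left (Finset.card_le_card Finset.inter_subset_right) _
    have e1 : (j + 1) * M = M * j + M := by ring
    omega
  obtain ⟨J, hJc, hJX, hJ⟩ := trim hG (by omega) M hLP hcXD
  obtain ⟨y0, hy0, y', hy', g, hg, hne, hyg, hyg', hrest⟩ := PP3 hj hP hJc.ge hc'.ge hWc.ge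
  obtain ⟨X', hX'D, hLP', hX'c⟩ := hJ y0 hy0
  have hl := mem_link.1 (h1 r hr).2.1
  have hl' := mem_link.1 (h1' y' hy').2.1
  have hre := (h1 r hr).1
  have hye' := (h1' y' hy').1
  have fSa : ∀ x ∈ e r, x ∉ X := fun x hx => Finset.disjoint_left.1 (h1 r hr).2.2 hx
  have fSb0 := Finset.disjoint_union_right.1 (h1' y' hy').2.2
  have fSb : ∀ x ∈ e' y', x ∉ X ∧ x ∉ e r := fun x hx =>
    ⟨Finset.disjoint_left.1 fSb0.1 hx, fun h => Finset.disjoint_left.1 fSb0.2 hx (Finset.mem_biUnion.2 ⟨r, hr, h⟩)⟩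
  have fW : ∀ x ∈ W, x ∉ X ∧ x ∉ e r ∧ x ∉ e' y' := by
    intro x hx
    have := hWQ hx
    rw [Finset.mem_compl] at this
    exact ⟨fun h => this (hXQ x h), fun h => this (hYQ r hr x h), fun h => this (hYQ' y' hy' x h)⟩
  have fX : ∀ x ∈ X', x = r ∨ (x ∉ X ∧ x ∉ e r ∧ x ∉ e' y' ∧ x ∉ W) := by
    intro x hx
    rcases Finset.mem_insert.1 (hXD (hX'D hx)) with h | h
    · exact Or.inl h
    · right
      rw [hU, Finset.mem_compl, Finset.mem_union, not_or] at h
      exact ⟨fun h' => h.1 (hXQ x h'), fun h' => h.1 (hYQ r hr x h'), fun h' => h.1 (hYQ' y' hy' x h'), h.2⟩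
  have fg : ∀ x ∈ g, x = y0 ∨ x = y' ∨ x ∈ W := by
    intro x hx
    by_cases h3 : x = y0
    · exact Or.inl h3
    by_cases h4 : x = y'
    · exact Or.inr (Or.inl h4)
    exact Or.inr (Or.inr (hrest x hx h3 h4))
  have hy0X := hLP'.mem_left
  have hrX := hLP'.mem_right
  set C : Finset (Fin n) → Finset (Fin n) := fun Y => g ∪ (X' ∪ (insert a (e r) ∪ (X ∪ Y))) with hC
  have chain : ∀ Y ∈ T, Disjoint Y (insert b (e' y') ∪ C ∅) →
      LP (H ∪ G) y' b (C Y) ∧ insert b (e' y') ∩ C Y = {y', b} := by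
    intro Y hY hdY
    have fY : ∀ x ∈ Y, x ≠ b ∧ x ∉ e' y' ∧ x ∉ g ∧ x ∉ X' ∧ x ≠ a ∧ x ∉ e r ∧ x ∉ X := by
      intro x hx
      have := Finset.disjoint_left.1 hdY hx
      simp only [hC, Finset.mem_union, Finset.mem_insert, Finset.notMem_empty, or_false, not_or] at this
      tauto
    have p0 := hF Y hY (Finset.disjoint_left.2 fun x hx => (fY x hx).2.2.2.2.2.2)
    have p1 : LP (H ∪ G) r b (insert a (e r) ∪ (X ∪ Y)) := by
      refine LP.cons (Finset.mem_union_left _ hl.2.2) (Finset.mem_insert_of_mem hre) ?_ ?_ p0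
      · rintro rfl; exact fSa _ hre ha
      · ext x
        simp only [Finset.mem_inter, Finset.mem_insert, Finset.mem_union, Finset.mem_singleton]
        grind
    have p2 := (hLP'.mono (E' := H ∪ G) Finset.subset_union_right).concat p1 (by
      ext x
      simp only [Finset.mem_inter, Finset.mem_insert, Finset.mem_union, Finset.mem_singleton]
      grind)
    refine ⟨LP.cons (Finset.mem_union_right _ hg) hyg' hne.symm ?_ p2, ?_⟩
    · ext x
      simp only [Finset.mem_inter, Finset.mem_insert, Finset.mem_union, Finset.mem_singleton]
      grind
    · ext x
      simp only [hC, Finset.mem_inter, Finset.mem_insert, Finset.mem_union, Finset.mem_singleton]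
      grind
  have hy'b : y' ≠ b := by rintro rfl; exact (fSb _ hye').1 hb
  have hce : (insert b (e' y')).card = j + 1 := by rw [Finset.card_insert_of_notMem hl'.2.1, hl'.1]
  set L := (insert b (e' y') ∪ C ∅)ᶜ with hL
  have hLdiv : j ∣ L.card := by
    obtain ⟨p, hp⟩ := chain ∅ (hT ∅ (by simp) (by simp) (by simp)) (by simp)
    obtain ⟨q, hq⟩ := p.card hE
    have h3 := Finset.card_union_add_card_inter (insert b (e' y')) (C ∅)
    rw [hp, Finset.card_pair hy'b, hq, hce] at h3
    rw [hL, Finset.card_compl, Fintype.card_fin]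
    refine Nat.dvd_sub hjn ⟨q + 1, ?_⟩
    rw [mul_add, mul_comm]; omega
  have hLX : Disjoint L X := by
    rw [Finset.disjoint_left]
    intro x hx hxX
    rw [hL, Finset.mem_compl] at hx
    apply hx; simp [hC, hxX]
  have hLc : L.card ≤ 6 * (M * j) + 6 * M := by
    have hsub : L ⊆ Y.biUnion e ∪ Y'.biUnion e' ∪ W ∪ (U \ XD) ∪ (XD \ X') := by
      intro x hx
      rw [hL, Finset.mem_compl] at hx
      by_contra hcon
      simp only [hC, Finset.mem_union, Finset.mem_insert, Finset.notMem_empty, or_false, not_or,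
        Finset.mem_sdiff] at hx hcon
      have hxU : x ∉ U := by tauto
      apply hxU
      rw [hU, Finset.mem_compl, hQ]
      simp only [Finset.mem_union, not_or]
      tauto
    have h3 := Finset.card_le_card hsub
    have h4 := Finset.card_union_le (Y.biUnion e ∪ Y'.biUnion e' ∪ W ∪ (U \ XD)) (XD \ X')
    have h5 := Finset.card_union_le (Y.biUnion e ∪ Y'.biUnion e' ∪ W) (U \ XD)
    have h6 := Finset.card_union_le (Y.biUnion e ∪ Y'.biUnion e') W
    have h7 := Finset.card_union_le (Y.biUnion e) (Y'.biUnion e')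
    have e1 : (j + 1) * M = M * j + M := by ring
    omega
  obtain ⟨p, hp⟩ := chain L (hT L hLX hLdiv hLc) (by rw [hL]; exact disjoint_compl_left)
  refine p.ham (by omega) hE hy'b (Finset.mem_union_left _ hl'.2.2) hp ?_
  rw [Finset.eq_univ_iff_forall]
  intro x
  by_cases hx : x ∈ L
  · simp [hC, hx]
  · rw [hL, Finset.mem_compl, not_not] at hx
    simp only [hC, Finset.mem_union, Finset.mem_insert, Finset.notMem_empty, or_false] at hx ⊢
    tauto

end det

section det
variable {n j : ℕ} {H G : Finset (Finset (Fin n))} {B M : ℕ}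

lemma Flex.mono {E : Finset (Finset (Fin n))} {u v : Fin n} {X : Finset (Fin n)} {T T' : Set (Finset (Fin n))}
    (h : Flex E u v X T) (hT : T' ⊆ T) : Flex E u v X T' :=
  ⟨h.1, h.2.1, fun Y hY => h.2.2 Y (hT hY)⟩

lemma LP.ne {E : Finset (Finset (Fin n))} {u v : Fin n} {X : Finset (Fin n)} (h : LP E u v X)
    (hX : 1 < X.card) : u ≠ v := by
  cases h with
  | nil => simp at hX
  | @cons _ w _ e X1 he hu huw hXe h1 =>
    rintro rfl
    have : u ∈ e ∩ X1 := Finset.mem_inter.2 ⟨hu, h1.mem_right⟩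
    rw [hXe] at this; exact huw (by simpa using this)

/-- sets of vertices that can be held simultaneously by the units `b` -/
def UT (H : Finset (Finset (Fin n))) (j : ℕ) {r : ℕ} (b : Fin r → Finset (Fin n)) : Set (Finset (Fin n)) :=
  {Y | ∃ σ : Fin r → Fin n, Function.Injective σ ∧ (∀ i, b i ∈ link H j (σ i)) ∧ Y = Finset.univ.image σ}

noncomputable def Nbr (H : Finset (Finset (Fin n))) (j : ℕ) (f : Finset (Fin n)) : Finset (Fin n) :=
  Finset.univ.filter fun y => f ∈ link H j y

lemma mem_Nbr {f : Finset (Fin n)} {y : Fin n} : y ∈ Nbr H j f ↔ f ∈ link H j y := by simp [Nbr]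

lemma unit_flex (hj : 2 ≤ j) {f : Finset (Fin n)} (hf : f.card = j) :
    ∃ a b, Flex (H ∪ G) a b f {Y | ∃ y, f ∈ link H j y ∧ Y = {y}} := by
  obtain ⟨a, ha, b, hb, hab⟩ := Finset.one_lt_card.1 (show 1 < f.card by omega)
  refine ⟨a, b, ha, hb, ?_⟩
  rintro Y ⟨y, hy, rfl⟩ _
  rw [Finset.union_comm f, Finset.singleton_union]
  exact LP.single (Finset.mem_union_left _ (mem_link.1 hy).2.2) (by simp [ha]) (by simp [hb]) hab

lemma units (hj : 2 ≤ j) (hH : H ⊆ kSets n (j + 1)) (hG : G ⊆ kSets n (j + 1))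
    (hD : DegB H j B) (hP : PP G j M) (hBn : B ≤ n) {u v : Fin n} {X : Finset (Fin n)}
    {T : Set (Finset (Fin n))} (h : Flex (H ∪ G) u v X T) (r : ℕ) :
    ∀ (b : Fin r → Finset (Fin n)) (A : Finset (Fin n)), (∀ i, (b i).card = j) → (∀ i, Disjoint (b i) X) →
    (∀ i i', i ≠ i' → Disjoint (b i) (b i')) →
    X.card + r * (4 * j + 3) + A.card + r * j + (2 * M * j + M) ≤ B →
    ∃ v' X', Flex (H ∪ G) u v' X' (TT T (UT H j b)) ∧ X ⊆ X' ∧ X'.card ≤ X.card + r * (4 * j + 3) ∧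
      (∀ x ∈ X', x ∉ X → (∀ i, x ∉ b i) → x ∉ A) := by
  induction r with
  | zero =>
    intro b A _ _ _ _
    refine ⟨v, X, h.mono ?_, le_rfl, by simp, fun x hx hx' => absurd hx hx'⟩
    rintro Y ⟨Y₁, hY₁, Y₂, ⟨σ, _, _, rfl⟩, _, rfl⟩
    simpa using hY₁
  | succ r ih =>
    intro b A hbc hbX hbd hB
    have e1 : (r + 1) * (4 * j + 3) = r * (4 * j + 3) + (4 * j + 3) := by ring
    have e2 : (r + 1) * j = r * j + j := by ring
    rw [e1, e2] at hB
    have hcA := Finset.card_union_le A (b (Fin.last r))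
    rw [hbc] at hcA
    obtain ⟨v', X', hF, hXX, hc, hA⟩ := ih (fun i => b i.castSucc) (A ∪ b (Fin.last r)) (fun i => hbc _)
      (fun i => hbX _) (fun i i' hi => hbd _ _ (by simpa using hi)) (by omega)
    obtain ⟨a', b', hU⟩ := unit_flex (H := H) (G := G) hj (hbc (Fin.last r))
    obtain ⟨X'', hF', hX1, hX2, hc', hA'⟩ := join (A := A) hj hH hG hD hP hBn hF hU (by
      rw [Finset.disjoint_left]
      intro x hx hxb
      refine hA x hx (fun h => Finset.disjoint_left.1 (hbX _) hxb h) (fun i hi => ?_) (Finset.mem_union_right _ hxb)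
      exact Finset.disjoint_left.1 (hbd i.castSucc (Fin.last r) (Fin.castSucc_lt_last i).ne) hi hxb) (by
      rw [hbc]; omega)
    rw [hbc] at hc'
    refine ⟨b', X'', hF'.mono ?_, hXX.trans hX1, by rw [e1]; omega, ?_⟩
    · rintro Y ⟨Y₁, hY₁, Y₂, ⟨σ, hσi, hσ, rfl⟩, hdis, rfl⟩
      have him : Finset.univ.image σ = (Finset.univ.image fun i : Fin r => σ i.castSucc) ∪ {σ (Fin.last r)} := by
        ext x
        simp only [Finset.mem_image, Finset.mem_univ, true_and, Finset.mem_union, Finset.mem_singleton]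
        constructor
        · rintro ⟨i, rfl⟩
          induction i using Fin.lastCases with
          | last => right; rfl
          | cast i => left; exact ⟨i, rfl⟩
        · rintro (⟨i, rfl⟩ | rfl)
          · exact ⟨_, rfl⟩
          · exact ⟨_, rfl⟩
      rw [him, Finset.disjoint_union_right] at hdis
      refine ⟨Y₁ ∪ (Finset.univ.image fun i : Fin r => σ i.castSucc), ⟨Y₁, hY₁, _, ⟨_, ?_, fun i => hσ _, rfl⟩,
        hdis.1, rfl⟩, {σ (Fin.last r)}, ⟨_, hσ _, rfl⟩, ?_, by rw [him, Finset.union_assoc]⟩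
      · intro i i' hi; exact Fin.castSucc_injective r (hσi hi)
      · rw [Finset.disjoint_union_left]
        refine ⟨hdis.2, ?_⟩
        rw [Finset.disjoint_singleton_right]
        intro hx
        obtain ⟨i, _, hi⟩ := Finset.mem_image.1 hx
        exact (Fin.castSucc_lt_last i).ne (hσi hi)
    · intro x hx hxX hxb
      by_cases hx' : x ∈ X'
      · exact fun hxA => hA x hx' hxX (fun i => hxb _) (Finset.mem_union_left _ hxA)
      · exact hA' x hx hx' (hxb _)

lemma slot_flex {f W : Finset (Fin n)} {p z q : Fin n} (hp : f ∈ link H j p) (hz : f ∈ link H j z)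
    (hzW : z ∈ W) (hg : insert p W ∈ G) (hpW : p ∉ W) (hWf : Disjoint W f) (hq : q ∈ f) :
    Flex (H ∪ G) p q (insert p f) {∅, W} := by
  have hp' := mem_link.1 hp
  have hz' := mem_link.1 hz
  refine ⟨by simp, by simp [hq], ?_⟩
  rintro Y hY _
  rcases hY with rfl | rfl
  · rw [Finset.union_empty]
    exact LP.single (Finset.mem_union_left _ hp'.2.2) (by simp) (by simp [hq]) (by rintro rfl; exact hp'.2.1 hq)
  · have p1 : LP (H ∪ G) p z (insert p Y) := LP.single (Finset.mem_union_right _ hg) (by simp) (by simp [hzW])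
      (by rintro rfl; exact hpW hzW)
    have p2 : LP (H ∪ G) z q (insert z f) := LP.single (Finset.mem_union_left _ hz'.2.2) (by simp) (by simp [hq])
      (by rintro rfl; exact hz'.2.1 hq)
    have := p1.concat p2 (by
      have hd : ∀ x ∈ Y, x ∉ f := fun x hx => Finset.disjoint_left.1 hWf hx
      have := hp'.2.1
      ext x
      simp only [Finset.mem_inter, Finset.mem_insert, Finset.mem_singleton]
      grind)
    convert this using 1
    ext x
    simp only [Finset.mem_union, Finset.mem_insert]
    grind

/-- slot condition -/
def SlotC (H : Finset (Finset (Fin n))) (j B R R' : ℕ) : Prop :=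
  ∀ f : Finset (Fin n), R ≤ (Nbr H j f).card → ∀ A : Finset (Fin n), A.card ≤ B →
    ∃ f0 : Finset (Fin n), f0.card = j ∧ Disjoint f0 A ∧ R' ≤ (Nbr H j f0 ∩ Nbr H j f).card

lemma bundle (hj : 2 ≤ j) (hH : H ⊆ kSets n (j + 1)) (hG : G ⊆ kSets n (j + 1))
    (hD : DegB H j B) (hP : PP G j M) (hBn : B ≤ n) {R R' : ℕ} (hS : SlotC H j B R R') (hRR : R' ≤ R)
    {u v : Fin n} {X : Finset (Fin n)}
    {T : Set (Finset (Fin n))} (h : Flex (H ∪ G) u v X T) (b : Fin j → Finset (Fin n))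
    (hbc : ∀ i, (b i).card = j) (hbX : ∀ i, Disjoint (b i) X)
    (hbd : ∀ i i', i ≠ i' → Disjoint (b i) (b i')) (hbR : ∀ i, R ≤ (Nbr H j (b i)).card)
    (hXB : X.card + 10 * (j + 1) ^ 2 + (2 * M * j + M) ≤ B) (hXR : X.card + 10 * (j + 1) ^ 2 + M ≤ R') :
    ∃ v' X', Flex (H ∪ G) u v' X' (T ∪ TT T (UT H j b)) ∧ X ⊆ X' ∧ X'.card ≤ X.card + 4 * (j + 1) ^ 2 := by
  have e1 : (j + 1) ^ 2 = j * j + 2 * j + 1 := by ring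
  rw [e1] at hXB hXR ⊢
  set l : Fin j := ⟨j - 1, by omega⟩ with hl
  set Bu := Finset.univ.biUnion b with hBu
  have hcBu : Bu.card ≤ j * j := by
    refine (Finset.card_biUnion_le_card_mul _ _ j fun i _ => (hbc i).le).trans ?_
    simp
  have hcXB := Finset.card_union_le X Bu
  obtain ⟨f, hfc, hfd, hfR⟩ := hS (b l) (hbR l) (X ∪ Bu) (by omega)
  set Q := X ∪ Bu ∪ f with hQ
  have hcQ : Q.card ≤ X.card + j * j + j := by
    have := Finset.card_union_le (X ∪ Bu) f
    rw [← hQ] at this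
    omega
  set N0 := Nbr H j f ∩ Nbr H j (b l) with hN0
  have hbig : ∀ S : Finset (Fin n), R' ≤ S.card → M ≤ (S \ Q).card := by
    intro S hS
    have := Finset.le_card_sdiff Q S
    omega
  obtain ⟨x, hxi, hxW, hxG⟩ := hP (Fin.cons (N0 \ Q) fun i => (if i = l then N0 else Nbr H j (b i)) \ Q) (by
    intro i
    induction i using Fin.cases with
    | zero => exact hbig _ hfR
    | succ i =>
      rw [Fin.cons_succ]
      refine hbig _ ?_
      split_ifs
      · exact hfR
      · exact hRR.trans (hbR i))
  set p := x 0 with hp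
  set w : Fin j → Fin n := fun i => x i.succ with hw
  set W := Finset.univ.image w with hWdef
  have hp0 : p ∈ N0 \ Q := by simpa using hxW 0
  have hw0 : ∀ i, w i ∈ (if i = l then N0 else Nbr H j (b i)) \ Q := by
    intro i; simpa using hxW i.succ
  have hwb : ∀ i, b i ∈ link H j (w i) := by
    intro i
    have := (Finset.mem_sdiff.1 (hw0 i)).1
    split_ifs at this with hi
    · rw [hi] at this ⊢; exact mem_Nbr.1 (Finset.mem_inter.1 this).2
    · exact mem_Nbr.1 this
  have hwl : f ∈ link H j (w l) := by
    have := (Finset.mem_sdiff.1 (hw0 l)).1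
    rw [if_pos rfl] at this
    exact mem_Nbr.1 (Finset.mem_inter.1 this).1
  have hpl : f ∈ link H j p := mem_Nbr.1 (Finset.mem_inter.1 (Finset.mem_sdiff.1 hp0).1).1
  have hWQ : ∀ y ∈ W, y ∉ Q := by
    intro y hy
    obtain ⟨i, _, rfl⟩ := Finset.mem_image.1 hy
    exact (Finset.mem_sdiff.1 (hw0 i)).2
  have hpQ := (Finset.mem_sdiff.1 hp0).2
  have hwi : Function.Injective w := fun i i' hi => Fin.succ_injective _ (hxi hi)
  have hpW : p ∉ W := by
    intro hy
    obtain ⟨i, _, hi⟩ := Finset.mem_image.1 hy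
    exact Fin.succ_ne_zero i (hxi hi)
  have hg : insert p W ∈ G := by
    convert hxG
    ext y
    simp only [Finset.mem_insert, hWdef, Finset.mem_image, Finset.mem_univ, true_and]
    constructor
    · rintro (rfl | ⟨i, rfl⟩)
      · exact ⟨0, rfl⟩
      · exact ⟨i.succ, rfl⟩
    · rintro ⟨i, rfl⟩
      induction i using Fin.cases with
      | zero => left; rfl
      | succ i => right; exact ⟨i, rfl⟩
  have hWc : W.card ≤ j := by
    refine Finset.card_image_le.trans ?_; simp
  have hQm : ∀ y, y ∉ Q → y ∉ X ∧ (∀ i, y ∉ b i) ∧ y ∉ f := by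
    intro y hy
    simp only [hQ, hBu, Finset.mem_union, Finset.mem_biUnion, Finset.mem_univ, true_and, not_or, not_exists] at hy
    tauto
  have hfm : ∀ y ∈ f, y ∉ X ∧ ∀ i, y ∉ b i := by
    intro y hy
    have := Finset.disjoint_left.1 hfd hy
    simp only [hBu, Finset.mem_union, Finset.mem_biUnion, Finset.mem_univ, true_and, not_or, not_exists] at this
    tauto
  obtain ⟨q, hq⟩ : f.Nonempty := Finset.card_pos.1 (by omega)
  have hslot := slot_flex hpl hwl (Finset.mem_image_of_mem w (Finset.mem_univ l)) hg hpW
    (Finset.disjoint_left.2 fun y hy => (hQm y (hWQ y hy)).2.2) hq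
  have hpf : p ∉ f := (hQm p hpQ).2.2
  have hcpf : (insert p f).card = j + 1 := by rw [Finset.card_insert_of_notMem hpf, hfc]
  have e2 : j * (4 * j + 3) = 4 * (j * j) + 3 * j := by ring
  have hcA1 := Finset.card_union_le (insert p f) W
  obtain ⟨v1, X1, hF1, hXX1, hc1, hA1⟩ := units hj hH hG hD hP hBn h j b (insert p f ∪ W) hbc hbX hbd (by omega)
  rw [e2] at hc1
  obtain ⟨X3, hF3, hX13, hpX3, hc3, hA3⟩ := join (A := W) hj hH hG hD hP hBn hF1 hslot (by
    rw [Finset.disjoint_left]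
    intro y hy hyf
    have hyA : y ∈ insert p f ∪ W := Finset.mem_union_left _ hyf
    have hyy : y ∉ X ∧ ∀ i, y ∉ b i := by
      rcases Finset.mem_insert.1 hyf with rfl | hyf
      · exact ⟨(hQm _ hpQ).1, (hQm _ hpQ).2.1⟩
      · exact hfm y hyf
    exact hA1 y hy hyy.1 hyy.2 hyA) (by omega)
  have hWX3 : ∀ y ∈ W, y ∉ X3 := by
    intro y hy hy3
    have hyQ := hQm y (hWQ y hy)
    have h1 : y ∉ X1 := fun h1 => hA1 y h1 hyQ.1 hyQ.2.1 (Finset.mem_union_right _ hy)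
    refine hA3 y hy3 h1 ?_ hy
    intro h2
    rcases Finset.mem_insert.1 h2 with rfl | h2
    · exact hpW hy
    · exact hyQ.2.2 h2
  have hWUT : W ∈ UT H j b := ⟨w, hwi, hwb, rfl⟩
  refine ⟨q, X3 ∪ W, ⟨Finset.mem_union_left _ hF3.1, Finset.mem_union_left _ hF3.2.1, ?_⟩,
    (hXX1.trans hX13).trans Finset.subset_union_left, ?_⟩
  · intro Y hY hYd
    rw [Finset.disjoint_union_right] at hYd
    have hin : Y ∪ W ∈ TT (TT T (UT H j b)) {∅, W} := by
      rcases hY with hY | hY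
      · exact ⟨Y ∪ W, ⟨Y, hY, W, hWUT, hYd.2, rfl⟩, ∅, by simp, by simp, by simp⟩
      · exact ⟨Y, hY, W, by simp, hYd.2, rfl⟩
    have := hF3.2.2 _ hin (by
      rw [Finset.disjoint_union_left]
      exact ⟨hYd.1, Finset.disjoint_left.2 hWX3⟩)
    convert this using 1
    ext y; simp only [Finset.mem_union]; tauto
  · have := Finset.card_union_le X3 W
    omega

/-- insertion sets of a list of bundles -/
def TB (H : Finset (Finset (Fin n))) (j : ℕ) : List (Fin j → Finset (Fin n)) → Set (Finset (Fin n))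
  | [] => {∅}
  | b :: Bs => TB H j Bs ∪ TT (TB H j Bs) (UT H j b)

/-- number of bundles good for a request -/
noncomputable def cnt (H : Finset (Finset (Fin n))) (j : ℕ) (σ : Fin j → Fin n) :
    List (Fin j → Finset (Fin n)) → ℕ
  | [] => 0
  | b :: Bs => (if ∀ i, b i ∈ link H j (σ i) then 1 else 0) + cnt H j σ Bs

lemma absorb (Bs : List (Fin j → Finset (Fin n))) :
    ∀ (h : ℕ) (L : Finset (Fin n)), L.card = j * h →
      (∀ σ : Fin j → Fin n, Function.Injective σ → (∀ i, σ i ∈ L) → h ≤ cnt H j σ Bs) → L ∈ TB H j Bs := by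
  have hex : ∀ (h : ℕ) (L : Finset (Fin n)), L.card = j * h → 1 ≤ h →
      ∃ σ : Fin j → Fin n, Function.Injective σ ∧ (∀ i, σ i ∈ L) := by
    intro h L hL hh
    have hjL : j ≤ L.card := by rw [hL]; exact Nat.le_mul_of_pos_right _ hh
    obtain ⟨S, hS, hSc⟩ := Finset.exists_subset_card_eq hjL
    let φ := S.equivFinOfCardEq hSc
    exact ⟨fun i => φ.symm i, fun i i' hi => φ.symm.injective (Subtype.ext hi), fun i => hS (φ.symm i).2⟩
  induction Bs with
  | nil =>
    intro h L hL hc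
    rcases Nat.eq_zero_or_pos h with rfl | hh
    · simp at hL; subst hL; rfl
    · obtain ⟨σ, h1, h2⟩ := hex h L hL hh
      have := hc σ h1 h2
      simp [cnt] at this; omega
  | cons b Bs ih =>
    intro h L hL hc
    rcases Nat.eq_zero_or_pos h with rfl | hh
    · exact Or.inl (ih 0 L hL fun _ _ _ => Nat.zero_le _)
    by_cases hg : ∃ σ : Fin j → Fin n, Function.Injective σ ∧ (∀ i, σ i ∈ L) ∧ ∀ i, b i ∈ link H j (σ i)
    · obtain ⟨σ, h1, h2, h3⟩ := hg
      right
      have hsub : Finset.univ.image σ ⊆ L := by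
        intro x hx
        obtain ⟨i, _, rfl⟩ := Finset.mem_image.1 hx
        exact h2 i
      refine ⟨L \ Finset.univ.image σ, ih (h - 1) _ ?_ ?_, Finset.univ.image σ, ⟨σ, h1, h3, rfl⟩,
        Finset.sdiff_disjoint, (Finset.sdiff_union_of_subset hsub).symm⟩
      · rw [Finset.card_sdiff_of_subset hsub, hL, Finset.card_image_of_injective _ h1, Finset.card_univ,
          Fintype.card_fin, Nat.mul_sub, mul_one]
      · intro τ t1 t2
        have := hc τ t1 fun i => (Finset.mem_sdiff.1 (t2 i)).1
        simp only [cnt] at this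
        split_ifs at this <;> omega
    · left
      refine ih h L hL fun σ h1 h2 => ?_
      have := hc σ h1 h2
      simp only [cnt] at this
      rw [if_neg (fun h3 => hg ⟨σ, h1, h2, h3⟩)] at this
      omega

end det

section det
variable {n j : ℕ} {H G : Finset (Finset (Fin n))} {B M : ℕ}

lemma link_sub (v : Fin n) : link H j v ⊆ kSets n j := Finset.filter_subset _ _

lemma kSets_card_le (n j : ℕ) : ((kSets n j).card : ℝ) ≤ (n : ℝ) ^ j := by
  have : (kSets n j).card ≤ n ^ j := by
    simp only [kSets, Finset.card_powersetCard, Finset.card_univ, Fintype.card_fin]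
    exact Nat.choose_le_pow n j
  exact_mod_cast this

lemma deg_le_link (hH : H ⊆ kSets n (j + 1)) (v : Fin n) : degOf H {v} ≤ (link H j v).card := by
  unfold degOf
  refine Finset.card_le_card_of_injOn (fun e => e.erase v) ?_ ?_
  · intro e he
    simp only [Finset.coe_filter, Finset.singleton_subset_iff, Set.mem_ofPred_eq] at he
    have hc : e.card = j + 1 := by simpa [kSets] using hH he.1
    refine Finset.mem_coe.2 (mem_link.2 ⟨?_, by simp, ?_⟩)
    · rw [Finset.card_erase_of_mem he.2, hc]; rfl
    · rw [Finset.insert_erase he.2]; exact he.1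
  · intro e he e' he' h
    simp only [Finset.coe_filter, Finset.singleton_subset_iff, Set.mem_ofPred_eq] at he he'
    have h : e.erase v = e'.erase v := h
    rw [← Finset.insert_erase he.2, h, Finset.insert_erase he'.2]

lemma avoid_card (hj : 1 ≤ j) {S : Finset (Finset (Fin n))} (hS : S ⊆ kSets n j) {a x : ℝ}
    (h : a * (n : ℝ) ^ j ≤ S.card) {A : Finset (Fin n)} (hA : (A.card : ℝ) ≤ x * n) :
    (a - x) * (n : ℝ) ^ j ≤ ((S.filter fun f => Disjoint f A).card : ℝ) := by
  have h1 := card_edges_meeting hj S hS A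
  have h2 := Finset.card_filter_add_card_filter_not (s := S) (fun f => Disjoint f A)
  have h3 : ((S.filter fun f => ¬ Disjoint f A).card : ℝ) ≤ A.card * (n : ℝ) ^ (j - 1) := by exact_mod_cast h1
  have h4 : ((S.filter fun f => Disjoint f A).card : ℝ) + ((S.filter fun f => ¬ Disjoint f A).card : ℝ) = S.card := by
    exact_mod_cast h2
  have h5 : (n : ℝ) ^ j = n * (n : ℝ) ^ (j - 1) := by
    rw [← pow_succ']; congr 1; omega
  have h6 : (A.card : ℝ) * (n : ℝ) ^ (j - 1) ≤ x * n * (n : ℝ) ^ (j - 1) :=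
    mul_le_mul_of_nonneg_right hA (by positivity)
  have h7 : x * n * (n : ℝ) ^ (j - 1) = x * (n : ℝ) ^ j := by rw [h5]; ring
  have h8 : (a - x) * (n : ℝ) ^ j = a * (n : ℝ) ^ j - x * (n : ℝ) ^ j := by ring
  linarith

lemma degB_of {α : ℝ} (hα : 0 < α) (hj : 1 ≤ j) (hn : 0 < n) (hl : ∀ v, α * (n : ℝ) ^ j ≤ (link H j v).card)
    (hB : (B : ℝ) ≤ α / 4 * n) : DegB H j B := by
  intro v A hA
  have h := avoid_card hj (link_sub v) (hl v) (A := A) (x := α / 4) (le_trans (by exact_mod_cast hA) hB)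
  have h1 : 0 < (α - α / 4) * (n : ℝ) ^ j := by
    have : (0 : ℝ) < n := by exact_mod_cast hn
    have : 0 < α - α / 4 := by linarith
    positivity
  have h2 : 0 < ((link H j v).filter fun f => Disjoint f A).card := by
    have := lt_of_lt_of_le h1 h
    exact_mod_cast this
  obtain ⟨f, hf⟩ := Finset.card_pos.1 h2
  rw [Finset.mem_filter] at hf
  exact ⟨f, hf⟩

lemma slotC_of {α : ℝ} (hα : 0 < α) (hj : 1 ≤ j) (hn : 0 < n) (hl : ∀ v, α * (n : ℝ) ^ j ≤ (link H j v).card)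
    (hB : (B : ℝ) ≤ α / 4 * n) {R R' : ℕ} (hR : 0 < R) (hRR : (R' : ℝ) ≤ α / 2 * R) : SlotC H j B R R' := by
  intro f hf A hA
  by_contra hcon
  push Not at hcon
  set F := (kSets n j).filter fun f0 => Disjoint f0 A with hF
  have hnp : (0 : ℝ) < (n : ℝ) ^ j := by
    have : (0 : ℝ) < n := by exact_mod_cast hn
    positivity
  have h1 : ∑ f0 ∈ F, ((Nbr H j f0 ∩ Nbr H j f).card : ℝ) ≤ (n : ℝ) ^ j * R' := by
    calc _ ≤ ∑ f0 ∈ F, (R' : ℝ) := by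
          refine Finset.sum_le_sum fun f0 h0 => ?_
          rw [hF, Finset.mem_filter] at h0
          have := hcon f0 (by simpa [kSets] using h0.1) h0.2
          exact_mod_cast this.le
      _ = F.card * R' := by simp
      _ ≤ _ := by
          refine mul_le_mul_of_nonneg_right (le_trans ?_ (kSets_card_le n j)) (by positivity)
          exact_mod_cast Finset.card_filter_le _ _
  have h2 : ∑ f0 ∈ F, ((Nbr H j f0 ∩ Nbr H j f).card : ℝ) =
      ∑ z ∈ Nbr H j f, (((link H j z).filter fun f0 => Disjoint f0 A).card : ℝ) := by
    have e1 : ∀ f0, ((Nbr H j f0 ∩ Nbr H j f).card : ℝ) = ∑ z ∈ Nbr H j f, if f0 ∈ link H j z then (1 : ℝ) else 0 := by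
      intro f0
      rw [Finset.inter_comm, ← Finset.filter_mem_eq_inter, Finset.card_filter]
      push_cast
      exact Finset.sum_congr rfl fun z _ => by simp only [mem_Nbr]
    simp only [e1]
    rw [Finset.sum_comm]
    refine Finset.sum_congr rfl fun z _ => ?_
    rw [← Finset.sum_filter, Finset.sum_const, nsmul_eq_mul, mul_one]
    congr 2
    ext f0
    simp only [hF, Finset.mem_filter]
    constructor
    · rintro ⟨⟨_, h⟩, h'⟩; exact ⟨h', h⟩
    · rintro ⟨h', h⟩; exact ⟨⟨link_sub z h', h⟩, h'⟩
  have h3 : (R : ℝ) * ((α - α / 4) * (n : ℝ) ^ j) ≤ ∑ z ∈ Nbr H j f, (((link H j z).filter fun f0 => Disjoint f0 A).card : ℝ) := by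
    calc _ ≤ ((Nbr H j f).card : ℝ) * ((α - α / 4) * (n : ℝ) ^ j) := by
          refine mul_le_mul_of_nonneg_right (by exact_mod_cast hf) ?_
          have : 0 < α - α / 4 := by linarith
          positivity
      _ = ∑ z ∈ Nbr H j f, (α - α / 4) * (n : ℝ) ^ j := by simp
      _ ≤ _ := Finset.sum_le_sum fun z _ =>
          avoid_card hj (link_sub z) (hl z) (le_trans (by exact_mod_cast hA) hB)
  rw [← h2] at h3
  have h4 := h3.trans h1
  have hR0 : (0 : ℝ) < R := by exact_mod_cast hR
  have h5 : (n : ℝ) ^ j * R' ≤ (n : ℝ) ^ j * (α / 2 * R) := mul_le_mul_of_nonneg_left hRR hnp.le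
  have h6 : 0 < (n : ℝ) ^ j * R * α := by positivity
  nlinarith

/-- rich sets -/
noncomputable def Rich (H : Finset (Finset (Fin n))) (j R : ℕ) : Finset (Finset (Fin n)) :=
  (kSets n j).filter fun f => R ≤ (Nbr H j f).card

/-- exceptional vertices -/
noncomputable def Zs (H : Finset (Finset (Fin n))) (j R : ℕ) (α : ℝ) : Finset (Fin n) :=
  Finset.univ.filter fun s => ((link H j s ∩ Rich H j R).card : ℝ) < α / 2 * (n : ℝ) ^ j

lemma Zs_card {α : ℝ} (hα : 0 < α) (hn : 0 < n) (hl : ∀ v, α * (n : ℝ) ^ j ≤ (link H j v).card) (R : ℕ) :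
    α * ((Zs H j R α).card : ℝ) ≤ 2 * R := by
  have hnp : (0 : ℝ) < (n : ℝ) ^ j := by
    have : (0 : ℝ) < n := by exact_mod_cast hn
    positivity
  set F := (kSets n j).filter fun f => ¬ R ≤ (Nbr H j f).card with hF
  have h1 : ∑ s ∈ Zs H j R α, ((link H j s \ Rich H j R).card : ℝ) ≤ (n : ℝ) ^ j * R := by
    calc _ ≤ ∑ s, ((link H j s \ Rich H j R).card : ℝ) :=
          Finset.sum_le_sum_of_subset_of_nonneg (Finset.subset_univ _) fun _ _ _ => by positivity
      _ = ∑ s, ∑ f ∈ F, (if f ∈ link H j s then (1 : ℝ) else 0) := by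
          refine Finset.sum_congr rfl fun s _ => ?_
          rw [← Finset.sum_filter, Finset.sum_const, nsmul_eq_mul, mul_one]
          congr 2
          ext f
          simp only [hF, Rich, Finset.mem_sdiff, Finset.mem_filter]
          constructor
          · rintro ⟨h, h'⟩; exact ⟨⟨link_sub s h, fun h2 => h' ⟨link_sub s h, h2⟩⟩, h⟩
          · rintro ⟨⟨_, h⟩, h'⟩; exact ⟨h', fun h2 => h h2.2⟩
      _ = ∑ f ∈ F, ((Nbr H j f).card : ℝ) := by
          rw [Finset.sum_comm]
          refine Finset.sum_congr rfl fun f _ => ?_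
          rw [← Finset.sum_filter, Finset.sum_const, nsmul_eq_mul, mul_one]
          rfl
      _ ≤ ∑ f ∈ F, (R : ℝ) := by
          refine Finset.sum_le_sum fun f hf => ?_
          have := (Finset.mem_filter.1 hf).2
          push Not at this
          exact_mod_cast this.le
      _ = F.card * R := by simp
      _ ≤ _ := by
          refine mul_le_mul_of_nonneg_right (le_trans ?_ (kSets_card_le n j)) (by positivity)
          exact_mod_cast Finset.card_filter_le _ _
  have h2 : ((Zs H j R α).card : ℝ) * (α / 2 * (n : ℝ) ^ j) ≤ ∑ s ∈ Zs H j R α, ((link H j s \ Rich H j R).card : ℝ) := by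
    rw [← nsmul_eq_mul, ← Finset.sum_const]
    refine Finset.sum_le_sum fun s hs => ?_
    have h3 := (Finset.mem_filter.1 hs).2
    have h4 : ((link H j s \ Rich H j R).card : ℝ) + ((link H j s ∩ Rich H j R).card : ℝ) = (link H j s).card := by
      exact_mod_cast Finset.card_sdiff_add_card_inter _ _
    have := hl s
    linarith
  have h3 := h2.trans h1
  have : α * ((Zs H j R α).card : ℝ) * (n : ℝ) ^ j ≤ 2 * R * (n : ℝ) ^ j := by linarith
  exact le_of_mul_le_mul_right this hnp

lemma rich_avoid {α : ℝ} (hj : 1 ≤ j) {R : ℕ} {s : Fin n} (hs : s ∉ Zs H j R α) {A : Finset (Fin n)}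
    (hA : (A.card : ℝ) ≤ α / 4 * n) :
    α / 4 * (n : ℝ) ^ j ≤ (((Rich H j R).filter fun f => Disjoint f A ∧ f ∈ link H j s).card : ℝ) := by
  have h1 : α / 2 * (n : ℝ) ^ j ≤ ((link H j s ∩ Rich H j R).card : ℝ) := by
    by_contra h; push Not at h; exact hs (Finset.mem_filter.2 ⟨Finset.mem_univ _, h⟩)
  have h2 := avoid_card hj (Finset.inter_subset_left.trans (link_sub s)) h1 hA
  have e : (link H j s ∩ Rich H j R).filter (fun f => Disjoint f A) =
      (Rich H j R).filter fun f => Disjoint f A ∧ f ∈ link H j s := by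
    ext f; simp only [Finset.mem_filter, Finset.mem_inter]; tauto
  rw [e] at h2
  have e2 : α / 2 - α / 4 = α / 4 := by ring
  rwa [e2] at h2

lemma choice {α : ℝ} (hα : 0 < α) (hj : 1 ≤ j) (hn : 0 < n) {R : ℕ} {s0 : Fin n} (hs0 : s0 ∉ Zs H j R α) (r : ℕ) :
    ∀ (w : (Fin r → Fin n) → ℝ) (A : Finset (Fin n)), (∀ σ, 0 ≤ w σ) →
    (∀ σ i, σ i ∈ Zs H j R α → w σ = 0) → ((A.card + r * j : ℕ) : ℝ) ≤ α / 4 * n →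
    ∃ b : Fin r → Finset (Fin n), (∀ i, b i ∈ Rich H j R) ∧ (∀ i, Disjoint (b i) A) ∧
      (∀ i i', i ≠ i' → Disjoint (b i) (b i')) ∧
      (α / 4) ^ r * ∑ σ, w σ ≤ ∑ σ, if ∀ i, b i ∈ link H j (σ i) then w σ else 0 := by
  have hnp : (0 : ℝ) < (n : ℝ) ^ j := by
    have : (0 : ℝ) < n := by exact_mod_cast hn
    positivity
  induction r with
  | zero =>
    intro w A hw _ _
    exact ⟨fun i => i.elim0, fun i => i.elim0, fun i => i.elim0, fun i => i.elim0, by simp⟩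
  | succ r ih =>
    intro w A hw hZ hA
    have hA' : (A.card : ℝ) ≤ α / 4 * n := by
      refine le_trans ?_ hA
      exact_mod_cast Nat.le_add_right _ _
    set F := (Rich H j R).filter fun f => Disjoint f A with hF
    have hFsub : F ⊆ kSets n j := (Finset.filter_subset _ _).trans (Finset.filter_subset _ _)
    have hFne : F.Nonempty := by
      have h := rich_avoid hj hs0 hA'
      have : 0 < α / 4 * (n : ℝ) ^ j := by positivity
      have : 0 < ((Rich H j R).filter fun f => Disjoint f A ∧ f ∈ link H j s0).card := by
        exact_mod_cast lt_of_lt_of_le this h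
      obtain ⟨f, hf⟩ := Finset.card_pos.1 this
      rw [Finset.mem_filter] at hf
      exact ⟨f, Finset.mem_filter.2 ⟨hf.1, hf.2.1⟩⟩
    let w' : Finset (Fin n) → (Fin r → Fin n) → ℝ := fun f τ =>
      ∑ s, if f ∈ link H j s then w (Fin.cons s τ) else 0
    have hsum : ∀ v : (Fin (r + 1) → Fin n) → ℝ, ∑ σ, v σ = ∑ s, ∑ τ : Fin r → Fin n, v (Fin.cons s τ) := by
      intro v
      rw [← (Fin.consEquiv (fun _ : Fin (r + 1) => Fin n)).sum_comp, Fintype.sum_prod_type]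
      rfl
    have hav : ∃ f ∈ F, α / 4 * ∑ σ, w σ ≤ ∑ τ, w' f τ := by
      by_contra hcon
      push Not at hcon
      have h1 : ∑ f ∈ F, ∑ τ, w' f τ < ∑ f ∈ F, α / 4 * ∑ σ, w σ := Finset.sum_lt_sum_of_nonempty hFne hcon
      have h0 : 0 ≤ α / 4 * ∑ σ, w σ := mul_nonneg (by positivity) (Finset.sum_nonneg fun σ _ => hw σ)
      have h2 : ∑ f ∈ F, α / 4 * ∑ σ, w σ ≤ (n : ℝ) ^ j * (α / 4 * ∑ σ, w σ) := by
        rw [Finset.sum_const, nsmul_eq_mul]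
        refine mul_le_mul_of_nonneg_right (le_trans ?_ (kSets_card_le n j)) h0
        exact_mod_cast Finset.card_le_card hFsub
      have h3 : ∑ f ∈ F, ∑ τ, w' f τ = ∑ s, ∑ τ : Fin r → Fin n,
          (((Rich H j R).filter fun f => Disjoint f A ∧ f ∈ link H j s).card : ℝ) * w (Fin.cons s τ) := by
        calc _ = ∑ f ∈ F, ∑ s, ∑ τ : Fin r → Fin n, (if f ∈ link H j s then w (Fin.cons s τ) else 0) :=
              Finset.sum_congr rfl fun f _ => Finset.sum_comm
          _ = ∑ s, ∑ f ∈ F, ∑ τ : Fin r → Fin n, (if f ∈ link H j s then w (Fin.cons s τ) else 0) := Finset.sum_comm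
          _ = ∑ s, ∑ τ : Fin r → Fin n, ∑ f ∈ F, (if f ∈ link H j s then w (Fin.cons s τ) else 0) :=
              Finset.sum_congr rfl fun s _ => Finset.sum_comm
          _ = _ := by
              refine Finset.sum_congr rfl fun s _ => Finset.sum_congr rfl fun τ _ => ?_
              rw [← Finset.sum_filter, Finset.sum_const, nsmul_eq_mul, hF, Finset.filter_filter]
      have h4 : (n : ℝ) ^ j * (α / 4 * ∑ σ, w σ) ≤ ∑ f ∈ F, ∑ τ, w' f τ := by
        rw [h3, hsum w, Finset.mul_sum, Finset.mul_sum]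
        refine Finset.sum_le_sum fun s _ => ?_
        rw [Finset.mul_sum, Finset.mul_sum]
        refine Finset.sum_le_sum fun τ _ => ?_
        by_cases hs : s ∈ Zs H j R α
        · rw [hZ (Fin.cons s τ) 0 (by simpa using hs)]; simp
        · have := mul_le_mul_of_nonneg_right (rich_avoid hj hs hA') (hw (Fin.cons s τ))
          linarith
      linarith
    obtain ⟨f, hfF, hf⟩ := hav
    have hfR := (Finset.mem_filter.1 hfF).1
    have hfA := (Finset.mem_filter.1 hfF).2
    have hfc : f.card = j := by simpa [kSets] using hFsub hfF
    obtain ⟨b, hb1, hb2, hb3, hb4⟩ := ih (w' f) (A ∪ f)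
      (fun τ => Finset.sum_nonneg fun s _ => by split_ifs <;> [exact hw _; exact le_rfl])
      (fun τ i hi => Finset.sum_eq_zero fun s _ => by
        rw [hZ (Fin.cons s τ) i.succ (by simpa using hi)]; simp)
      (by
        refine le_trans ?_ hA
        have := Finset.card_union_le A f
        have : (A ∪ f).card + r * j ≤ A.card + (r + 1) * j := by rw [add_mul]; omega
        exact_mod_cast this)
    refine ⟨Fin.cons f b, ?_, ?_, ?_, ?_⟩
    · intro i
      induction i using Fin.cases with
      | zero => exact hfR
      | succ i => exact hb1 i
    · intro i
      induction i using Fin.cases with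
      | zero => exact hfA
      | succ i => exact (Finset.disjoint_union_right.1 (hb2 i)).1
    · intro i i' hi
      induction i using Fin.cases with
      | zero =>
        induction i' using Fin.cases with
        | zero => exact absurd rfl hi
        | succ i' => exact (Finset.disjoint_union_right.1 (hb2 i')).2.symm
      | succ i =>
        induction i' using Fin.cases with
        | zero => exact (Finset.disjoint_union_right.1 (hb2 i)).2
        | succ i' => exact hb3 i i' (fun h => hi (by rw [h]))
    · calc _ = (α / 4) ^ r * (α / 4 * ∑ σ, w σ) := by rw [pow_succ]; ring
        _ ≤ (α / 4) ^ r * ∑ τ, w' f τ := mul_le_mul_of_nonneg_left hf (by positivity)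
        _ ≤ _ := hb4
        _ = ∑ τ : Fin r → Fin n, ∑ s, (if ∀ i, (Fin.cons f b : Fin (r + 1) → Finset (Fin n)) i ∈
              link H j ((Fin.cons s τ : Fin (r + 1) → Fin n) i) then w (Fin.cons s τ) else 0) := by
            refine Finset.sum_congr rfl fun τ _ => ?_
            by_cases h : ∀ i, b i ∈ link H j (τ i)
            · rw [if_pos h]
              refine Finset.sum_congr rfl fun s _ => ?_
              simp only [Fin.forall_fin_succ, Fin.cons_zero, Fin.cons_succ, h, and_true, implies_true]
            · rw [if_neg h]
              symm
              refine Finset.sum_eq_zero fun s _ => if_neg fun h2 => h fun i => ?_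
              simpa using h2 i.succ
        _ = _ := by rw [hsum]; exact Finset.sum_comm

end det

section det
variable {n j : ℕ} {H G : Finset (Finset (Fin n))} {B M : ℕ}

lemma cover (hj : 2 ≤ j) (hH : H ⊆ kSets n (j + 1)) (hG : G ⊆ kSets n (j + 1))
    (hD : DegB H j B) (hP : PP G j M) (hBn : B ≤ n) {u v : Fin n} {X : Finset (Fin n)}
    {T : Set (Finset (Fin n))} (h : Flex (H ∪ G) u v X T) (S : Finset (Fin n)) :
    X.card + S.card * (4 * (j + 1)) + (2 * M * j + M) ≤ B →
    ∃ v' X', Flex (H ∪ G) u v' X' T ∧ X ⊆ X' ∧ S ⊆ X' ∧ X'.card ≤ X.card + S.card * (4 * (j + 1)) := by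
  induction S using Finset.induction_on with
  | empty => intro _; exact ⟨v, X, h, le_rfl, by simp, by simp⟩
  | insert s S hs ih =>
    rw [Finset.card_insert_of_notMem hs]
    have e1 : (S.card + 1) * (4 * (j + 1)) = S.card * (4 * (j + 1)) + 4 * (j + 1) := by ring
    rw [e1]
    intro hB
    obtain ⟨v', X', hF, h1, h2, h3⟩ := ih (by omega)
    by_cases hsX : s ∈ X'
    · exact ⟨v', X', hF, h1, Finset.insert_subset hsX h2, by omega⟩
    · obtain ⟨f, hf, hfd⟩ := hD s X' (by omega)
      have hf' := mem_link.1 hf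
      obtain ⟨q, hq⟩ : f.Nonempty := Finset.card_pos.1 (by omega)
      have hl : LP (H ∪ G) s q (insert s f) := LP.single (Finset.mem_union_left _ hf'.2.2) (by simp) (by simp [hq])
        (by rintro rfl; exact hf'.2.1 hq)
      have hc : (insert s f).card = j + 1 := by rw [Finset.card_insert_of_notMem hf'.2.1, hf'.1]
      obtain ⟨X'', hF', hX1, hX2, hc', _⟩ := join (A := ∅) hj hH hG hD hP hBn hF (flex_of_LP hl) (by
        rw [Finset.disjoint_insert_right]; exact ⟨hsX, hfd.symm⟩) (by
        rw [hc, Finset.card_empty]; omega)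
      rw [TT_empty] at hF'
      rw [hc] at hc'
      refine ⟨q, X'', hF', h1.trans hX1, Finset.insert_subset (hX2 (by simp)) (h2.trans hX1), by omega⟩

/-- potential -/
noncomputable def pot (H : Finset (Finset (Fin n))) (j R : ℕ) (α : ℝ) (Bs : List (Fin j → Finset (Fin n)))
    (σ : Fin j → Fin n) : ℝ :=
  if ∀ i, σ i ∉ Zs H j R α then (1 / 2 : ℝ) ^ cnt H j σ Bs else 0

lemma pot_nonneg {R : ℕ} {α : ℝ} (Bs : List (Fin j → Finset (Fin n))) (σ : Fin j → Fin n) : 0 ≤ pot H j R α Bs σ := by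
  unfold pot; split_ifs <;> positivity

lemma pot_cons {R : ℕ} {α : ℝ} (b : Fin j → Finset (Fin n)) (Bs : List (Fin j → Finset (Fin n))) (σ : Fin j → Fin n) :
    pot H j R α (b :: Bs) σ = pot H j R α Bs σ -
      1 / 2 * (if ∀ i, b i ∈ link H j (σ i) then pot H j R α Bs σ else 0) := by
  unfold pot
  simp only [cnt]
  split_ifs
  · rw [pow_add]; ring
  · simp
  · simp
  · simp

lemma iterate {α : ℝ} (hα : 0 < α) (hα1 : α ≤ 1) (hj : 2 ≤ j) (hn : 0 < n) (hH : H ⊆ kSets n (j + 1)) (hG : G ⊆ kSets n (j + 1))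
    (hD : DegB H j B) (hP : PP G j M) (hBn : B ≤ n) {R R' : ℕ} (hS : SlotC H j B R R') (hRR : R' ≤ R)
    (hB : (B : ℝ) ≤ α / 4 * n) {s0 : Fin n} (hs0 : s0 ∉ Zs H j R α) (N : ℕ) :
    (j + 1) + N * (4 * (j + 1) ^ 2) + 10 * (j + 1) ^ 2 + (2 * M * j + M) ≤ B →
    (j + 1) + N * (4 * (j + 1) ^ 2) + 10 * (j + 1) ^ 2 + M ≤ R' →
    ∃ (Bs : List (Fin j → Finset (Fin n))) (u v : Fin n) (X : Finset (Fin n)), Flex (H ∪ G) u v X (TB H j Bs) ∧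
      j + 1 ≤ X.card ∧ X.card ≤ (j + 1) + N * (4 * (j + 1) ^ 2) ∧
      ∑ σ, pot H j R α Bs σ ≤ (1 - (α / 4) ^ j / 2) ^ N * (n : ℝ) ^ j := by
  induction N with
  | zero =>
    intro _ _
    obtain ⟨f, hf, -⟩ := hD s0 ∅ (by simp)
    have hf' := mem_link.1 hf
    obtain ⟨q, hq⟩ : f.Nonempty := Finset.card_pos.1 (by omega)
    have hl : LP (H ∪ G) s0 q (insert s0 f) := LP.single (Finset.mem_union_left _ hf'.2.2) (by simp) (by simp [hq])
      (by rintro rfl; exact hf'.2.1 hq)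
    have hc : (insert s0 f).card = j + 1 := by rw [Finset.card_insert_of_notMem hf'.2.1, hf'.1]
    refine ⟨[], s0, q, insert s0 f, flex_of_LP hl, hc.ge, by omega, ?_⟩
    rw [pow_zero, one_mul]
    calc _ ≤ ∑ σ : Fin j → Fin n, (1 : ℝ) := Finset.sum_le_sum fun σ _ => by
            unfold pot; split_ifs <;> simp [cnt]
      _ = _ := by simp
  | succ N ih =>
    have e1 : (N + 1) * (4 * (j + 1) ^ 2) = N * (4 * (j + 1) ^ 2) + 4 * (j + 1) ^ 2 := by ring
    rw [e1]
    intro h1 h2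
    obtain ⟨Bs, u, v, X, hF, hX1, hX2, hpot⟩ := ih (by omega) (by omega)
    obtain ⟨b, hb1, hb2, hb3, hb4⟩ := choice hα (by omega) hn hs0 j (pot H j R α Bs) X (pot_nonneg Bs) (by
      intro σ i hi
      unfold pot
      rw [if_neg]
      push Not; exact ⟨i, hi⟩) (by
      refine le_trans ?_ hB
      have e2 : (j + 1) ^ 2 = j * j + 2 * j + 1 := by ring
      have : X.card + j * j ≤ B := by rw [e2] at h1 hX2; omega
      exact_mod_cast this)
    obtain ⟨v', X', hF', hXX, hc⟩ := bundle hj hH hG hD hP hBn hS hRR hF b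
      (fun i => by simpa [kSets] using (Finset.mem_filter.1 (hb1 i)).1) hb2 hb3
      (fun i => (Finset.mem_filter.1 (hb1 i)).2) (by omega) (by omega)
    refine ⟨b :: Bs, u, v', X', hF', hX1.trans (Finset.card_le_card hXX), by omega, ?_⟩
    simp only [pot_cons]
    rw [Finset.sum_sub_distrib, ← Finset.mul_sum]
    have hd1 : (α / 4) ^ j ≤ 1 := pow_le_one₀ (by positivity) (by linarith)
    calc _ ≤ (1 - (α / 4) ^ j / 2) * ∑ σ, pot H j R α Bs σ := by linarith
      _ ≤ (1 - (α / 4) ^ j / 2) * ((1 - (α / 4) ^ j / 2) ^ N * (n : ℝ) ^ j) :=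
          mul_le_mul_of_nonneg_left hpot (by linarith)
      _ = _ := by rw [pow_succ]; ring

theorem det1 {α : ℝ} (hα : 0 < α) (hα1 : α ≤ 1) (hj : 2 ≤ j) (hn : 0 < n) (hjn : j ∣ n)
    (hH : H ⊆ kSets n (j + 1)) (hG : G ⊆ kSets n (j + 1))
    (hdeg : ∀ v : Fin n, α * (n : ℝ) ^ j ≤ (degOf H {v} : ℝ)) (hP : PP G j M) (hM : 1 ≤ M)
    {R R' N h0 Zb : ℕ} (hR : 0 < R) (hRR : (R' : ℝ) ≤ α / 2 * R) (hB : (B : ℝ) ≤ α / 4 * n)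
    (hZb : 2 * (R : ℝ) ≤ α * Zb) (hZn : Zb < n)
    (c1 : (j + 1) + N * (4 * (j + 1) ^ 2) + Zb * (4 * (j + 1)) + 10 * (j + 1) ^ 2 + 6 * (j + 1) * M ≤ B)
    (c2 : (j + 1) + N * (4 * (j + 1) ^ 2) + 10 * (j + 1) ^ 2 + M ≤ R')
    (c3 : 6 * (j + 1) * M ≤ j * h0)
    (c4 : (1 - (α / 4) ^ j / 2) ^ N * (n : ℝ) ^ j ≤ (1 / 2) ^ h0) : IsHamCycle n (j + 1) 1 (H ∪ G) := by
  have hl : ∀ v, α * (n : ℝ) ^ j ≤ (link H j v).card := fun v => (hdeg v).trans (by exact_mod_cast deg_le_link hH v)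
  have hD := degB_of hα (by omega) hn hl hB
  have hS := slotC_of hα (by omega) hn hl hB hR hRR
  have hn0 : (0 : ℝ) < n := by exact_mod_cast hn
  have hR0 : (0 : ℝ) < R := by exact_mod_cast hR
  have hBn : B ≤ n := by
    have : (B : ℝ) ≤ n := by nlinarith
    exact_mod_cast this
  have hRR' : R' ≤ R := by
    have : (R' : ℝ) ≤ R := by nlinarith
    exact_mod_cast this
  have hZc : (Zs H j R α).card ≤ Zb := by
    have h1 := (Zs_card hα hn hl R).trans hZb
    exact_mod_cast le_of_mul_le_mul_left h1 hα
  obtain ⟨s0, hs0⟩ : ∃ s0, s0 ∉ Zs H j R α := by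
    by_contra hcon
    push Not at hcon
    have : Zs H j R α = Finset.univ := Finset.eq_univ_iff_forall.2 hcon
    rw [this, Finset.card_univ, Fintype.card_fin] at hZc
    omega
  have e6 : 6 * (j + 1) * M = 2 * M * j + M + 4 * M * j + 5 * M := by ring
  obtain ⟨Bs, u, v, X, hF, hX1, hX2, hpot⟩ := iterate hα hα1 hj hn hH hG hD hP hBn hS hRR' hB hs0 N
    (by omega) c2
  have hZ4 : (Zs H j R α).card * (4 * (j + 1)) ≤ Zb * (4 * (j + 1)) := Nat.mul_le_mul_right _ hZc
  obtain ⟨v', X', hF', hXX, hZX, hc⟩ := cover hj hH hG hD hP hBn hF (Zs H j R α) (by omega)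
  have hcnt : ∀ σ : Fin j → Fin n, (∀ i, σ i ∉ Zs H j R α) → h0 ≤ cnt H j σ Bs := by
    intro σ hσ
    have h1 : pot H j R α Bs σ ≤ ∑ σ, pot H j R α Bs σ :=
      Finset.single_le_sum (f := pot H j R α Bs) (fun τ _ => pot_nonneg Bs τ) (Finset.mem_univ σ)
    have h2 := (h1.trans hpot).trans c4
    unfold pot at h2
    rw [if_pos hσ] at h2
    by_contra hlt
    push Not at hlt
    have := pow_lt_pow_right_of_lt_one₀ (by norm_num : (0 : ℝ) < 1 / 2) (by norm_num) hlt
    linarith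
  have hemp : ∅ ∈ TB H j Bs := absorb Bs 0 ∅ (by simp) (fun _ _ _ => Nat.zero_le _)
  have hne : u ≠ v' := by
    have := hF'.2.2 ∅ hemp (by simp)
    rw [Finset.union_empty] at this
    have hcc := Finset.card_le_card hXX
    exact this.ne (by omega)
  refine finish hj hH hG hD hP hM hBn hjn hne hF' ?_ ?_
  · rintro L hL ⟨h, hh⟩ hLc
    refine absorb Bs h L hh fun σ _ hσ => ?_
    have hh0 : h ≤ h0 := by
      have : j * h ≤ j * h0 := by omega
      exact Nat.le_of_mul_le_mul_left this (by omega)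
    refine hh0.trans (hcnt σ fun i hi => ?_)
    exact Finset.disjoint_left.1 hL (hσ i) (hZX hi)
  · have : 0 < (j + 1) ^ 2 := by positivity
    omega

end det

lemma disj_sub {n : ℕ} (m r : ℕ) : ∀ (W : Fin r → Finset (Fin n)) (A : Finset (Fin n)),
    (∀ i, A.card + r * m ≤ (W i).card) →
    ∃ V : Fin r → Finset (Fin n), (∀ i, V i ⊆ W i) ∧ (∀ i, (V i).card = m) ∧ (∀ i, Disjoint (V i) A) ∧
      ∀ i i', i ≠ i' → Disjoint (V i) (V i') := by
  induction r with
  | zero => intro W A _; exact ⟨fun i => i.elim0, fun i => i.elim0, fun i => i.elim0, fun i => i.elim0, fun i => i.elim0⟩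
  | succ r ih =>
    intro W A h
    have e : (r + 1) * m = r * m + m := by ring
    have h1 : m ≤ (W 0 \ A).card := by
      have h2 := Finset.le_card_sdiff A (W 0)
      have := h 0
      omega
    obtain ⟨V0, hV0, hc⟩ := Finset.exists_subset_card_eq h1
    obtain ⟨V, v1, v2, v3, v4⟩ := ih (fun i => W i.succ) (A ∪ V0) (by
      intro i
      have := Finset.card_union_le A V0
      have := h i.succ
      omega)
    refine ⟨Fin.cons V0 V, ?_, ?_, ?_, ?_⟩
    · intro i
      induction i using Fin.cases with
      | zero => exact hV0.trans Finset.sdiff_subset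
      | succ i => exact v1 i
    · intro i
      induction i using Fin.cases with
      | zero => exact hc
      | succ i => exact v2 i
    · intro i
      induction i using Fin.cases with
      | zero => exact Finset.disjoint_of_subset_left hV0 Finset.sdiff_disjoint
      | succ i => exact (Finset.disjoint_union_right.1 (v3 i)).1
    · intro i i' hi
      induction i using Fin.cases with
      | zero =>
        induction i' using Fin.cases with
        | zero => exact absurd rfl hi
        | succ i' => exact (Finset.disjoint_union_right.1 (v3 i')).2.symm
      | succ i =>
        induction i' using Fin.cases with
        | zero => exact (Finset.disjoint_union_right.1 (v3 i)).2
        | succ i' => exact v4 i i' (fun h => hi (by rw [h]))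

/-- transversals of a family -/
noncomputable def trv {n r : ℕ} (V : Fin r → Finset (Fin n)) : Finset (Finset (Fin n)) :=
  (Fintype.piFinset V).image fun x => Finset.univ.image x

lemma trv_inj {n r : ℕ} {V : Fin r → Finset (Fin n)} (hV : ∀ i i', i ≠ i' → Disjoint (V i) (V i'))
    {x : Fin r → Fin n} (hx : ∀ i, x i ∈ V i) : Function.Injective x := by
  intro i i' h
  by_contra hne
  exact Finset.disjoint_left.1 (hV i i' hne) (hx i) (h ▸ hx i')

lemma trv_card {n r m : ℕ} {V : Fin r → Finset (Fin n)} (hV : ∀ i i', i ≠ i' → Disjoint (V i) (V i'))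
    (hc : ∀ i, (V i).card = m) : (trv V).card = m ^ r := by
  unfold trv
  rw [Finset.card_image_of_injOn, Fintype.card_piFinset]
  · simp [hc]
  · intro x hx y hy h
    have hx' : ∀ i, x i ∈ V i := by simpa [Fintype.mem_piFinset] using hx
    have hy' : ∀ i, y i ∈ V i := by simpa [Fintype.mem_piFinset] using hy
    have h : Finset.univ.image x = Finset.univ.image y := h
    funext i
    have h1 : x i ∈ Finset.univ.image y := h ▸ Finset.mem_image_of_mem x (Finset.mem_univ i)
    obtain ⟨i', _, hi'⟩ := Finset.mem_image.1 h1
    by_cases he : i' = i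
    · rw [← hi', he]
    · exact absurd (hx' i) (Finset.disjoint_left.1 (hV i' i he) (hi' ▸ hy' i'))

lemma prob_PP (n j m : ℕ) (p : ℝ) (hp0 : 0 ≤ p) (hp1 : p ≤ 1) :
    1 - (2 : ℝ) ^ ((j + 1) * n) * Real.exp (-(p * (m : ℝ) ^ (j + 1))) ≤
      bw (kSets n (j + 1)) p (fun E => if PP E j ((j + 1) * m) then 1 else 0) := by
  set F : Finset (Fin (j + 1) → Finset (Fin n)) := Finset.univ.filter fun V =>
    (∀ i, (V i).card = m) ∧ ∀ i i', i ≠ i' → Disjoint (V i) (V i') with hF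
  have h1 : bw (kSets n (j + 1)) p (fun E => 1 + (-1) * ∑ V ∈ F, if Disjoint E (trv V) then (1 : ℝ) else 0) ≤
      bw (kSets n (j + 1)) p (fun E => if PP E j ((j + 1) * m) then 1 else 0) := by
    refine bw_mono hp0 hp1 fun E hE => ?_
    have hnn : ∀ V ∈ F, 0 ≤ (if Disjoint E (trv V) then (1 : ℝ) else 0) := fun V _ => by split_ifs <;> norm_num
    by_cases hPP : PP E j ((j + 1) * m)
    · rw [if_pos hPP]
      have := Finset.sum_nonneg hnn
      linarith
    · rw [if_neg hPP]
      have : ∃ V ∈ F, Disjoint E (trv V) := by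
        unfold PP at hPP
        push Not at hPP
        obtain ⟨W, hW, hW2⟩ := hPP
        obtain ⟨V, v1, v2, v3, v4⟩ := disj_sub m (j + 1) W ∅ (by simpa using hW)
        refine ⟨V, Finset.mem_filter.2 ⟨Finset.mem_univ _, v2, v4⟩, ?_⟩
        rw [Finset.disjoint_right]
        intro e he
        obtain ⟨x, hx, rfl⟩ := Finset.mem_image.1 he
        rw [Fintype.mem_piFinset] at hx
        exact hW2 x (trv_inj v4 hx) fun i => v1 i (hx i)
      obtain ⟨V, hV, hd⟩ := this
      have := Finset.single_le_sum hnn hV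
      rw [if_pos hd] at this
      linarith
  refine le_trans ?_ h1
  rw [bw_add, bw_mul, bw_const, bw_sum]
  have h2 : ∑ V ∈ F, bw (kSets n (j + 1)) p (fun E => if Disjoint E (trv V) then (1 : ℝ) else 0) ≤
      (2 : ℝ) ^ ((j + 1) * n) * Real.exp (-(p * (m : ℝ) ^ (j + 1))) := by
    calc _ ≤ ∑ V ∈ F, Real.exp (-(p * (m : ℝ) ^ (j + 1))) := by
          refine Finset.sum_le_sum fun V hV => ?_
          obtain ⟨_, v2, v4⟩ := Finset.mem_filter.1 hV
          have hsub : trv V ⊆ kSets n (j + 1) := by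
            intro e he
            obtain ⟨x, hx, rfl⟩ := Finset.mem_image.1 he
            rw [Fintype.mem_piFinset] at hx
            simp only [kSets, Finset.mem_powersetCard, Finset.subset_univ, true_and]
            rw [Finset.card_image_of_injective _ (trv_inj v4 hx)]; simp
          have hb : bw (kSets n (j + 1)) p (fun E => if Disjoint E (trv V) then (1 : ℝ) else 0) =
              (1 - p) ^ (trv V).card := by
            convert bw_disjoint hsub p
          rw [hb, trv_card v4 v2]
          calc (1 - p) ^ m ^ (j + 1) ≤ (Real.exp (-p)) ^ m ^ (j + 1) := by
                refine pow_le_pow_left₀ (by linarith) ?_ _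
                have := Real.add_one_le_exp (-p)
                linarith
            _ = _ := by
                rw [← Real.exp_nat_mul]
                congr 1
                push_cast; ring
      _ = F.card * Real.exp (-(p * (m : ℝ) ^ (j + 1))) := by simp
      _ ≤ _ := by
          refine mul_le_mul_of_nonneg_right ?_ (Real.exp_pos _).le
          have : F.card ≤ 2 ^ ((j + 1) * n) := by
            refine (Finset.card_le_univ F).trans ?_
            simp [pow_mul, pow_right_comm]
          exact_mod_cast this
  linarith

set_option maxHeartbeats 1000000 in
lemma params {α : ℝ} (hα : 0 < α) (hα1 : α ≤ 1) {j : ℕ} (hj : 2 ≤ j) :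
    ∃ γ : ℝ, 0 < γ ∧ ∀ᶠ n : ℕ in Filter.atTop, ∃ m R R' N h0 Zb B : ℕ, γ * n ≤ m ∧ 1 ≤ m ∧
      0 < R ∧ (R' : ℝ) ≤ α / 2 * R ∧ (B : ℝ) ≤ α / 4 * n ∧ 2 * (R : ℝ) ≤ α * Zb ∧ Zb < n ∧
      (j + 1) + N * (4 * (j + 1) ^ 2) + Zb * (4 * (j + 1)) + 10 * (j + 1) ^ 2 + 6 * (j + 1) * ((j + 1) * m) ≤ B ∧
      (j + 1) + N * (4 * (j + 1) ^ 2) + 10 * (j + 1) ^ 2 + (j + 1) * m ≤ R' ∧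
      6 * (j + 1) * ((j + 1) * m) ≤ j * h0 ∧
      (1 - (α / 4) ^ j / 2) ^ N * (n : ℝ) ^ j ≤ (1 / 2) ^ h0 := by
  obtain ⟨K, hK⟩ : ∃ K : ℝ, K = j + 1 := ⟨_, rfl⟩
  have hK1 : 1 ≤ K := by rw [hK]; have : (0 : ℝ) ≤ j := by positivity
                         linarith
  have hK0 : 0 < K := by linarith
  obtain ⟨d, hd⟩ : ∃ d : ℝ, d = (α / 4) ^ j := ⟨_, rfl⟩
  have hd0 : 0 < d := by rw [hd]; positivity
  have hd1 : d ≤ 1 := by rw [hd]; exact pow_le_one₀ (by positivity) (by linarith)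
  rw [← hd]
  obtain ⟨c, hc⟩ : ∃ c : ℝ, c = α ^ 2 / (128 * K) := ⟨_, rfl⟩
  have hc0 : 0 < c := by rw [hc]; positivity
  have hcK : 128 * K * c = α ^ 2 := by rw [hc]; field_simp
  have hc1 : c ≤ 1 / 2 := by nlinarith
  obtain ⟨μ, hμ⟩ : ∃ μ : ℝ, μ = α * c / (32 * K ^ 2) := ⟨_, rfl⟩
  have hμ0 : 0 < μ := by rw [hμ]; positivity
  have hμK : 4 * K ^ 2 * μ = α * c / 8 := by rw [hμ]; field_simp; norm_num
  obtain ⟨γ, hγ⟩ : ∃ γ : ℝ, γ = min (min (α / (96 * K ^ 2)) (α * c / (8 * K))) (d * μ / (24 * K ^ 2)) := ⟨_, rfl⟩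
  have hγ0 : 0 < γ := by rw [hγ]; positivity
  have g1 : 6 * K ^ 2 * γ ≤ α / 16 := by
    have : γ ≤ α / (96 * K ^ 2) := by rw [hγ]; exact (min_le_left _ _).trans (min_le_left _ _)
    rw [le_div_iff₀ (by positivity)] at this
    linarith
  have g2 : K * γ ≤ α * c / 8 := by
    have : γ ≤ α * c / (8 * K) := by rw [hγ]; exact (min_le_left _ _).trans (min_le_right _ _)
    rw [le_div_iff₀ (by positivity)] at this
    linarith
  have g3 : 6 * K ^ 2 * γ ≤ d * μ / 4 := by
    have : γ ≤ d * μ / (24 * K ^ 2) := by rw [hγ]; exact min_le_right _ _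
    rw [le_div_iff₀ (by positivity)] at this
    linarith
  refine ⟨γ, hγ0, ?_⟩
  have E1 : ∀ᶠ n : ℕ in Filter.atTop, (K + 4 * K * (2 / α + 1) + 10 * K ^ 2 + 6 * K ^ 2 + 1) / (α / 16) ≤ n :=
    tendsto_natCast_atTop_atTop.eventually_ge_atTop _
  have E2 : ∀ᶠ n : ℕ in Filter.atTop, (K + 10 * K ^ 2 + K + 1) / (α * c / 4) ≤ n :=
    tendsto_natCast_atTop_atTop.eventually_ge_atTop _
  have E3 : ∀ᶠ n : ℕ in Filter.atTop, ‖(n : ℝ) ^ j‖ ≤ Real.exp (-(d / 2 + 6 * K ^ 2)) * ‖Real.exp (d * μ / 4 * n)‖ := by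
    have := (isLittleO_pow_exp_pos_mul_atTop j (b := d * μ / 4) (by positivity)).def
      (Real.exp_pos (-(d / 2 + 6 * K ^ 2)))
    exact tendsto_natCast_atTop_atTop.eventually this
  filter_upwards [E1, E2, E3, Filter.eventually_ge_atTop 1] with n e1 e2 e3 e4
  rw [div_le_iff₀ (by positivity)] at e1 e2
  have hn1 : (1 : ℝ) ≤ n := by exact_mod_cast e4
  have hn0 : (0 : ℝ) < n := by linarith
  set m := ⌈γ * n⌉₊ with hm
  set R := ⌈c * n⌉₊ with hR
  set R' := ⌊α / 2 * R⌋₊ with hR'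
  set N := ⌊μ * n⌋₊ with hN
  set Zb := ⌈2 * (R : ℝ) / α⌉₊ with hZ
  set B := ⌊α / 4 * n⌋₊ with hB
  have m1 : γ * n ≤ m := Nat.le_ceil _
  have m2 : (m : ℝ) < γ * n + 1 := Nat.ceil_lt_add_one (by positivity)
  have r1 : c * n ≤ R := Nat.le_ceil _
  have r2 : (R : ℝ) < c * n + 1 := Nat.ceil_lt_add_one (by positivity)
  have r'1 : (R' : ℝ) ≤ α / 2 * R := Nat.floor_le (by positivity)
  have r'2 : α / 2 * R < R' + 1 := Nat.lt_floor_add_one _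
  have n1 : (N : ℝ) ≤ μ * n := Nat.floor_le (by positivity)
  have n2 : μ * n < N + 1 := Nat.lt_floor_add_one _
  have z1 : 2 * (R : ℝ) / α ≤ Zb := Nat.le_ceil _
  have z2 : (Zb : ℝ) < 2 * (R : ℝ) / α + 1 := Nat.ceil_lt_add_one (by positivity)
  have b1 : (B : ℝ) ≤ α / 4 * n := Nat.floor_le (by positivity)
  have b2 : α / 4 * n < B + 1 := Nat.lt_floor_add_one _
  have hNK : 4 * K ^ 2 * N ≤ α * c / 8 * n := by
    have h := mul_le_mul_of_nonneg_left n1 (by positivity : 0 ≤ 4 * K ^ 2)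
    rw [← hμK]; linarith
  have c1R : K + N * (4 * K ^ 2) + Zb * (4 * K) + 10 * K ^ 2 + 6 * K * (K * m) ≤ B := by
    have t1 : 4 * K * Zb ≤ α * n / 16 + 4 * K * (2 / α + 1) := by
      have h1 : (Zb : ℝ) ≤ 2 * (c * n + 1) / α + 1 := by
        refine z2.le.trans ?_
        gcongr
      have h2 : 4 * K * (2 * (c * n + 1) / α + 1) = (8 * K * c) * n / α + 4 * K * (2 / α + 1) := by
        field_simp; ring
      have h3 : (8 * K * c) * n / α = α * n / 16 := by
        have : 8 * K * c = α ^ 2 / 16 := by linarith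
        rw [this]; field_simp
      rw [← h3, ← h2]
      exact mul_le_mul_of_nonneg_left h1 (by positivity)
    have t2 : 6 * K ^ 2 * m ≤ α / 16 * n + 6 * K ^ 2 := by
      have h1 : 6 * K ^ 2 * m ≤ 6 * K ^ 2 * (γ * n + 1) := mul_le_mul_of_nonneg_left m2.le (by positivity)
      have h2 : 6 * K ^ 2 * γ * n ≤ α / 16 * n := mul_le_mul_of_nonneg_right g1 hn0.le
      linarith
    have t3 : α * c / 8 * n ≤ α / 16 * n := by
      refine mul_le_mul_of_nonneg_right ?_ hn0.le
      have := mul_le_mul_of_nonneg_left hc1 hα.le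
      linarith
    linarith
  have c1N : (j + 1) + N * (4 * (j + 1) ^ 2) + Zb * (4 * (j + 1)) + 10 * (j + 1) ^ 2 + 6 * (j + 1) * ((j + 1) * m) ≤ B := by
    rw [hK] at c1R; exact_mod_cast c1R
  refine ⟨m, R, R', N, 6 * (j + 1) * ((j + 1) * m), Zb, B, m1, ?_, ?_, r'1, b1, ?_, ?_, c1N, ?_, ?_, ?_⟩
  · exact Nat.ceil_pos.2 (by positivity)
  · exact Nat.ceil_pos.2 (by positivity)
  · rw [div_le_iff₀ hα] at z1; linarith
  · have : (B : ℝ) ≤ n := by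
      have : α / 4 * (n : ℝ) ≤ 1 * n := mul_le_mul_of_nonneg_right (by linarith) hn0.le
      linarith
    have hBn : B ≤ n := by exact_mod_cast this
    have : Zb ≤ Zb * (4 * (j + 1)) := Nat.le_mul_of_pos_right _ (by positivity)
    omega
  · have c2R : K + N * (4 * K ^ 2) + 10 * K ^ 2 + K * m ≤ R' := by
      have t1 : K * m ≤ α * c / 8 * n + K := by
        have h1 : K * m ≤ K * (γ * n + 1) := mul_le_mul_of_nonneg_left m2.le (by positivity)
        have h2 : K * γ * n ≤ α * c / 8 * n := mul_le_mul_of_nonneg_right g2 hn0.le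
        linarith
      have t2 : α / 2 * (c * n) ≤ α / 2 * R := mul_le_mul_of_nonneg_left r1 (by positivity)
      linarith
    rw [hK] at c2R; exact_mod_cast c2R
  · exact Nat.le_mul_of_pos_left _ (by omega)
  · rw [Real.norm_of_nonneg (by positivity), Real.norm_of_nonneg (Real.exp_pos _).le] at e3
    have s1 : (1 - d / 2) ^ N ≤ Real.exp (-(d / 2 * N)) := by
      calc (1 - d / 2) ^ N ≤ (Real.exp (-(d / 2))) ^ N := by
            refine pow_le_pow_left₀ (by linarith) ?_ _
            have := Real.add_one_le_exp (-(d / 2))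
            linarith
        _ = _ := by rw [← Real.exp_nat_mul]; congr 1; ring
    have s2 : Real.exp (-(6 * K ^ 2 * m)) ≤ (1 / 2 : ℝ) ^ (6 * (j + 1) * ((j + 1) * m)) := by
      have h1 : Real.exp (-1) ≤ 1 / 2 := by
        rw [Real.exp_neg, one_div]
        refine inv_anti₀ (by norm_num) ?_
        have := Real.add_one_le_exp (1 : ℝ)
        linarith
      calc _ = (Real.exp (-1)) ^ (6 * (j + 1) * ((j + 1) * m)) := by
            rw [← Real.exp_nat_mul]; congr 1; push_cast; rw [hK]; ring
        _ ≤ _ := pow_le_pow_left₀ (Real.exp_pos _).le h1 _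
    refine le_trans ?_ s2
    calc (1 - d / 2) ^ N * (n : ℝ) ^ j ≤ Real.exp (-(d / 2 * N)) * (Real.exp (-(d / 2 + 6 * K ^ 2)) * Real.exp (d * μ / 4 * n)) :=
          mul_le_mul s1 e3 (by positivity) (Real.exp_pos _).le
      _ = Real.exp (-(d / 2 * N) + (-(d / 2 + 6 * K ^ 2) + d * μ / 4 * n)) := by
          rw [Real.exp_add, Real.exp_add]
      _ ≤ _ := by
          refine Real.exp_le_exp.2 ?_
          have h1 : d / 2 * (μ * n) ≤ d / 2 * (N + 1) := mul_le_mul_of_nonneg_left n2.le (by positivity)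
          have h2 : 6 * K ^ 2 * m ≤ 6 * K ^ 2 * (γ * n + 1) := mul_le_mul_of_nonneg_left m2.le (by positivity)
          have h3 : 6 * K ^ 2 * γ * n ≤ d * μ / 4 * n := mul_le_mul_of_nonneg_right g3 hn0.le
          linarith

theorem case_one (j : ℕ) (hj : 2 ≤ j) (α₀ : ℝ) (hα₀ : 0 < α₀) :
    ∃ C : ℕ, 0 < C ∧ ∀ δ : ℝ, 0 < δ → ∃ n₀ : ℕ, ∀ n : ℕ, n₀ ≤ n → j ∣ n →
      ∀ H : Finset (Finset (Fin n)), H ⊆ kSets n (j + 1) →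
        (∀ v : Fin n, α₀ * (n : ℝ) ^ j ≤ (degOf H {v} : ℝ)) →
        ∀ p : ℝ, 0 ≤ p → p ≤ 1 → (C : ℝ) * (n : ℝ) ^ (-(j : ℝ)) ≤ p →
          1 - δ ≤ gProb n (j + 1) p (fun E => IsHamCycle n (j + 1) 1 (H ∪ E)) := by
  obtain ⟨α, hα⟩ : ∃ α : ℝ, α = min α₀ 1 := ⟨_, rfl⟩
  have hα0 : 0 < α := by rw [hα]; positivity
  have hα1 : α ≤ 1 := by rw [hα]; exact min_le_right _ _
  have hαα : α ≤ α₀ := by rw [hα]; exact min_le_left _ _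
  obtain ⟨γ, hγ, hev⟩ := params hα0 hα1 hj
  obtain ⟨C, hC⟩ := exists_nat_ge (((j : ℝ) + 2) / γ ^ (j + 1))
  have hC0 : 0 < C := by
    have : (0 : ℝ) < C := lt_of_lt_of_le (by positivity) hC
    exact_mod_cast this
  refine ⟨C, hC0, fun δ hδ => ?_⟩
  have E1 : ∀ᶠ n : ℕ in Filter.atTop, Real.exp (-(n : ℝ)) ≤ δ := by
    have : Filter.Tendsto (fun n : ℕ => Real.exp (-(n : ℝ))) Filter.atTop (nhds 0) :=
      Real.tendsto_exp_neg_atTop_nhds_zero.comp tendsto_natCast_atTop_atTop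
    exact this.eventually_le_const hδ
  obtain ⟨n₀, hn₀⟩ := Filter.eventually_atTop.1 ((hev.and E1).and (Filter.eventually_ge_atTop 1))
  refine ⟨n₀, fun n hn hjn H hH hdeg p hp0 hp1 hp => ?_⟩
  obtain ⟨⟨⟨m, R, R', N, h0, Zb, B, m1, m2, q1, q2, q3, q4, q5, q6, q7, q8, q9⟩, e1⟩, e2⟩ := hn₀ n hn
  have hn0 : (0 : ℝ) < n := by exact_mod_cast e2
  rw [gProb_eq_bw]
  have h1 := prob_PP n j m p hp0 hp1
  have h2 : bw (kSets n (j + 1)) p (fun E => if PP E j ((j + 1) * m) then (1 : ℝ) else 0) ≤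
      bw (kSets n (j + 1)) p (fun E => if IsHamCycle n (j + 1) 1 (H ∪ E) then (1 : ℝ) else 0) := by
    refine bw_mono hp0 hp1 fun E hE => ?_
    by_cases hPP : PP E j ((j + 1) * m)
    · have := det1 hα0 hα1 hj e2 hjn hH hE
        (fun v => (mul_le_mul_of_nonneg_right hαα (by positivity)).trans (hdeg v)) hPP
        (Nat.mul_pos (by omega) m2) q1 q2 q3 q4 q5 q6 q7 q8 q9
      rw [if_pos hPP, if_pos this]
    · rw [if_neg hPP]; split_ifs <;> norm_num
  have h3 : (2 : ℝ) ^ ((j + 1) * n) * Real.exp (-(p * (m : ℝ) ^ (j + 1))) ≤ δ := by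
    refine le_trans ?_ e1
    have t1 : (2 : ℝ) ^ ((j + 1) * n) ≤ Real.exp (((j : ℝ) + 1) * n) := by
      calc (2 : ℝ) ^ ((j + 1) * n) ≤ (Real.exp 1) ^ ((j + 1) * n) := by
            refine pow_le_pow_left₀ (by norm_num) ?_ _
            have := Real.add_one_le_exp (1 : ℝ)
            linarith
        _ = _ := by rw [← Real.exp_nat_mul]; congr 1; push_cast; ring
    have t2 : ((j : ℝ) + 2) * n ≤ p * (m : ℝ) ^ (j + 1) := by
      have a1 : (n : ℝ) ^ (-(j : ℝ)) * (n : ℝ) ^ (j + 1) = n := by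
        rw [Real.rpow_neg hn0.le, Real.rpow_natCast, pow_succ]; field_simp
      have a2 : ((j : ℝ) + 2) ≤ C * γ ^ (j + 1) := by
        rwa [div_le_iff₀ (by positivity)] at hC
      calc ((j : ℝ) + 2) * n ≤ C * γ ^ (j + 1) * n := mul_le_mul_of_nonneg_right a2 hn0.le
        _ = (C * (n : ℝ) ^ (-(j : ℝ))) * (γ * n) ^ (j + 1) := by
            rw [mul_pow]; nth_rewrite 1 [← a1]; ring
        _ ≤ p * (m : ℝ) ^ (j + 1) := by
            refine mul_le_mul hp (pow_le_pow_left₀ (by positivity) m1 _) (by positivity) hp0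
    calc _ ≤ Real.exp (((j : ℝ) + 1) * n) * Real.exp (-(p * (m : ℝ) ^ (j + 1))) :=
          mul_le_mul_of_nonneg_right t1 (Real.exp_pos _).le
      _ = Real.exp (((j : ℝ) + 1) * n + -(p * (m : ℝ) ^ (j + 1))) := by rw [Real.exp_add]
      _ ≤ _ := Real.exp_le_exp.2 (by linarith)
  linarith

/-- Theorem 2 of the paper. For integers `k ≥ 3`, `1 ≤ ℓ ≤ k-1` and
`α > 0` there are `ε > 0` and an integer `C > 0` such that for all sufficiently large
`n ∈ (k-ℓ)ℕ`, for any `k`-graph `H` on `n` vertices with `δ₁(H) ≥ α n^{k-1}` and any `p`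
with `p ≥ n^{-(k-ℓ)-ε}` (if `ℓ ≥ 2`) resp. `p ≥ C n^{-(k-1)}` (if `ℓ = 1`), a.a.s.
`H ∪ G^{(k)}(n,p)` contains a Hamiltonian `ℓ`-cycle. -/
theorem hamiltonicity_in_randomly_perturbed_hypergraphs
    (k ℓ : ℕ) (hk : 3 ≤ k) (hl1 : 1 ≤ ℓ) (hlk : ℓ ≤ k - 1) (α : ℝ) (hα : 0 < α) :
    ∃ ε : ℝ, 0 < ε ∧ ∃ C : ℕ, 0 < C ∧
      ∀ δ : ℝ, 0 < δ → ∃ n₀ : ℕ, ∀ n : ℕ, n₀ ≤ n → (k - ℓ) ∣ n →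
        ∀ H : Finset (Finset (Fin n)), H ⊆ kSets n k →
          (∀ v : Fin n, α * (n : ℝ) ^ (k - 1) ≤ (degOf H {v} : ℝ)) →
          ∀ p : ℝ, 0 ≤ p → p ≤ 1 →
            ((2 ≤ ℓ → (n : ℝ) ^ (-((k : ℝ) - (ℓ : ℝ)) - ε) ≤ p) ∧
             (ℓ = 1 → (C : ℝ) * (n : ℝ) ^ (-((k : ℝ) - 1)) ≤ p)) →
            1 - δ ≤ gProb n k p (fun E => IsHamCycle n k ℓ (H ∪ E)) := by
  rcases Nat.lt_or_ge ℓ 2 with h | h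
  · have hl : ℓ = 1 := by omega
    subst hl
    obtain ⟨j, rfl⟩ : ∃ j, k = j + 1 := ⟨k - 1, by omega⟩
    obtain ⟨C, hC, hmain⟩ := case_one j (by omega) α hα
    refine ⟨1, one_pos, C, hC, fun δ hδ => ?_⟩
    obtain ⟨n₀, hn₀⟩ := hmain δ hδ
    refine ⟨n₀, fun n hn hd H hH hdeg p hp0 hp1 hp => ?_⟩
    refine hn₀ n hn (by simpa using hd) H hH (by simpa using hdeg) p hp0 hp1 ?_
    have := hp.2 rfl
    rwa [show -((((j + 1 : ℕ) : ℝ)) - 1) = -(j : ℝ) by push_cast; ring] at this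
  · obtain ⟨ε, hε, hmain⟩ := case_ge2 k ℓ h hlk α hα
    refine ⟨ε, hε, 1, one_pos, fun δ hδ => ?_⟩
    obtain ⟨n₀, hn₀⟩ := hmain δ hδ
    exact ⟨n₀, fun n hn hd H hH hdeg p _ hp1 hp => hn₀ n hn hd H hH hdeg p hp1 (hp.1 h)⟩
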